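/- arXiv:1005.1951 — 2 statements merged into one kernel-verified Lean document; each statement's English description precedes it below -/
import Mathlib

section
/- Fix an integer ℓ ≥ 1. For every real x with 0 < x < 1/e, the series S_ℓ(x) := Σ_{n≥1} C(n,n+ℓ)·x^n/n! and S_ℓ^e(x) := Σ_{n≥1} C^e(n,n+ℓ)·x^n/n! converge, S_ℓ(x) > 0, and the ratio S_ℓ^e(x)/S_ℓ(x) tends to 1/2^{ℓ+1} as x tends to 1/e from the left. -/
open Filter

/-- Number of edges of a simple graph. -/
noncomputable def edgeCount {V : Type*} (G : SimpleGraph V) : ℕ := G.edgeSet.ncard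

/-- `G` has no odd cycle. -/
def HasNoOddCycle {V : Type*} (G : SimpleGraph V) : Prop :=
  ∀ (v : V) (w : G.Walk v v), w.IsCycle → Even w.length

/-- `C(k,m)`: the number of connected simple graphs on `{1,…,k}` with exactly `m` edges. -/
noncomputable def Cconn (k m : ℕ) : ℕ :=
  Nat.card {G : SimpleGraph (Fin k) // G.Connected ∧ edgeCount G = m}

/-- `C^e(k,m)`: the number of connected simple graphs on `{1,…,k}` with exactly `m`
edges and no odd cycle. -/
noncomputable def CconnE (k m : ℕ) : ℕ :=
  Nat.card {G : SimpleGraph (Fin k) // G.Connected ∧ edgeCount G = m ∧ HasNoOddCycle G}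

/-- `S_ℓ(x) = Σ_{n} C(n,n+ℓ) x^n / n!` (the `n = 0` term vanishes). -/
noncomputable def Sgen (ℓ : ℕ) (x : ℝ) : ℝ :=
  ∑' n : ℕ, (Cconn n (n + ℓ) : ℝ) * x ^ n / n.factorial

/-- `S^e_ℓ(x) = Σ_{n} C^e(n,n+ℓ) x^n / n!` (the `n = 0` term vanishes). -/
noncomputable def SgenE (ℓ : ℕ) (x : ℝ) : ℝ :=
  ∑' n : ℕ, (CconnE n (n + ℓ) : ℝ) * x ^ n / n.factorial

section MultiplicativeWeights

/-- A graph weight that is invariant under isomorphism and multiplicative over disjoint unions. -/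
structure IsMulWeight {R : Type*} [CommRing R]
    (ω : ∀ (V : Type) [Fintype V], SimpleGraph V → R) : Prop where
  iso : ∀ (V W : Type) [Fintype V] [Fintype W] (G : SimpleGraph V) (G' : SimpleGraph W),
    (G ≃g G') → ω V G = ω W G'
  mul : ∀ (V : Type) [Fintype V] [DecidableEq V] (G : SimpleGraph V) (S : Finset V),
    (∀ a ∈ S, ∀ b ∉ S, ¬ G.Adj a b) →
      ω V G = ω S (G.induce (S : Set V)) * ω (Sᶜ : Finset V) (G.induce ((Sᶜ : Finset V) : Set V))

variable {R : Type*} [CommRing R] (ω : ∀ (V : Type) [Fintype V], SimpleGraph V → R)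

open scoped Classical in
/-- Total weight of all graphs on `V`. -/
noncomputable def totalWeight (V : Type) [Fintype V] : R := ∑ G : SimpleGraph V, ω V G

open scoped Classical in
/-- Total weight of the connected graphs on `V`. -/
noncomputable def connWeight (V : Type) [Fintype V] : R :=
  ∑ G : SimpleGraph V with G.Connected, ω V G

variable {ω}

theorem totalWeight_congr (hω : IsMulWeight ω) {V W : Type} [Fintype V] [Fintype W] (e : V ≃ W) :
    totalWeight ω V = totalWeight ω W := by
  classical
  unfold totalWeight
  refine Fintype.sum_equiv e.simpleGraph _ _ fun G => ?_
  exact hω.iso _ _ _ _ (SimpleGraph.Iso.comap e.symm G).symm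

theorem connWeight_congr (hω : IsMulWeight ω) {V W : Type} [Fintype V] [Fintype W] (e : V ≃ W) :
    connWeight ω V = connWeight ω W := by
  classical
  unfold connWeight
  refine Finset.sum_equiv e.simpleGraph (fun G => ?_) fun G _ => ?_
  · simp only [Finset.mem_filter, Finset.mem_univ, true_and]
    exact (SimpleGraph.Iso.comap e.symm G).symm.connected_iff
  · exact hω.iso _ _ _ _ (SimpleGraph.Iso.comap e.symm G).symm

/-- The union of a graph on `S` and a graph on its complement. -/
def glue {V : Type} [Fintype V] [DecidableEq V] (S : Finset V) (G₁ : SimpleGraph S)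
    (G₂ : SimpleGraph (Sᶜ : Finset V)) : SimpleGraph V :=
  G₁.map (Function.Embedding.subtype _) ⊔ G₂.map (Function.Embedding.subtype _)

section Glue

variable {V : Type} [Fintype V] [DecidableEq V] {S : Finset V}

theorem glue_adj {G₁ : SimpleGraph S} {G₂ : SimpleGraph (Sᶜ : Finset V)} {a b : V} :
    (glue S G₁ G₂).Adj a b ↔
      (∃ (ha : a ∈ S) (hb : b ∈ S), G₁.Adj ⟨a, ha⟩ ⟨b, hb⟩) ∨
      (∃ (ha : a ∈ Sᶜ) (hb : b ∈ Sᶜ), G₂.Adj ⟨a, ha⟩ ⟨b, hb⟩) := by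
  unfold glue
  simp only [SimpleGraph.sup_adj, SimpleGraph.map_adj, Function.Embedding.subtype_apply]
  constructor
  · rintro (⟨u, v, h, rfl, rfl⟩ | ⟨u, v, h, rfl, rfl⟩)
    · exact Or.inl ⟨u.2, v.2, h⟩
    · exact Or.inr ⟨u.2, v.2, h⟩
  · rintro (⟨ha, hb, h⟩ | ⟨ha, hb, h⟩)
    · exact Or.inl ⟨_, _, h, rfl, rfl⟩
    · exact Or.inr ⟨_, _, h, rfl, rfl⟩

theorem glue_not_adj {G₁ : SimpleGraph S} {G₂ : SimpleGraph (Sᶜ : Finset V)} {a b : V}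
    (ha : a ∈ S) (hb : b ∉ S) : ¬ (glue S G₁ G₂).Adj a b := by
  rw [glue_adj]
  rintro (⟨_, h, _⟩ | ⟨h, _, _⟩)
  · exact hb h
  · simp [ha] at h

theorem induce_glue_left (G₁ : SimpleGraph S) (G₂ : SimpleGraph (Sᶜ : Finset V)) :
    (glue S G₁ G₂).induce (S : Set V) = G₁ := by
  ext a b
  have h1 : (a : V) ∈ S := a.2
  have h2 : (b : V) ∈ S := b.2
  simp only [SimpleGraph.induce_adj, glue_adj]
  constructor
  · rintro (⟨_, _, h⟩ | ⟨h, _, _⟩)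
    · exact h
    · simp [h1] at h
  · intro h
    exact Or.inl ⟨h1, h2, h⟩

theorem induce_glue_right (G₁ : SimpleGraph S) (G₂ : SimpleGraph (Sᶜ : Finset V)) :
    (glue S G₁ G₂).induce ((Sᶜ : Finset V) : Set V) = G₂ := by
  ext a b
  have h1 : (a : V) ∈ Sᶜ := a.2
  have h2 : (b : V) ∈ Sᶜ := b.2
  have h1' : (a : V) ∉ S := Finset.mem_compl.1 h1
  simp only [SimpleGraph.induce_adj, glue_adj]
  constructor
  · rintro (⟨h, _, _⟩ | ⟨_, _, h⟩)
    · exact absurd h h1'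
    · exact h
  · intro h
    exact Or.inr ⟨h1, h2, h⟩

theorem glue_induce (G : SimpleGraph V) (h : ∀ a ∈ S, ∀ b ∉ S, ¬ G.Adj a b) :
    glue S (G.induce (S : Set V)) (G.induce ((Sᶜ : Finset V) : Set V)) = G := by
  ext a b
  rw [glue_adj]
  simp only [SimpleGraph.comap_adj, Function.Embedding.subtype_apply]
  constructor
  · rintro (⟨_, _, h⟩ | ⟨_, _, h⟩) <;> exact h
  · intro hab
    by_cases ha : a ∈ S
    · by_cases hb : b ∈ S
      · exact Or.inl ⟨ha, hb, hab⟩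
      · exact absurd hab (h a ha b hb)
    · by_cases hb : b ∈ S
      · exact absurd hab.symm (h b hb a ha)
      · exact Or.inr ⟨by simpa using ha, by simpa using hb, hab⟩

end Glue

/-- The vertex set of the component of `r`. -/
noncomputable def compOf {V : Type} [Fintype V] (G : SimpleGraph V) (r : V) : Finset V :=
  by classical exact Finset.univ.filter fun v => G.Reachable r v

theorem mem_compOf {V : Type} [Fintype V] {G : SimpleGraph V} {r v : V} :
    v ∈ compOf G r ↔ G.Reachable r v := by
  classical
  simp [compOf]

theorem compOf_not_adj {V : Type} [Fintype V] {G : SimpleGraph V} {r : V} :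
    ∀ a ∈ compOf G r, ∀ b ∉ compOf G r, ¬ G.Adj a b := by
  intro a ha b hb hab
  rw [mem_compOf] at ha hb
  exact hb (ha.trans hab.reachable)

theorem induce_compOf_connected {V : Type} [Fintype V] (G : SimpleGraph V) (r : V) :
    (G.induce (compOf G r : Set V)).Connected := by
  have h : (compOf G r : Set V) = (G.connectedComponentMk r).supp := by
    ext v
    simp only [Finset.mem_coe, mem_compOf, SimpleGraph.ConnectedComponent.mem_supp_iff,
      SimpleGraph.ConnectedComponent.eq]
    exact ⟨fun h => h.symm, fun h => h.symm⟩
  rw [h]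
  exact (G.connectedComponentMk r).connected_toSimpleGraph

theorem compOf_glue {V : Type} [Fintype V] [DecidableEq V] {S : Finset V} {r : V} (hr : r ∈ S)
    {G₁ : SimpleGraph S} (G₂ : SimpleGraph (Sᶜ : Finset V)) (h : G₁.Connected) :
    compOf (glue S G₁ G₂) r = S := by
  ext v
  rw [mem_compOf]
  constructor
  · rintro ⟨p⟩
    clear h
    induction p with
    | nil => exact hr
    | @cons u w v hadj p ih =>
      refine ih ?_
      by_contra hw
      exact glue_not_adj hr hw hadj
  · intro hv
    obtain ⟨p⟩ := h.preconnected ⟨r, hr⟩ ⟨v, hv⟩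
    let f : G₁ →g glue S G₁ G₂ :=
      ⟨Subtype.val, fun {a b} hab => glue_adj.2 (Or.inl ⟨a.2, b.2, hab⟩)⟩
    exact ⟨p.map f⟩

theorem totalWeight_eq_sum_comp (hω : IsMulWeight ω) (V : Type) [Fintype V] [DecidableEq V]
    (r : V) :
    totalWeight ω V = ∑ S : Finset V with r ∈ S,
      connWeight ω S * totalWeight ω (Sᶜ : Finset V) := by
  classical
  unfold totalWeight
  trans ∑ S : Finset V with r ∈ S, ∑ G : SimpleGraph V with compOf G r = S, ω V G
  swap
  · refine Finset.sum_congr rfl fun S hS => ?_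
    simp only [Finset.mem_filter, Finset.mem_univ, true_and] at hS
    unfold connWeight
    rw [Finset.sum_mul_sum, ← Finset.sum_product']
    symm
    refine Finset.sum_bij' (i := fun p _ => glue S p.1 p.2)
      (j := fun G _ => (G.induce (S : Set V), G.induce ((Sᶜ : Finset V) : Set V))) ?_ ?_ ?_ ?_ ?_
    · rintro ⟨G₁, G₂⟩ h
      simp only [Finset.mem_product, Finset.mem_filter, Finset.mem_univ, true_and, and_true] at h
      simp only [Finset.mem_filter, Finset.mem_univ, true_and]
      exact compOf_glue hS G₂ h
    · intro G h
      simp only [Finset.mem_filter, Finset.mem_univ, true_and] at h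
      simp only [Finset.mem_product, Finset.mem_filter, Finset.mem_univ, true_and, and_true]
      have := induce_compOf_connected G r
      rw [h] at this
      exact this
    · rintro ⟨G₁, G₂⟩ h
      exact Prod.ext (induce_glue_left _ _) (induce_glue_right _ _)
    · intro G h
      simp only [Finset.mem_filter, Finset.mem_univ, true_and] at h
      refine glue_induce G ?_
      rw [← h]
      exact compOf_not_adj
    · rintro ⟨G₁, G₂⟩ h
      have := hω.mul V (glue S G₁ G₂) S fun a ha b hb => glue_not_adj ha hb
      rw [induce_glue_left, induce_glue_right] at this
      exact this.symm
  · have h := Finset.sum_fiberwise_of_maps_to (s := (Finset.univ : Finset (SimpleGraph V)))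
      (t := Finset.univ.filter fun S : Finset V => r ∈ S) (g := fun G => compOf G r)
      (fun G _ => by simp [mem_compOf]) (fun G => ω V G)
    convert h.symm

theorem card_mul_totalWeight (hω : IsMulWeight ω) (n : ℕ) :
    (n : R) * totalWeight ω (Fin n) = ∑ k ∈ Finset.range (n + 1),
      (n.choose k : R) * ((k : R) * connWeight ω (Fin k) * totalWeight ω (Fin (n - k))) := by
  classical
  have h1 : (n : R) * totalWeight ω (Fin n) = ∑ r : Fin n, ∑ S : Finset (Fin n) with r ∈ S,
      connWeight ω S * totalWeight ω (Sᶜ : Finset (Fin n)) := by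
    rw [← Finset.sum_congr rfl fun r _ => totalWeight_eq_sum_comp hω (Fin n) r]
    simp
  rw [h1]
  simp only [Finset.sum_filter]
  rw [Finset.sum_comm]
  have h2 : ∀ S : Finset (Fin n), (∑ r : Fin n, if r ∈ S then
      connWeight ω S * totalWeight ω (Sᶜ : Finset (Fin n)) else 0) =
      (S.card : R) * connWeight ω (Fin S.card) * totalWeight ω (Fin (n - S.card)) := by
    intro S
    rw [Finset.sum_ite_mem, Finset.univ_inter, Finset.sum_const, nsmul_eq_mul, mul_assoc,
      connWeight_congr hω S.equivFin,
      totalWeight_congr hω ((Sᶜ : Finset (Fin n)).equivFinOfCardEq (n := n - S.card) (by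
        rw [Finset.card_compl, Fintype.card_fin]))]
  rw [Finset.sum_congr rfl fun S _ => h2 S]
  have := Finset.sum_powerset_apply_card
    (fun k => (k : R) * connWeight ω (Fin k) * totalWeight ω (Fin (n - k)))
    (x := (Finset.univ : Finset (Fin n)))
  rw [Finset.powerset_univ, Finset.card_fin] at this
  rw [this]
  exact Finset.sum_congr rfl fun k _ => by rw [nsmul_eq_mul]

end MultiplicativeWeights

section EdgeWeights

open Polynomial

theorem edgeCount_congr {V W : Type*} {G : SimpleGraph V} {G' : SimpleGraph W} (e : G ≃g G') :
    edgeCount G = edgeCount G' := by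
  unfold edgeCount
  rw [← Nat.card_coe_set_eq, ← Nat.card_coe_set_eq]
  exact Nat.card_congr e.mapEdgeSet

theorem edgeCount_map {V W : Type*} (f : V ↪ W) (G : SimpleGraph V) :
    edgeCount (G.map f) = edgeCount G := by
  unfold edgeCount
  rw [SimpleGraph.edgeSet_map, Set.ncard_image_of_injective _ f.sym2Map.injective]

theorem edgeCount_glue {V : Type} [Fintype V] [DecidableEq V] (S : Finset V) (G₁ : SimpleGraph S)
    (G₂ : SimpleGraph (Sᶜ : Finset V)) :
    edgeCount (glue S G₁ G₂) = edgeCount G₁ + edgeCount G₂ := by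
  rw [← edgeCount_map (Function.Embedding.subtype _) G₁,
    ← edgeCount_map (Function.Embedding.subtype _) G₂]
  unfold edgeCount glue
  rw [SimpleGraph.edgeSet_sup, Set.ncard_union_eq _ (Set.toFinite _) (Set.toFinite _)]
  rw [Set.disjoint_left]
  intro e
  induction e with
  | _ a b =>
    simp only [SimpleGraph.mem_edgeSet, SimpleGraph.map_adj, Function.Embedding.subtype_apply]
    rintro ⟨u, v, -, rfl, rfl⟩ ⟨u', v', -, h, -⟩
    have := u'.2
    rw [h] at this
    exact Finset.mem_compl.1 this u.2

theorem edgeCount_of_no_cross {V : Type} [Fintype V] [DecidableEq V] (G : SimpleGraph V)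
    (S : Finset V) (h : ∀ a ∈ S, ∀ b ∉ S, ¬ G.Adj a b) :
    edgeCount G = edgeCount (G.induce (S : Set V)) +
      edgeCount (G.induce ((Sᶜ : Finset V) : Set V)) := by
  conv_lhs => rw [← glue_induce G h]
  exact edgeCount_glue S _ _

open scoped Classical in
/-- The generating polynomial of proper 2-colourings by size of a colour class. -/
noncomputable def bicolorPoly {V : Type} [Fintype V] (G : SimpleGraph V) : ℝ[X] :=
  ∑ σ : V → Bool with ∀ a b, G.Adj a b → σ a ≠ σ b, ∏ v, if σ v then X else 1

theorem bicolorPoly_congr {V W : Type} [Fintype V] [Fintype W] {G : SimpleGraph V}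
    {G' : SimpleGraph W} (e : G ≃g G') : bicolorPoly G = bicolorPoly G' := by
  classical
  unfold bicolorPoly
  refine Finset.sum_equiv (Equiv.arrowCongr e.toEquiv (Equiv.refl Bool)) (fun σ => ?_)
    fun σ _ => ?_
  · simp only [Finset.mem_filter, Finset.mem_univ, true_and]
    constructor
    · intro h a b hab
      exact h _ _ (e.symm.map_adj_iff.2 hab)
    · intro h a b hab
      have := h (e a) (e b) (e.map_adj_iff.2 hab)
      have he : ∀ v, e.toEquiv.symm (e v) = v := e.toEquiv.symm_apply_apply
      simpa only [Equiv.arrowCongr_apply, Function.comp_apply, Equiv.coe_refl, id_eq, he]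
        using this
  · refine Fintype.prod_equiv e.toEquiv _ _ fun v => ?_
    simp only [Equiv.arrowCongr_apply, Function.comp_apply, Equiv.coe_refl, id_eq,
      Equiv.symm_apply_apply]

theorem bicolorPoly_of_no_cross {V : Type} [Fintype V] [DecidableEq V] (G : SimpleGraph V)
    (S : Finset V) (h : ∀ a ∈ S, ∀ b ∉ S, ¬ G.Adj a b) :
    bicolorPoly G = bicolorPoly (V := S) (G.induce (S : Set V)) *
      bicolorPoly (V := (Sᶜ : Finset V)) (G.induce ((Sᶜ : Finset V) : Set V)) := by
  classical
  unfold bicolorPoly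
  rw [Finset.sum_mul_sum, ← Finset.sum_product']
  refine Finset.sum_bij' (fun σ _ => (fun v => σ v, fun v => σ v))
    (fun p _ v => if hv : v ∈ S then p.1 ⟨v, hv⟩ else p.2 ⟨v, Finset.mem_compl.2 hv⟩)
    ?_ ?_ ?_ ?_ ?_
  · intro σ hσ
    simp only [Finset.mem_filter, Finset.mem_univ, true_and, Finset.mem_product] at hσ ⊢
    exact ⟨fun a b hab => hσ _ _ hab, fun a b hab => hσ _ _ hab⟩
  · intro p hp
    simp only [Finset.mem_filter, Finset.mem_univ, true_and, Finset.mem_product] at hp ⊢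
    intro a b hab
    by_cases ha : a ∈ S <;> by_cases hb : b ∈ S
    · simp only [ha, hb, dif_pos]
      exact hp.1 ⟨a, ha⟩ ⟨b, hb⟩ hab
    · exact absurd hab (h a ha b hb)
    · exact absurd hab.symm (h b hb a ha)
    · simp only [ha, hb, dif_neg, not_false_eq_true]
      exact hp.2 ⟨a, Finset.mem_compl.2 ha⟩ ⟨b, Finset.mem_compl.2 hb⟩ hab
  · intro σ _
    ext v
    by_cases hv : v ∈ S <;> simp [hv]
  · intro p _
    ext v
    · have : (v : V) ∈ S := v.2
      simp
    · have : (v : V) ∉ S := Finset.mem_compl.1 v.2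
      simp [this]
  · intro σ _
    rw [← Finset.prod_mul_prod_compl S, ← Finset.prod_coe_sort S,
      ← Finset.prod_coe_sort (Sᶜ : Finset V)]

/-- The edge-counting weight. -/
noncomputable def edgeWeight (V : Type) [Fintype V] (G : SimpleGraph V) : ℝ[X] := X ^ edgeCount G

/-- The weight counting edges and proper 2-colourings. -/
noncomputable def biWeight (V : Type) [Fintype V] (G : SimpleGraph V) : ℝ[X][X] :=
  X ^ edgeCount G * C (bicolorPoly G)

theorem isMulWeight_edgeWeight : IsMulWeight edgeWeight where
  iso V W _ _ G G' e := by simp [edgeWeight, edgeCount_congr e]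
  mul V _ _ G S h := by simp only [edgeWeight, ← pow_add, edgeCount_of_no_cross G S h]

theorem isMulWeight_biWeight : IsMulWeight biWeight where
  iso V W _ _ G G' e := by simp [biWeight, edgeCount_congr e, bicolorPoly_congr e]
  mul V _ _ G S h := by
    simp only [biWeight]
    rw [edgeCount_of_no_cross G S h, bicolorPoly_of_no_cross G S h, pow_add, C_mul]
    ring

open scoped Classical in
theorem sum_le_pow_edgeCount {V : Type} [Fintype V] {R : Type*} [CommRing R] (H : SimpleGraph V) :
    ∑ G : SimpleGraph V with G ≤ H, (X : R[X]) ^ edgeCount G = (1 + X) ^ edgeCount H := by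
  have hc : edgeCount H = H.edgeFinset.card := by
    unfold edgeCount
    rw [← SimpleGraph.coe_edgeFinset, Set.ncard_coe_finset]
  rw [hc, add_comm, ← Finset.sum_pow_mul_eq_add_pow]
  refine Finset.sum_bij' (fun G _ => G.edgeFinset) (fun s _ => SimpleGraph.fromEdgeSet (s : Set _))
    ?_ ?_ ?_ ?_ ?_
  · intro G hG
    simp only [Finset.mem_filter, Finset.mem_univ, true_and, Finset.mem_powerset] at hG ⊢
    exact SimpleGraph.edgeFinset_subset_edgeFinset.2 hG
  · intro s hs
    simp only [Finset.mem_filter, Finset.mem_univ, true_and, Finset.mem_powerset] at hs ⊢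
    intro a b hab
    rw [SimpleGraph.fromEdgeSet_adj] at hab
    simpa using hs hab.1
  · intro G _
    simp
  · intro s hs
    rw [Finset.mem_powerset] at hs
    ext e
    simp only [SimpleGraph.mem_edgeFinset, SimpleGraph.edgeSet_fromEdgeSet, Set.mem_sdiff,
      Finset.mem_coe, Sym2.mem_diagSet]
    refine ⟨fun h => h.1, fun h => ⟨h, ?_⟩⟩
    exact SimpleGraph.not_isDiag_of_mem_edgeFinset (hs h)
  · intro G _
    have : edgeCount G = G.edgeFinset.card := by
      unfold edgeCount
      rw [← SimpleGraph.coe_edgeFinset, Set.ncard_coe_finset]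
    simp [this]

theorem totalWeight_edgeWeight (n : ℕ) :
    totalWeight edgeWeight (Fin n) = (1 + X) ^ n.choose 2 := by
  classical
  have h := sum_le_pow_edgeCount (R := ℝ) (⊤ : SimpleGraph (Fin n))
  have hc : edgeCount (⊤ : SimpleGraph (Fin n)) = n.choose 2 := by
    unfold edgeCount
    rw [← SimpleGraph.coe_edgeFinset, Set.ncard_coe_finset,
      SimpleGraph.card_edgeFinset_top_eq_card_choose_two, Fintype.card_fin]
  rw [hc] at h
  rw [← h]
  unfold totalWeight edgeWeight
  refine Finset.sum_congr ?_ fun _ _ => rfl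
  ext
  simp

end EdgeWeights

section TotalBiWeight

open Polynomial

/-- The complete bipartite graph between the two colour classes of `σ`. -/
def bicliqueOf {V : Type} (σ : V → Bool) : SimpleGraph V where
  Adj a b := σ a ≠ σ b
  symm := ⟨fun _ _ h => h.symm⟩
  loopless := ⟨fun _ h => h rfl⟩

theorem edgeCount_bicliqueOf {V : Type} [Fintype V] (σ : V → Bool) :
    edgeCount (bicliqueOf σ) = (Finset.univ.filter fun v => σ v = true).card *
      (Fintype.card V - (Finset.univ.filter fun v => σ v = true).card) := by
  classical
  set A := Finset.univ.filter fun v => σ v = true with hA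
  rw [← Finset.card_compl, ← Finset.card_product]
  have hinj : Set.InjOn (fun p : V × V => s(p.1, p.2)) (A ×ˢ Aᶜ : Finset (V × V)) := by
    rintro ⟨a, b⟩ h ⟨c, d⟩ h' hab
    simp only [Finset.coe_product, Set.mem_prod, Finset.mem_coe, Finset.mem_compl, hA,
      Finset.mem_filter, Finset.mem_univ, true_and] at h h'
    simp only [Sym2.eq_iff] at hab
    rcases hab with ⟨rfl, rfl⟩ | ⟨rfl, rfl⟩
    · rfl
    · exact absurd h.1 h'.2
  rw [← Set.ncard_coe_finset, ← hinj.ncard_image]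
  unfold edgeCount
  congr 1
  ext e
  induction e with
  | _ a b =>
    simp only [SimpleGraph.mem_edgeSet, bicliqueOf, Set.mem_image, Finset.coe_product,
      Set.mem_prod, Finset.mem_coe, Finset.mem_compl, hA, Finset.mem_filter, Finset.mem_univ,
      true_and, Prod.exists, Sym2.eq_iff]
    constructor
    · intro h
      cases ha : σ a <;> cases hb : σ b
      · simp [ha, hb] at h
      · exact ⟨b, a, ⟨hb, by simp [ha]⟩, Or.inr ⟨rfl, rfl⟩⟩
      · exact ⟨a, b, ⟨ha, by simp [hb]⟩, Or.inl ⟨rfl, rfl⟩⟩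
      · simp [ha, hb] at h
    · rintro ⟨c, d, ⟨hc, hd⟩, ⟨rfl, rfl⟩ | ⟨rfl, rfl⟩⟩
      · rw [hc]; exact fun h => hd h.symm
      · rw [hc]; exact hd

theorem totalWeight_biWeight (n : ℕ) :
    totalWeight biWeight (Fin n) = ∑ σ : Fin n → Bool,
      C (X ^ (Finset.univ.filter fun v => σ v = true).card) *
        (1 + X) ^ ((Finset.univ.filter fun v => σ v = true).card *
          (n - (Finset.univ.filter fun v => σ v = true).card)) := by
  classical
  unfold totalWeight biWeight bicolorPoly
  simp only [map_sum, Finset.mul_sum, Finset.sum_filter]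
  rw [Finset.sum_comm]
  refine Finset.sum_congr (by ext; simp) fun σ _ => ?_
  have h := sum_le_pow_edgeCount (R := ℝ[X]) (bicliqueOf σ)
  rw [edgeCount_bicliqueOf, Fintype.card_fin] at h
  rw [← h, Finset.mul_sum, Finset.sum_filter]
  refine Finset.sum_congr (by ext; simp) fun G _ => ?_
  have hp : (∏ v, if σ v = true then (X : ℝ[X]) else 1) =
      X ^ (Finset.univ.filter fun v => σ v = true).card := by
    rw [Finset.prod_ite, Finset.prod_const, Finset.prod_const_one, mul_one]
  have hle : (∀ a b, G.Adj a b → σ a ≠ σ b) ↔ G ≤ bicliqueOf σ :=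
    ⟨fun h a b => h a b, fun h a b => @h a b⟩
  by_cases hG : G ≤ bicliqueOf σ
  · rw [if_pos hG, if_pos (hle.2 hG), hp, mul_comm]
  · rw [if_neg hG, if_neg (fun h => hG (hle.1 h)), C_0, mul_zero]

/-- `Y d/dY` on polynomials. -/
noncomputable def eulerDeriv : Derivation ℝ ℝ[X] ℝ[X] := (X : ℝ[X]) • derivative'

theorem eulerDeriv_apply (p : ℝ[X]) : eulerDeriv p = X * derivative p := rfl

theorem eulerDeriv_X_pow (a : ℕ) : eulerDeriv (X ^ a : ℝ[X]) = (a : ℝ[X]) * X ^ a := by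
  rw [eulerDeriv_apply, derivative_X_pow]
  cases a with
  | zero => simp
  | succ a => simp [pow_succ]; ring

/-- `(1 + X) d/dX` on polynomials. -/
noncomputable def shiftDeriv (R : Type*) [CommRing R] : Derivation R R[X] R[X] :=
  (1 + X : R[X]) • derivative'

theorem shiftDeriv_apply {R : Type*} [CommRing R] (p : R[X]) :
    shiftDeriv R p = (1 + X) * derivative p := rfl

theorem shiftDeriv_pow {R : Type*} [CommRing R] (a : ℕ) :
    shiftDeriv R ((1 + X) ^ a) = (a : R[X]) * (1 + X) ^ a := by
  rw [shiftDeriv_apply, derivative_pow]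
  cases a with
  | zero => simp
  | succ a => simp [pow_succ]; ring

/-- The coefficientwise extension of a derivation to polynomials. -/
noncomputable def polyCoeffDeriv {A : Type*} [CommRing A] [Algebra ℝ A] (d : Derivation ℝ A A) :
    Derivation ℝ A[X] A[X] :=
  Derivation.mk'
    { toFun := fun p => ∑ n ∈ p.support, monomial n (d (p.coeff n))
      map_add' := fun p q => by
        ext n
        simp only [finsetSum_coeff, coeff_monomial, coeff_add, Finset.sum_ite_eq', mem_support_iff]
        split_ifs <;> simp_all [← map_add]
      map_smul' := fun c p => by
        ext n
        simp only [finsetSum_coeff, coeff_monomial, coeff_smul, Finset.sum_ite_eq',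
          mem_support_iff, RingHom.id_apply]
        split_ifs <;> simp_all }
    (fun p q => by
      have key : ∀ (r : A[X]) (n : ℕ),
          (∑ n ∈ r.support, monomial n (d (r.coeff n))).coeff n = d (r.coeff n) := by
        intro r n
        simp only [finsetSum_coeff, coeff_monomial, Finset.sum_ite_eq', mem_support_iff]
        split_ifs <;> simp_all
      ext n
      simp only [LinearMap.coe_mk, AddHom.coe_mk]
      rw [key]
      simp only [smul_eq_mul, coeff_add, coeff_mul, key, map_sum, Derivation.leibniz,
        Finset.sum_add_distrib]
      congr 1
      rw [← Finset.Nat.sum_antidiagonal_swap]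
      rfl)

theorem coeff_polyCoeffDeriv {A : Type*} [CommRing A] [Algebra ℝ A] (d : Derivation ℝ A A)
    (p : A[X]) (n : ℕ) : (polyCoeffDeriv d p).coeff n = d (p.coeff n) := by
  change (∑ n ∈ p.support, monomial n (d (p.coeff n))).coeff n = d (p.coeff n)
  simp only [finsetSum_coeff, coeff_monomial, Finset.sum_ite_eq', mem_support_iff]
  split_ifs <;> simp_all

theorem polyCoeffDeriv_C {A : Type*} [CommRing A] [Algebra ℝ A] (d : Derivation ℝ A A) (a : A) :
    polyCoeffDeriv d (C a) = C (d a) := by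
  ext n
  rw [coeff_polyCoeffDeriv, coeff_C, coeff_C]
  split_ifs <;> simp

theorem polyCoeffDeriv_X {A : Type*} [CommRing A] [Algebra ℝ A] (d : Derivation ℝ A A) :
    polyCoeffDeriv d X = 0 := by
  ext n
  rw [coeff_polyCoeffDeriv, coeff_X]
  split_ifs <;> simp

theorem polyCoeffDeriv_one_add_X_pow {A : Type*} [CommRing A] [Algebra ℝ A]
    (d : Derivation ℝ A A) (m : ℕ) : polyCoeffDeriv d ((1 + X) ^ m) = 0 := by
  rw [Derivation.leibniz_pow, map_add, polyCoeffDeriv_X]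
  simp

theorem shiftDeriv_totalWeight_biWeight (n : ℕ) :
    shiftDeriv ℝ[X] (totalWeight biWeight (Fin n)) =
      (n : ℝ[X][X]) * polyCoeffDeriv eulerDeriv (totalWeight biWeight (Fin n)) -
      polyCoeffDeriv eulerDeriv (polyCoeffDeriv eulerDeriv (totalWeight biWeight (Fin n))) := by
  rw [totalWeight_biWeight]
  simp only [map_sum, Finset.mul_sum, ← Finset.sum_sub_distrib]
  refine Finset.sum_congr rfl fun σ _ => ?_
  set a := (Finset.univ.filter fun v => σ v = true).card
  have ha : a ≤ n := by
    simpa using Finset.card_filter_le (Finset.univ : Finset (Fin n)) fun v => σ v = true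
  have h1 : polyCoeffDeriv eulerDeriv (C (X ^ a) * (1 + X) ^ (a * (n - a)) : ℝ[X][X]) =
      (a : ℝ[X][X]) * (C (X ^ a) * (1 + X) ^ (a * (n - a))) := by
    rw [Derivation.leibniz, polyCoeffDeriv_one_add_X_pow, polyCoeffDeriv_C, eulerDeriv_X_pow]
    simp only [smul_eq_mul, mul_zero, zero_add, C_mul, map_natCast]
    ring
  have h2 : ∀ p : ℝ[X][X], polyCoeffDeriv eulerDeriv ((a : ℝ[X][X]) * p) =
      (a : ℝ[X][X]) * polyCoeffDeriv eulerDeriv p := by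
    intro p
    rw [Derivation.leibniz, Derivation.map_natCast, smul_zero, add_zero, smul_eq_mul]
  have h3 : shiftDeriv ℝ[X] (C (X ^ a) * (1 + X) ^ (a * (n - a))) =
      ((a * (n - a) : ℕ) : ℝ[X][X]) * (C (X ^ a) * (1 + X) ^ (a * (n - a))) := by
    rw [Derivation.leibniz, shiftDeriv_pow, shiftDeriv_apply, derivative_C]
    simp only [smul_eq_mul]
    ring
  rw [h3, h1, h2, h1, Nat.cast_mul, Nat.cast_sub ha]
  ring

theorem shiftDeriv_totalWeight_edgeWeight (n : ℕ) :
    shiftDeriv ℝ (totalWeight edgeWeight (Fin n)) =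
      (n.choose 2 : ℝ[X]) * totalWeight edgeWeight (Fin n) := by
  rw [totalWeight_edgeWeight, shiftDeriv_pow]

end TotalBiWeight

section ConnectedCoefficients

open Polynomial

theorem exists_bool_coloring {V : Type} {G : SimpleGraph V} (hG : G.Connected)
    (h : HasNoOddCycle G) : ∃ σ : V → Bool, ∀ a b, G.Adj a b → σ a ≠ σ b := by
  obtain ⟨T, hTG, hT⟩ := hG.exists_isTree_le
  obtain ⟨c⟩ : Nonempty (T.Coloring Bool) := by
    obtain ⟨c⟩ := hT.colorable_two
    exact ⟨SimpleGraph.Coloring.mk (fun v => decide (c v = 0)) fun {a b} hab => by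
      have := c.valid hab
      intro h
      rw [decide_eq_decide] at h
      omega⟩
  refine ⟨c, fun a b hab hc => ?_⟩
  obtain ⟨p, hp⟩ := hT.1.exists_isPath b a
  have he : Even p.length := (c.even_length_iff_congr p).2 (by rw [hc])
  have hnT : s(a, b) ∉ p.edges := fun hmem => c.valid (p.adj_of_mem_edges hmem) hc
  have hcyc : (SimpleGraph.Walk.cons hab (p.mapLe hTG)).IsCycle := by
    rw [SimpleGraph.Walk.cons_isCycle_iff]
    exact ⟨hp.mapLe hTG, by simpa using hnT⟩
  have := h _ _ hcyc
  rw [SimpleGraph.Walk.length_cons, SimpleGraph.Walk.length_map, Nat.even_add_one] at this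
  exact this he

theorem hasNoOddCycle_of_bool_coloring {V : Type} {G : SimpleGraph V} {σ : V → Bool}
    (h : ∀ a b, G.Adj a b → σ a ≠ σ b) : HasNoOddCycle G := fun _ w _ =>
  ((SimpleGraph.Coloring.mk σ fun {a b} hab => h a b hab : G.Coloring Bool).even_length_iff_congr
    w).2 Iff.rfl

theorem bool_coloring_unique {V : Type} {G : SimpleGraph V} (hG : G.Connected) {σ τ : V → Bool}
    (h : ∀ a b, G.Adj a b → σ a ≠ σ b) (h' : ∀ a b, G.Adj a b → τ a ≠ τ b) :
    τ = σ ∨ τ = fun v => !σ v := by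
  obtain ⟨r⟩ := hG.nonempty
  have key : ∀ v, (σ r = σ v ↔ τ r = τ v) := by
    intro v
    obtain ⟨p⟩ := hG.preconnected r v
    have h1 := (SimpleGraph.Coloring.mk σ fun {a b} hab => h a b hab :
      G.Coloring Bool).even_length_iff_congr p
    have h2 := (SimpleGraph.Coloring.mk τ fun {a b} hab => h' a b hab :
      G.Coloring Bool).even_length_iff_congr p
    rw [h1] at h2
    rw [@Bool.eq_iff_iff (σ r), @Bool.eq_iff_iff (τ r)]
    exact h2
  by_cases hr : τ r = σ r
  · left
    ext v
    have := key v
    cases h1 : σ v <;> cases h2 : τ v <;> cases h3 : σ r <;> simp_all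
  · right
    ext v
    have := key v
    cases h1 : σ v <;> cases h2 : τ v <;> cases h3 : σ r <;> simp_all

open scoped Classical in
theorem eval_bicolorPoly {V : Type} [Fintype V] {G : SimpleGraph V} (hG : G.Connected) :
    (bicolorPoly G).eval 1 = if HasNoOddCycle G then 2 else 0 := by
  have h0 : (bicolorPoly G).eval 1 = ((Finset.univ.filter fun σ : V → Bool =>
      ∀ a b, G.Adj a b → σ a ≠ σ b).card : ℝ) := by
    unfold bicolorPoly
    rw [eval_finsetSum, Finset.sum_congr rfl (g := fun _ => (1 : ℝ)), Finset.sum_const,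
      nsmul_eq_mul, mul_one]
    intro σ _
    rw [eval_prod]
    refine Finset.prod_eq_one fun v _ => ?_
    split_ifs <;> simp
  rw [h0]
  split_ifs with h
  · obtain ⟨σ, hσ⟩ := exists_bool_coloring hG h
    obtain ⟨r⟩ := hG.nonempty
    have : (Finset.univ.filter fun σ : V → Bool => ∀ a b, G.Adj a b → σ a ≠ σ b) =
        {σ, fun v => !σ v} := by
      ext τ
      simp only [Finset.mem_filter, Finset.mem_univ, true_and, Finset.mem_insert,
        Finset.mem_singleton]
      constructor
      · exact bool_coloring_unique hG hσ
      · rintro (rfl | rfl)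
        · exact hσ
        · intro a b hab
          simpa using hσ a b hab
    rw [this, Finset.card_pair]
    · norm_num
    · intro h
      have := congrFun h r
      simp at this
  · rw [Finset.filter_eq_empty_iff.2]
    · simp
    · intro σ _ hσ
      exact h (hasNoOddCycle_of_bool_coloring hσ)

theorem eval_eulerDeriv_prod {V : Type} [Fintype V] (σ : V → Bool) :
    (eulerDeriv (∏ v, if σ v then (X : ℝ[X]) else 1)).eval 1 =
      ((Finset.univ.filter fun v => σ v = true).card : ℝ) := by
  rw [Finset.prod_ite, Finset.prod_const, Finset.prod_const_one, mul_one, eulerDeriv_X_pow]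
  simp

/-- Exchanging the two colours. -/
theorem two_mul_eval_eulerDeriv_bicolorPoly {V : Type} [Fintype V] (G : SimpleGraph V) :
    2 * (eulerDeriv (bicolorPoly G)).eval 1 = Fintype.card V * (bicolorPoly G).eval 1 := by
  classical
  unfold bicolorPoly
  set P := Finset.univ.filter fun σ : V → Bool => ∀ a b, G.Adj a b → σ a ≠ σ b with hP
  have h1 : (eulerDeriv (∑ σ ∈ P, ∏ v, if σ v then (X : ℝ[X]) else 1)).eval 1 =
      ∑ σ ∈ P, ((Finset.univ.filter fun v => σ v = true).card : ℝ) := by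
    rw [map_sum, eval_finsetSum]
    exact Finset.sum_congr rfl fun σ _ => eval_eulerDeriv_prod σ
  have h2 : ∑ σ ∈ P, ((Finset.univ.filter fun v => σ v = true).card : ℝ) =
      ∑ σ ∈ P, ((Finset.univ.filter fun v => ¬ σ v = true).card : ℝ) := by
    refine Finset.sum_bij' (fun σ _ v => !σ v) (fun σ _ v => !σ v) ?_ ?_ ?_ ?_ ?_
    · intro σ hσ
      simp only [hP, Finset.mem_filter, Finset.mem_univ, true_and] at hσ ⊢
      intro a b hab
      simpa using hσ a b hab
    · intro σ hσ
      simp only [hP, Finset.mem_filter, Finset.mem_univ, true_and] at hσ ⊢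
      intro a b hab
      simpa using hσ a b hab
    · intro σ _; ext; simp
    · intro σ _; ext; simp
    · intro σ _; simp
  rw [h1, two_mul]
  nth_rewrite 2 [h2]
  rw [← Finset.sum_add_distrib, eval_finsetSum, Finset.mul_sum]
  refine Finset.sum_congr rfl fun σ _ => ?_
  have h3 : (∏ v, if σ v then (X : ℝ[X]) else 1).eval 1 = 1 := by
    rw [eval_prod]
    refine Finset.prod_eq_one fun v _ => ?_
    split_ifs <;> simp
  rw [h3, mul_one, ← Nat.cast_add, Finset.card_filter_add_card_filter_not, Finset.card_univ]

theorem exists_connected_finset (V : Type) [Fintype V] :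
    ∃ s : Finset (SimpleGraph V), (∀ G, G ∈ s ↔ G.Connected) ∧
      ∀ {R : Type} [CommRing R] (ω : ∀ (V : Type) [Fintype V], SimpleGraph V → R),
        connWeight ω V = ∑ G ∈ s, ω V G := by
  classical
  exact ⟨_, fun G => by rw [Finset.mem_filter, and_iff_right (Finset.mem_univ G)],
    fun ω => rfl⟩

theorem card_filter_eq_natCard {V : Type} [Fintype V] (s : Finset (SimpleGraph V))
    (hs : ∀ G, G ∈ s ↔ G.Connected) (p : SimpleGraph V → Prop) [DecidablePred p] :
    (s.filter p).card = Nat.card {G : SimpleGraph V // G.Connected ∧ p G} := by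
  rw [← Set.ncard_coe_finset, ← Nat.card_coe_set_eq]
  refine Nat.card_congr (Equiv.subtypeEquivRight fun G => ?_)
  rw [Finset.mem_coe, Finset.mem_filter, hs]

theorem coeff_connWeight_edgeWeight (n m : ℕ) :
    (connWeight edgeWeight (Fin n)).coeff m = Cconn n m := by
  obtain ⟨s, hs, h⟩ := exists_connected_finset (Fin n)
  rw [h, finsetSum_coeff, Cconn, ← card_filter_eq_natCard s hs, ← Finset.sum_boole]
  refine Finset.sum_congr rfl fun G _ => ?_
  simp only [edgeWeight, coeff_X_pow, @eq_comm _ m]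

open scoped Classical in
theorem eval_coeff_connWeight_biWeight (n m : ℕ) :
    ((connWeight biWeight (Fin n)).coeff m).eval 1 = 2 * CconnE n m := by
  obtain ⟨s, hs, h⟩ := exists_connected_finset (Fin n)
  rw [h, finsetSum_coeff, CconnE, ← card_filter_eq_natCard s hs, ← Finset.sum_boole,
    eval_finsetSum, Finset.mul_sum]
  refine Finset.sum_congr rfl fun G hG => ?_
  have := eval_bicolorPoly ((hs G).1 hG)
  rw [biWeight, coeff_mul_C, coeff_X_pow]
  by_cases h1 : m = edgeCount G
  · by_cases h2 : HasNoOddCycle G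
    · rw [if_pos h1, one_mul, this, if_pos h2, if_pos ⟨h1.symm, h2⟩, mul_one]
    · rw [if_pos h1, one_mul, this, if_neg h2, if_neg (fun h => h2 h.2), mul_zero]
  · rw [if_neg h1, if_neg (fun h => h1 h.1.symm), zero_mul, mul_zero, eval_zero]

theorem two_mul_eval_eulerDeriv_coeff_connWeight (n m : ℕ) :
    2 * (eulerDeriv ((connWeight biWeight (Fin n)).coeff m)).eval 1 =
      n * ((connWeight biWeight (Fin n)).coeff m).eval 1 := by
  classical
  unfold connWeight biWeight
  rw [finsetSum_coeff, map_sum, eval_finsetSum, eval_finsetSum, Finset.mul_sum, Finset.mul_sum]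
  refine Finset.sum_congr rfl fun G _ => ?_
  rw [coeff_mul_C, coeff_X_pow]
  have := two_mul_eval_eulerDeriv_bicolorPoly G
  rw [Fintype.card_fin] at this
  split_ifs
  · simpa using this
  · simp

theorem le_edgeCount_add_one {n : ℕ} {G : SimpleGraph (Fin n)} (hG : G.Connected) :
    n ≤ edgeCount G + 1 := by
  have := hG.card_vert_le_card_edgeSet_add_one
  rwa [Nat.card_eq_fintype_card, Fintype.card_fin, Nat.card_coe_set_eq] at this

theorem coeff_connWeight_edgeWeight_eq_zero {n m : ℕ} (h : m + 1 < n) :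
    (connWeight edgeWeight (Fin n)).coeff m = 0 := by
  obtain ⟨s, hs, hsum⟩ := exists_connected_finset (Fin n)
  rw [hsum, finsetSum_coeff]
  refine Finset.sum_eq_zero fun G hG => ?_
  have := le_edgeCount_add_one ((hs G).1 hG)
  rw [edgeWeight, coeff_X_pow, if_neg (by omega)]

theorem coeff_connWeight_biWeight_eq_zero {n m : ℕ} (h : m + 1 < n) :
    (connWeight biWeight (Fin n)).coeff m = 0 := by
  obtain ⟨s, hs, hsum⟩ := exists_connected_finset (Fin n)
  rw [hsum, finsetSum_coeff]
  refine Finset.sum_eq_zero fun G hG => ?_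
  have := le_edgeCount_add_one ((hs G).1 hG)
  rw [biWeight, coeff_mul_C, coeff_X_pow, if_neg (by omega), zero_mul]

theorem connWeight_fin_zero {R : Type*} [CommRing R]
    (ω : ∀ (V : Type) [Fintype V], SimpleGraph V → R) : connWeight ω (Fin 0) = 0 := by
  classical
  unfold connWeight
  refine Finset.sum_eq_zero fun G hG => ?_
  obtain ⟨r⟩ := (Finset.mem_filter.1 hG).2.nonempty
  exact r.elim0

theorem connWeight_fin_one {R : Type*} [CommRing R]
    (ω : ∀ (V : Type) [Fintype V], SimpleGraph V → R) : connWeight ω (Fin 1) = ω (Fin 1) ⊥ := by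
  classical
  unfold connWeight
  rw [Finset.sum_eq_single_of_mem ⊥]
  · simp only [Finset.mem_filter, Finset.mem_univ, true_and]
    exact SimpleGraph.Connected.mk fun a b => by rw [Subsingleton.elim a b]
  · intro G _ h
    exact absurd (Subsingleton.elim _ _) h

theorem edgeCount_bot {V : Type*} : edgeCount (⊥ : SimpleGraph V) = 0 := by
  simp [edgeCount]

theorem connWeight_edgeWeight_fin_one : connWeight edgeWeight (Fin 1) = 1 := by
  rw [connWeight_fin_one]
  simp [edgeWeight, edgeCount_bot]

theorem connWeight_biWeight_fin_one : connWeight biWeight (Fin 1) = C (1 + X) := by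
  rw [connWeight_fin_one]
  unfold biWeight
  rw [edgeCount_bot, pow_zero, one_mul]
  congr 1
  classical
  have h : bicolorPoly (⊥ : SimpleGraph (Fin 1)) =
      ∑ σ : Fin 1 → Bool, ∏ v, if σ v then (X : ℝ[X]) else 1 := by
    unfold bicolorPoly
    refine Finset.sum_congr ?_ fun _ _ => rfl
    ext σ
    simp
  have h2 : ∀ σ : Fin 1 → Bool, (∏ v, if σ v then (X : ℝ[X]) else 1) =
      (fun b => if b then (X : ℝ[X]) else 1) (Equiv.funUnique (Fin 1) Bool σ) := by
    intro σ
    simp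
  rw [h, Finset.sum_congr rfl fun σ _ => h2 σ,
    Equiv.sum_comp (Equiv.funUnique (Fin 1) Bool) fun b => if b then (X : ℝ[X]) else 1,
    Fintype.sum_bool]
  simp [add_comm]

end ConnectedCoefficients

section FormalDerivations

open PowerSeries

/-- The Euler derivation `x d/dx` on power series. -/
noncomputable def theta (K : Type*) [CommRing K] : Derivation K K⟦X⟧ K⟦X⟧ :=
  (X : K⟦X⟧) • derivative K

@[simp]
theorem coeff_theta {K : Type*} [CommRing K] (f : K⟦X⟧) (n : ℕ) :
    coeff n (theta K f) = n * coeff n f := by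
  change coeff n (X * derivative K f) = _
  cases n with
  | zero => simp
  | succ n => rw [coeff_succ_X_mul, coeff_derivative]; push_cast; ring

/-- The coefficientwise extension of a derivation to power series. -/
noncomputable def psCoeffDeriv {R K : Type*} [CommRing R] [CommRing K] [Algebra R K]
    (d : Derivation R K K) : Derivation R K⟦X⟧ K⟦X⟧ :=
  Derivation.mk'
    { toFun := fun f => mk fun n => d (coeff n f)
      map_add' := fun f g => by ext; simp
      map_smul' := fun c f => by
        ext n
        have h1 : ∀ g : K⟦X⟧, coeff n (c • g) = c • coeff n g := fun _ => rfl
        simp only [coeff_mk, RingHom.id_apply, h1, Derivation.map_smul] }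
    (fun f g => by
      ext n
      simp only [LinearMap.coe_mk, AddHom.coe_mk, coeff_mk, smul_eq_mul, map_add, coeff_mul,
        map_sum, Derivation.leibniz, Finset.sum_add_distrib]
      congr 1
      rw [← Finset.Nat.sum_antidiagonal_swap]
      rfl)

@[simp]
theorem coeff_psCoeffDeriv {R K : Type*} [CommRing R] [CommRing K] [Algebra R K]
    (d : Derivation R K K) (f : K⟦X⟧) (n : ℕ) :
    coeff n (psCoeffDeriv d f) = d (coeff n f) := by
  change coeff n (mk fun n => d (coeff n f)) = _
  rw [coeff_mk]

theorem theta_psCoeffDeriv {R K : Type*} [CommRing R] [CommRing K] [Algebra R K]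
    (d : Derivation R K K) (f : K⟦X⟧) :
    theta K (psCoeffDeriv d f) = psCoeffDeriv d (theta K f) := by
  ext n
  simp only [coeff_theta, coeff_psCoeffDeriv]
  rw [Derivation.leibniz, Derivation.map_natCast, smul_zero, add_zero, smul_eq_mul]

theorem eq_zero_of_theta_eq_mul {K : Type*} [CommRing K] [IsDomain K] [CharZero K] {Z F : K⟦X⟧}
    (h : theta K Z = Z * theta K F) (h0 : coeff 0 Z = 0) : Z = 0 := by
  ext n
  induction n using Nat.strong_induction_on with
  | _ n ih =>
    rcases Nat.eq_zero_or_pos n with rfl | hn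
    · simpa using h0
    · have h1 := congrArg (coeff n) h
      rw [coeff_theta, coeff_mul, Finset.sum_eq_zero] at h1
      · rcases mul_eq_zero.1 h1 with h2 | h2
        · exact absurd (Nat.cast_eq_zero.1 h2) hn.ne'
        · simpa using h2
      · rintro ⟨a, b⟩ hab
        rw [Finset.HasAntidiagonal.mem_antidiagonal] at hab
        simp only at hab ⊢
        rcases Nat.eq_zero_or_pos b with rfl | hb
        · simp
        · rw [ih a (by omega), map_zero, zero_mul]

/-- If `G = exp F`, every coefficientwise derivation satisfies `dG = G dF`. -/
theorem psCoeffDeriv_exp {R K : Type*} [CommRing R] [CommRing K] [Algebra R K] [IsDomain K]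
    [CharZero K] (d : Derivation R K K) {G F : K⟦X⟧} (h : theta K G = G * theta K F)
    (hG : coeff 0 G = 1) (hF : coeff 0 F = 0) :
    psCoeffDeriv d G = G * psCoeffDeriv d F := by
  rw [← sub_eq_zero]
  refine eq_zero_of_theta_eq_mul (F := F) ?_ ?_
  · rw [map_sub, theta_psCoeffDeriv, h, Derivation.leibniz, Derivation.leibniz,
      theta_psCoeffDeriv, h]
    simp only [smul_eq_mul]
    ring
  · rw [map_sub, coeff_psCoeffDeriv, hG, coeff_mul]
    simp [hF]

theorem shift_eq_of_univariate {K : Type*} [CommRing K] [Algebra ℝ K] [IsDomain K] [CharZero K]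
    (d : Derivation ℝ K K) {G F : K⟦X⟧} (h : theta K G = G * theta K F)
    (hG : coeff 0 G = 1) (hF : coeff 0 F = 0)
    (hL : 2 * psCoeffDeriv d G = theta K (theta K G) - theta K G) :
    2 * psCoeffDeriv d F = theta K (theta K F) + theta K F * theta K F - theta K F := by
  have hG0 : G ≠ 0 := by
    rintro rfl
    simp at hG
  rw [psCoeffDeriv_exp d h hG hF, h, Derivation.leibniz, h] at hL
  simp only [smul_eq_mul] at hL
  refine mul_left_cancel₀ hG0 ?_
  linear_combination hL

theorem shift_eq_of_bivariate {R K : Type*} [CommRing R] [CommRing K] [Algebra ℝ K] [Algebra R K]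
    [IsDomain K] [CharZero K]
    (L : Derivation R K K) (d : Derivation ℝ K K) {G F : K⟦X⟧} (h : theta K G = G * theta K F)
    (hG : coeff 0 G = 1) (hF : coeff 0 F = 0)
    (hL : psCoeffDeriv L G = theta K (psCoeffDeriv d G) - psCoeffDeriv d (psCoeffDeriv d G)) :
    psCoeffDeriv L F = theta K (psCoeffDeriv d F) - psCoeffDeriv d (psCoeffDeriv d F) +
      (theta K F - psCoeffDeriv d F) * psCoeffDeriv d F := by
  have hG0 : G ≠ 0 := by
    rintro rfl
    simp at hG
  have hd := psCoeffDeriv_exp d h hG hF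
  rw [psCoeffDeriv_exp L h hG hF, hd, Derivation.leibniz, Derivation.leibniz, h, hd] at hL
  simp only [smul_eq_mul] at hL
  refine mul_left_cancel₀ hG0 ?_
  linear_combination hL

end FormalDerivations

section ExponentialFormula

open PowerSeries

variable {K : Type} [CommRing K] [Algebra ℝ K]

/-- The exponential generating series of all graphs. -/
noncomputable def totalSeries (ω : ∀ (V : Type) [Fintype V], SimpleGraph V → K) : K⟦X⟧ :=
  mk fun n => ((n.factorial : ℝ)⁻¹) • totalWeight ω (Fin n)

/-- The exponential generating series of connected graphs. -/
noncomputable def connSeries (ω : ∀ (V : Type) [Fintype V], SimpleGraph V → K) : K⟦X⟧ :=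
  mk fun n => ((n.factorial : ℝ)⁻¹) • connWeight ω (Fin n)

theorem theta_totalSeries {ω : ∀ (V : Type) [Fintype V], SimpleGraph V → K}
    (hω : IsMulWeight ω) :
    theta K (totalSeries ω) = totalSeries ω * theta K (connSeries ω) := by
  ext n
  rw [coeff_theta, mul_comm (totalSeries ω), coeff_mul,
    Finset.Nat.sum_antidiagonal_eq_sum_range_succ_mk]
  simp only [coeff_theta, totalSeries, connSeries, coeff_mk]
  rw [mul_smul_comm, card_mul_totalWeight hω, Finset.smul_sum]
  refine Finset.sum_congr rfl fun k hk => ?_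
  have hk' : k ≤ n := Nat.lt_succ_iff.1 (Finset.mem_range.1 hk)
  have hc : ((n.choose k : ℕ) : K) = algebraMap ℝ K (n.choose k : ℝ) := by simp
  rw [hc, ← Algebra.smul_def, smul_smul, Nat.cast_choose ℝ hk']
  simp only [mul_smul_comm, smul_mul_assoc, smul_smul]
  congr 1
  have := Nat.cast_ne_zero (R := ℝ).2 n.factorial_ne_zero
  field_simp

end ExponentialFormula

section Slices

open PowerSeries

theorem Polynomial.coeff_mul_of_low {R : Type*} [CommRing R] {P Q : Polynomial R} {u v : ℕ}
    (hP : ∀ m < u, P.coeff m = 0) (hQ : ∀ m < v, Q.coeff m = 0) (i : ℕ) :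
    (P * Q).coeff (u + v + i) =
      ∑ p ∈ Finset.HasAntidiagonal.antidiagonal i, P.coeff (u + p.1) * Q.coeff (v + p.2) := by
  obtain ⟨P', rfl⟩ := Polynomial.X_pow_dvd_iff.2 hP
  obtain ⟨Q', rfl⟩ := Polynomial.X_pow_dvd_iff.2 hQ
  rw [show Polynomial.X ^ u * P' * (Polynomial.X ^ v * Q') =
    Polynomial.X ^ (u + v) * (P' * Q') by ring, add_comm (u + v) i, Polynomial.coeff_X_pow_mul,
    Polynomial.coeff_mul]
  refine Finset.sum_congr rfl fun p _ => ?_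
  rw [add_comm u, add_comm v, Polynomial.coeff_X_pow_mul, Polynomial.coeff_X_pow_mul]

variable {R : Type*} [CommRing R]

/-- The `n`-th coefficient has order at least `n - 1`, and there is no constant term. -/
def IsLow (P : (Polynomial R)⟦X⟧) : Prop :=
  coeff 0 P = 0 ∧ ∀ n m, m + 1 < n → (coeff n P).coeff m = 0

/-- The coefficients of `X ^ (n + i - 1)` in the `n`-th coefficient. -/
noncomputable def slice (i : ℕ) : (Polynomial R)⟦X⟧ →ₗ[R] R⟦X⟧ where
  toFun P := mk fun n => (coeff n P).coeff (n + i - 1)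
  map_add' P Q := by ext; simp
  map_smul' c P := by
    ext n
    have h1 : coeff n (c • P) = c • coeff n P := rfl
    simp

theorem coeff_slice (i n : ℕ) (P : (Polynomial R)⟦X⟧) :
    coeff n (slice i P) = (coeff n P).coeff (n + i - 1) := by
  change coeff n (mk fun n => (coeff n P).coeff (n + i - 1)) = _
  rw [coeff_mk]

theorem coeff_slice_mul {P Q : (Polynomial R)⟦X⟧} (hP : IsLow P) (hQ : IsLow Q) (i n : ℕ) :
    (coeff n (P * Q)).coeff (n + i - 2) =
      coeff n (∑ p ∈ Finset.HasAntidiagonal.antidiagonal i, slice p.1 P * slice p.2 Q) := by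
  rw [map_sum, coeff_mul, Polynomial.finsetSum_coeff]
  simp only [coeff_mul]
  rw [Finset.sum_comm]
  refine Finset.sum_congr rfl fun q hq => ?_
  rw [Finset.HasAntidiagonal.mem_antidiagonal] at hq
  obtain ⟨a, b⟩ := q
  simp only at hq ⊢
  rcases Nat.eq_zero_or_pos a with rfl | ha
  · simp [hP.1, coeff_slice]
  rcases Nat.eq_zero_or_pos b with rfl | hb
  · simp [hQ.1, coeff_slice]
  have h := Polynomial.coeff_mul_of_low (P := coeff a P) (Q := coeff b Q) (u := a - 1) (v := b - 1)
    (fun m hm => hP.2 a m (by omega)) (fun m hm => hQ.2 b m (by omega)) i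
  rw [show a - 1 + (b - 1) + i = n + i - 2 by omega] at h
  rw [h]
  refine Finset.sum_congr rfl fun p _ => ?_
  rw [coeff_slice, coeff_slice, show a + p.1 - 1 = a - 1 + p.1 by omega,
    show b + p.2 - 1 = b - 1 + p.2 by omega]

theorem coeff_shiftDeriv (p : Polynomial R) (m : ℕ) :
    (shiftDeriv R p).coeff m = (m + 1) * p.coeff (m + 1) + m * p.coeff m := by
  rw [shiftDeriv_apply, add_mul, one_mul, Polynomial.coeff_add, Polynomial.coeff_derivative]
  cases m with
  | zero => simp [mul_comm]
  | succ m =>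
    rw [Polynomial.coeff_X_mul, Polynomial.coeff_derivative]
    push_cast
    ring

theorem slice_recurrence_zero {F A P Q : (Polynomial R)⟦X⟧} (hF : IsLow F) (hA : IsLow A)
    (hP : IsLow P) (hQ : IsLow Q) (h : psCoeffDeriv (shiftDeriv R) F = A + P * Q) :
    theta R (slice 0 F) - slice 0 F = slice 0 P * slice 0 Q := by
  ext n
  have h1 := coeff_slice_mul hP hQ 0 n
  rw [Finset.HasAntidiagonal.antidiagonal_zero, Finset.sum_singleton] at h1
  rw [← h1, map_sub, coeff_theta, coeff_slice]
  have h2 : P * Q = psCoeffDeriv (shiftDeriv R) F - A := by rw [h]; ring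
  rw [h2, map_sub, coeff_psCoeffDeriv, Polynomial.coeff_sub, coeff_shiftDeriv]
  rcases n with _ | _ | n
  · simp [hF.1, hA.1]
  · have h3 := coeff_slice_mul hP hQ 0 1
    rw [h2, map_sub, coeff_psCoeffDeriv, Polynomial.coeff_sub, coeff_shiftDeriv,
      Finset.HasAntidiagonal.antidiagonal_zero, Finset.sum_singleton, coeff_mul] at h3
    rw [h3]
    simp [coeff_slice, hP.1, hQ.1, Finset.Nat.antidiagonal_succ]
  · rw [hA.2 (n + 2) _ (by omega), hF.2 (n + 2) (n + 1 + 1 + 0 - 2) (by omega)]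
    have e1 : n + 1 + 1 + 0 - 2 = n := by omega
    have e2 : n + 1 + 1 + 0 - 1 = n + 1 := by omega
    rw [e1, e2]
    push_cast
    ring

theorem slice_recurrence_succ {F A P Q : (Polynomial R)⟦X⟧} (hF : IsLow F) (hA : IsLow A)
    (hP : IsLow P) (hQ : IsLow Q) (h : psCoeffDeriv (shiftDeriv R) F = A + P * Q) (k : ℕ) :
    theta R (slice (k + 1) F) + k * slice (k + 1) F + theta R (slice k F) + (k - 1) * slice k F =
      slice k A + ∑ p ∈ Finset.HasAntidiagonal.antidiagonal (k + 1), slice p.1 P * slice p.2 Q := by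
  ext n
  rw [map_add (coeff n) (slice k A), ← coeff_slice_mul hP hQ]
  have h2 : P * Q = psCoeffDeriv (shiftDeriv R) F - A := by rw [h]; ring
  have hk : (k : R⟦X⟧) = C (k : R) := by simp
  rw [h2, map_sub, coeff_psCoeffDeriv, Polynomial.coeff_sub, coeff_shiftDeriv]
  rw [sub_mul, one_mul, hk]
  simp only [map_add, map_sub, coeff_C_mul, coeff_theta, coeff_slice]
  rcases n with _ | n
  · simp [hF.1, hA.1]
  · have e1 : n + 1 + (k + 1) - 2 = n + k := by omega
    have e2 : n + 1 + (k + 1) - 1 = n + k + 1 := by omega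
    have e3 : n + 1 + k - 1 = n + k := by omega
    rw [e1, e2, e3]
    push_cast
    ring

theorem slice_theta (i : ℕ) (P : (Polynomial R)⟦X⟧) :
    slice i (theta (Polynomial R) P) = theta R (slice i P) := by
  ext n
  rw [coeff_slice, coeff_theta, coeff_theta, coeff_slice, ← Polynomial.C_eq_natCast,
    Polynomial.coeff_C_mul]

theorem IsLow.theta {P : (Polynomial R)⟦X⟧} (h : IsLow P) : IsLow (theta (Polynomial R) P) := by
  refine ⟨by simp, fun n m hm => ?_⟩
  rw [coeff_theta, ← Polynomial.C_eq_natCast, Polynomial.coeff_C_mul, h.2 n m hm, mul_zero]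

theorem slice_psCoeffDeriv [Algebra ℝ R] (d : Derivation ℝ R R) (i : ℕ)
    (P : (Polynomial R)⟦X⟧) :
    slice i (psCoeffDeriv (polyCoeffDeriv d) P) = psCoeffDeriv d (slice i P) := by
  ext n
  rw [coeff_slice, coeff_psCoeffDeriv, coeff_psCoeffDeriv, coeff_slice, coeff_polyCoeffDeriv]

theorem IsLow.psCoeffDeriv [Algebra ℝ R] (d : Derivation ℝ R R) {P : (Polynomial R)⟦X⟧}
    (h : IsLow P) : IsLow (psCoeffDeriv (polyCoeffDeriv d) P) := by
  refine ⟨by rw [coeff_psCoeffDeriv, h.1, map_zero], fun n m hm => ?_⟩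
  rw [coeff_psCoeffDeriv, coeff_polyCoeffDeriv, h.2 n m hm, map_zero]

theorem IsLow.smul (c : R) {P : (Polynomial R)⟦X⟧} (hP : IsLow P) : IsLow (c • P) := by
  have h1 : ∀ n, coeff n (c • P) = c • coeff n P := fun _ => rfl
  exact ⟨by rw [h1, hP.1, smul_zero], fun n m hm => by
    rw [h1, Polynomial.coeff_smul, hP.2 n m hm, smul_zero]⟩

theorem IsLow.sub {P Q : (Polynomial R)⟦X⟧} (hP : IsLow P) (hQ : IsLow Q) : IsLow (P - Q) :=
  ⟨by rw [map_sub, hP.1, hQ.1, sub_zero], fun n m hm => by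
    rw [map_sub, Polynomial.coeff_sub, hP.2 n m hm, hQ.2 n m hm, sub_zero]⟩

end Slices

section ConnectedSeries

open PowerSeries

/-- The series counting connected graphs of excess `i - 1`. -/
noncomputable def allSeries (i : ℕ) : ℝ⟦X⟧ := slice i (connSeries edgeWeight)

/-- The series counting connected graphs of excess `i - 1` with a proper 2-colouring. -/
noncomputable def bicolSeries (i : ℕ) : (Polynomial ℝ)⟦X⟧ := slice i (connSeries biWeight)

theorem isLow_connSeries_edgeWeight : IsLow (connSeries edgeWeight) := by
  refine ⟨?_, fun n m hm => ?_⟩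
  · rw [connSeries, coeff_mk, connWeight_fin_zero, smul_zero]
  · rw [connSeries, coeff_mk, Polynomial.coeff_smul, coeff_connWeight_edgeWeight_eq_zero hm,
      smul_zero]

theorem isLow_connSeries_biWeight : IsLow (connSeries biWeight) := by
  refine ⟨?_, fun n m hm => ?_⟩
  · rw [connSeries, coeff_mk, connWeight_fin_zero, smul_zero]
  · rw [connSeries, coeff_mk, Polynomial.coeff_smul, coeff_connWeight_biWeight_eq_zero hm,
      smul_zero]

theorem shift_connSeries_edgeWeight :
    2 * psCoeffDeriv (shiftDeriv ℝ) (connSeries edgeWeight) =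
      theta _ (theta _ (connSeries edgeWeight)) +
        theta _ (connSeries edgeWeight) * theta _ (connSeries edgeWeight) -
        theta _ (connSeries edgeWeight) := by
  refine shift_eq_of_univariate (shiftDeriv ℝ) (theta_totalSeries isMulWeight_edgeWeight) ?_
    isLow_connSeries_edgeWeight.1 ?_
  · rw [totalSeries, coeff_mk, totalWeight_edgeWeight]
    simp
  · ext1 n
    have h2 : (2 : (Polynomial ℝ)⟦X⟧) = C (2 : Polynomial ℝ) :=
      (map_ofNat (C : Polynomial ℝ →+* (Polynomial ℝ)⟦X⟧) 2).symm
    have h3 : ((n.choose 2 : ℕ) : Polynomial ℝ) * 2 = n * (n - 1) := by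
      rw [show (2 : Polynomial ℝ) = ((2 : ℕ) : Polynomial ℝ) by simp, ← Nat.cast_mul,
        Nat.choose_two_right, Nat.div_mul_cancel (Nat.even_mul_pred_self n).two_dvd]
      cases n <;> simp
    rw [h2, coeff_C_mul, coeff_psCoeffDeriv, map_sub, coeff_theta, coeff_theta, totalSeries,
      coeff_mk, Derivation.map_smul, shiftDeriv_totalWeight_edgeWeight, mul_smul_comm,
      mul_smul_comm, mul_smul_comm, ← smul_sub, ← mul_assoc, mul_comm 2, h3]
    congr 1
    ring

theorem shift_connSeries_biWeight :
    psCoeffDeriv (shiftDeriv (Polynomial ℝ)) (connSeries biWeight) =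
      theta _ (psCoeffDeriv (polyCoeffDeriv eulerDeriv) (connSeries biWeight)) -
        psCoeffDeriv (polyCoeffDeriv eulerDeriv)
          (psCoeffDeriv (polyCoeffDeriv eulerDeriv) (connSeries biWeight)) +
        (theta _ (connSeries biWeight) -
          psCoeffDeriv (polyCoeffDeriv eulerDeriv) (connSeries biWeight)) *
          psCoeffDeriv (polyCoeffDeriv eulerDeriv) (connSeries biWeight) := by
  refine shift_eq_of_bivariate (shiftDeriv (Polynomial ℝ)) (polyCoeffDeriv eulerDeriv)
    (theta_totalSeries isMulWeight_biWeight) ?_ isLow_connSeries_biWeight.1 ?_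
  · rw [totalSeries, coeff_mk, totalWeight_biWeight]
    simp
  · ext1 n
    rw [coeff_psCoeffDeriv, map_sub, coeff_theta, coeff_psCoeffDeriv, coeff_psCoeffDeriv,
      coeff_psCoeffDeriv, totalSeries, coeff_mk]
    have h1 : ∀ p : Polynomial (Polynomial ℝ), shiftDeriv (Polynomial ℝ)
        (((n.factorial : ℝ)⁻¹) • p) = ((n.factorial : ℝ)⁻¹) • shiftDeriv (Polynomial ℝ) p := by
      intro p
      rw [shiftDeriv_apply, shiftDeriv_apply, Polynomial.derivative_smul, mul_smul_comm]
    rw [h1, Derivation.map_smul, Derivation.map_smul, shiftDeriv_totalWeight_biWeight,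
      mul_smul_comm, ← smul_sub]

end ConnectedSeries

section Recurrences

open PowerSeries

/-- Marking a vertex of the first colour. -/
noncomputable def etaD : Derivation ℝ (Polynomial ℝ)⟦X⟧ (Polynomial ℝ)⟦X⟧ := psCoeffDeriv eulerDeriv

/-- Marking a vertex of the second colour. -/
noncomputable def xiD : Derivation ℝ (Polynomial ℝ)⟦X⟧ (Polynomial ℝ)⟦X⟧ :=
  Derivation.mk'
    { toFun := fun f => theta (Polynomial ℝ) f - etaD f
      map_add' := fun f g => by rw [map_add, map_add]; ring
      map_smul' := fun c f => by
        have h1 : theta (Polynomial ℝ) (c • f) = c • theta (Polynomial ℝ) f := by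
          ext1 n
          have h1 : ∀ g : (Polynomial ℝ)⟦X⟧, coeff n (c • g) = c • coeff n g := fun _ => rfl
          rw [coeff_theta, h1, h1, coeff_theta, mul_smul_comm]
        rw [Derivation.map_smul, h1, RingHom.id_apply, smul_sub] }
    (fun f g => by
      simp only [LinearMap.coe_mk, AddHom.coe_mk, Derivation.leibniz, smul_eq_mul]
      ring)

theorem xiD_apply (f : (Polynomial ℝ)⟦X⟧) : xiD f = theta (Polynomial ℝ) f - etaD f := rfl

theorem xiD_add_etaD (f : (Polynomial ℝ)⟦X⟧) : xiD f + etaD f = theta (Polynomial ℝ) f := by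
  rw [xiD_apply]; ring

theorem coeff_etaD (f : (Polynomial ℝ)⟦X⟧) (n : ℕ) : coeff n (etaD f) = eulerDeriv (coeff n f) :=
  coeff_psCoeffDeriv _ _ _

theorem theta_etaD (f : (Polynomial ℝ)⟦X⟧) : theta _ (etaD f) = etaD (theta _ f) :=
  theta_psCoeffDeriv _ _

theorem xiD_etaD_comm (f : (Polynomial ℝ)⟦X⟧) : xiD (etaD f) = etaD (xiD f) := by
  rw [xiD_apply, xiD_apply, map_sub, theta_etaD]

theorem allSeries_zero_eq :
    theta ℝ (allSeries 0) - allSeries 0 = C (1 / 2) * theta ℝ (allSeries 0) ^ 2 := by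
  have hF := isLow_connSeries_edgeWeight
  have hA := (hF.theta.theta.sub hF.theta).smul (1 / 2 : ℝ)
  have h := slice_recurrence_zero hF hA (hF.theta.smul (1 / 2 : ℝ)) hF.theta ?_
  · rw [allSeries, h, map_smul, slice_theta, smul_eq_C_mul]
    ring
  · have := shift_connSeries_edgeWeight
    rw [smul_mul_assoc, ← smul_add]
    rw [eq_inv_smul_iff₀ (two_ne_zero' ℝ) |>.2 (_ : (2 : ℝ) • psCoeffDeriv (shiftDeriv ℝ)
      (connSeries edgeWeight) = _), one_div]
    rw [ofNat_smul_eq_nsmul, nsmul_eq_mul]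
    push_cast
    rw [this]
    ring

theorem allSeries_succ_eq (k : ℕ) :
    theta ℝ (allSeries (k + 1)) + (k : ℝ⟦X⟧) * allSeries (k + 1) + theta ℝ (allSeries k) +
      ((k : ℝ⟦X⟧) - 1) * allSeries k =
      C (1 / 2) * (theta ℝ (theta ℝ (allSeries k)) - theta ℝ (allSeries k)) +
      C (1 / 2) * ∑ p ∈ Finset.HasAntidiagonal.antidiagonal (k + 1),
        theta ℝ (allSeries p.1) * theta ℝ (allSeries p.2) := by
  have hF := isLow_connSeries_edgeWeight
  have hA := (hF.theta.theta.sub hF.theta).smul (1 / 2 : ℝ)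
  have h := slice_recurrence_succ hF hA (hF.theta.smul (1 / 2 : ℝ)) hF.theta ?_ k
  · unfold allSeries
    rw [h, map_smul, map_sub, slice_theta, slice_theta, smul_eq_C_mul, Finset.mul_sum]
    congr 1
    refine Finset.sum_congr rfl fun p _ => ?_
    rw [map_smul, slice_theta, slice_theta, smul_eq_C_mul, mul_assoc]
  · have := shift_connSeries_edgeWeight
    rw [smul_mul_assoc, ← smul_add]
    rw [eq_inv_smul_iff₀ (two_ne_zero' ℝ) |>.2 (_ : (2 : ℝ) • psCoeffDeriv (shiftDeriv ℝ)
      (connSeries edgeWeight) = _), one_div]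
    rw [ofNat_smul_eq_nsmul, nsmul_eq_mul]
    push_cast
    rw [this]
    ring

theorem bicolSeries_zero_eq :
    theta _ (bicolSeries 0) - bicolSeries 0 = xiD (bicolSeries 0) * etaD (bicolSeries 0) := by
  have hF := isLow_connSeries_biWeight
  have hE := hF.psCoeffDeriv eulerDeriv
  have h := slice_recurrence_zero hF (hE.theta.sub (hE.psCoeffDeriv eulerDeriv))
    (hF.theta.sub hE) hE shift_connSeries_biWeight
  rw [bicolSeries, h, map_sub, slice_theta, slice_psCoeffDeriv, xiD_apply, etaD]

theorem bicolSeries_succ_eq (k : ℕ) :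
    theta _ (bicolSeries (k + 1)) + (k : (Polynomial ℝ)⟦X⟧) * bicolSeries (k + 1) +
      theta _ (bicolSeries k) +
      ((k : (Polynomial ℝ)⟦X⟧) - 1) * bicolSeries k =
      xiD (etaD (bicolSeries k)) + ∑ p ∈ Finset.HasAntidiagonal.antidiagonal (k + 1),
        xiD (bicolSeries p.1) * etaD (bicolSeries p.2) := by
  have hF := isLow_connSeries_biWeight
  have hE := hF.psCoeffDeriv eulerDeriv
  have h := slice_recurrence_succ hF (hE.theta.sub (hE.psCoeffDeriv eulerDeriv))
    (hF.theta.sub hE) hE shift_connSeries_biWeight k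
  unfold bicolSeries
  rw [h]
  simp only [map_sub, slice_theta, slice_psCoeffDeriv, xiD_apply, etaD]

theorem coeff_allSeries (i n : ℕ) :
    coeff n (allSeries i) = (Cconn n (n + i - 1) : ℝ) / n.factorial := by
  rw [allSeries, coeff_slice, connSeries, coeff_mk, Polynomial.coeff_smul,
    coeff_connWeight_edgeWeight, smul_eq_mul, inv_mul_eq_div]

theorem coeff_zero_allSeries (i : ℕ) : coeff 0 (allSeries i) = 0 := by
  rw [allSeries, coeff_slice, isLow_connSeries_edgeWeight.1, Polynomial.coeff_zero]

theorem coeff_one_allSeries_zero : coeff 1 (allSeries 0) = 1 := by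
  rw [allSeries, coeff_slice, connSeries, coeff_mk, connWeight_edgeWeight_fin_one]
  simp

theorem coeff_zero_bicolSeries (i : ℕ) : coeff 0 (bicolSeries i) = 0 := by
  rw [bicolSeries, coeff_slice, isLow_connSeries_biWeight.1, Polynomial.coeff_zero]

theorem coeff_one_bicolSeries_zero : coeff 1 (bicolSeries 0) = 1 + Polynomial.X := by
  rw [bicolSeries, coeff_slice, connSeries, coeff_mk, connWeight_biWeight_fin_one]
  simp

/-- Forgetting the colour marks. -/
noncomputable def forget : (Polynomial ℝ)⟦X⟧ →+* ℝ⟦X⟧ := PowerSeries.map (Polynomial.evalRingHom 1)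

theorem coeff_forget (f : (Polynomial ℝ)⟦X⟧) (n : ℕ) :
    coeff n (forget f) = (coeff n f).eval 1 := by
  simp [forget]

theorem forget_theta (f : (Polynomial ℝ)⟦X⟧) : forget (theta _ f) = theta ℝ (forget f) := by
  ext n
  simp [coeff_forget]

/-- The series counting connected graphs of excess `i - 1` without odd cycle. -/
noncomputable def evenSeries (i : ℕ) : ℝ⟦X⟧ := C (1 / 2) * forget (bicolSeries i)

theorem forget_bicolSeries (i : ℕ) : forget (bicolSeries i) = 2 * evenSeries i := by
  rw [evenSeries, ← mul_assoc, show (2 : ℝ⟦X⟧) = C 2 from (map_ofNat C 2).symm, ← map_mul]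
  norm_num

theorem coeff_evenSeries (i n : ℕ) :
    coeff n (evenSeries i) = (CconnE n (n + i - 1) : ℝ) / n.factorial := by
  rw [evenSeries, coeff_C_mul, coeff_forget, bicolSeries, coeff_slice, connSeries, coeff_mk,
    Polynomial.coeff_smul, Polynomial.eval_smul, eval_coeff_connWeight_biWeight, smul_eq_mul]
  field_simp

theorem forget_etaD_bicolSeries (i : ℕ) :
    forget (etaD (bicolSeries i)) = theta ℝ (evenSeries i) := by
  ext n
  rw [coeff_forget, coeff_etaD, coeff_theta, evenSeries, coeff_C_mul, coeff_forget, bicolSeries,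
    coeff_slice, connSeries, coeff_mk, Polynomial.coeff_smul, Derivation.map_smul,
    Polynomial.eval_smul, Polynomial.eval_smul, smul_eq_mul, smul_eq_mul]
  linear_combination ((n.factorial : ℝ)⁻¹ / 2) *
    two_mul_eval_eulerDeriv_coeff_connWeight n (n + i - 1)

theorem theta_two_mul (f : ℝ⟦X⟧) : theta ℝ (2 * f) = 2 * theta ℝ f := by
  rw [Derivation.leibniz]
  simp [smul_eq_mul, show theta ℝ (2 : ℝ⟦X⟧) = 0 from Derivation.map_natCast _ 2]

theorem forget_xiD_bicolSeries (i : ℕ) :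
    forget (xiD (bicolSeries i)) = theta ℝ (evenSeries i) := by
  rw [xiD_apply, map_sub, forget_theta, forget_bicolSeries, forget_etaD_bicolSeries, theta_two_mul]
  ring

/-- The squared imbalance operator. -/
noncomputable def imbalance (f : (Polynomial ℝ)⟦X⟧) : (Polynomial ℝ)⟦X⟧ :=
  xiD (xiD f - etaD f) - etaD (xiD f - etaD f)

theorem evenSeries_zero_eq :
    theta ℝ (evenSeries 0) - evenSeries 0 = C (1 / 2) * theta ℝ (evenSeries 0) ^ 2 := by
  have h := congrArg forget bicolSeries_zero_eq
  rw [map_sub, map_mul, forget_theta, forget_bicolSeries, theta_two_mul, forget_xiD_bicolSeries,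
    forget_etaD_bicolSeries] at h
  have h2 : (C (1 / 2) : ℝ⟦X⟧) * 2 = 1 := by
    rw [show (2 : ℝ⟦X⟧) = C 2 from (map_ofNat C 2).symm, ← map_mul]
    norm_num
  linear_combination C (1 / 2) * h - (theta ℝ (evenSeries 0) - evenSeries 0) * h2

theorem evenSeries_succ_eq (k : ℕ) :
    theta ℝ (evenSeries (k + 1)) + (k : ℝ⟦X⟧) * evenSeries (k + 1) + theta ℝ (evenSeries k) +
      ((k : ℝ⟦X⟧) - 1) * evenSeries k =
      C (1 / 4) * theta ℝ (theta ℝ (evenSeries k)) -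
      C (1 / 8) * forget (imbalance (bicolSeries k)) +
      C (1 / 2) * ∑ p ∈ Finset.HasAntidiagonal.antidiagonal (k + 1),
        theta ℝ (evenSeries p.1) * theta ℝ (evenSeries p.2) := by
  have h := congrArg forget (bicolSeries_succ_eq k)
  have h1 : 4 * xiD (etaD (bicolSeries k)) =
      theta _ (theta _ (bicolSeries k)) - imbalance (bicolSeries k) := by
    rw [← xiD_add_etaD (theta _ (bicolSeries k)), ← xiD_add_etaD (bicolSeries k), imbalance]
    simp only [map_add, map_sub, xiD_etaD_comm]
    ring
  have h3 := congrArg forget h1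
  rw [map_mul, map_sub, forget_theta, forget_theta, forget_bicolSeries, map_ofNat, theta_two_mul,
    theta_two_mul] at h3
  simp only [map_add, map_sub, map_mul, map_sum, forget_theta, forget_bicolSeries, theta_two_mul,
    forget_xiD_bicolSeries, forget_etaD_bicolSeries, map_natCast, map_one] at h
  have e2 : (C (1 / 2) : ℝ⟦X⟧) * 2 = 1 := by
    rw [show (2 : ℝ⟦X⟧) = C 2 from (map_ofNat C 2).symm, ← map_mul]
    norm_num
  have e8 : (C (1 / 8) : ℝ⟦X⟧) * 4 = C (1 / 2) := by
    rw [show (4 : ℝ⟦X⟧) = C 4 from (map_ofNat C 4).symm, ← map_mul]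
    norm_num
  have e4 : (C (1 / 8) : ℝ⟦X⟧) * 2 = C (1 / 4) := by
    rw [show (2 : ℝ⟦X⟧) = C 2 from (map_ofNat C 2).symm, ← map_mul]
    norm_num
  linear_combination C (1 / 2) * h + C (1 / 8) * h3 -
    (theta ℝ (evenSeries (k + 1)) + (k : ℝ⟦X⟧) * evenSeries (k + 1) + theta ℝ (evenSeries k) +
      ((k : ℝ⟦X⟧) - 1) * evenSeries k) * e2 - forget (xiD (etaD (bicolSeries k))) * e8 +
      theta ℝ (theta ℝ (evenSeries k)) * e4

end Recurrences

section TreeFunction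

open PowerSeries

/-- The tree function, counting rooted labelled trees. -/
noncomputable def treeSeries : ℝ⟦X⟧ := theta ℝ (allSeries 0)

/-- The series `1 / (1 - T)` for the tree function `T`. -/
noncomputable def pathSeries : ℝ⟦X⟧ := (1 - treeSeries)⁻¹

theorem two_mul_C_half : (2 : ℝ⟦X⟧) * C (1 / 2 : ℝ) = 1 := by
  rw [show (2 : ℝ⟦X⟧) = C 2 from (map_ofNat C 2).symm, ← map_mul]
  norm_num

theorem theta_C (c : ℝ) : theta ℝ (C c) = 0 := by
  ext n
  rw [coeff_theta, coeff_C]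
  split_ifs with h <;> simp [h]

theorem theta_C_mul (c : ℝ) (f : ℝ⟦X⟧) : theta ℝ (C c * f) = C c * theta ℝ f := by
  rw [Derivation.leibniz, theta_C]
  simp

theorem theta_treeSeries : theta ℝ treeSeries = treeSeries + treeSeries * theta ℝ treeSeries := by
  have h := congrArg (theta ℝ) allSeries_zero_eq
  rw [map_sub, theta_C_mul, Derivation.leibniz_pow] at h
  simp only [smul_eq_mul, nsmul_eq_mul, Nat.cast_ofNat, Nat.add_one_sub_one, pow_one] at h
  change theta ℝ treeSeries - treeSeries =
    C (1 / 2) * (2 * (treeSeries * theta ℝ treeSeries)) at h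
  linear_combination h + treeSeries * theta ℝ treeSeries * two_mul_C_half

theorem coeff_treeSeries (n : ℕ) : coeff n treeSeries = n * coeff n (allSeries 0) :=
  coeff_theta _ _

theorem coeff_zero_treeSeries : coeff 0 treeSeries = 0 := by
  rw [coeff_treeSeries]; simp

theorem constantCoeff_treeSeries : constantCoeff treeSeries = 0 := by
  rw [← coeff_zero_eq_constantCoeff_apply, coeff_zero_treeSeries]

theorem coeff_one_treeSeries : coeff 1 treeSeries = 1 := by
  rw [coeff_treeSeries, coeff_one_allSeries_zero]; simp

theorem coeff_treeSeries_nonneg (n : ℕ) : 0 ≤ coeff n treeSeries := by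
  rw [coeff_treeSeries, coeff_allSeries]
  positivity

theorem one_sub_treeSeries_mul_pathSeries : (1 - treeSeries) * pathSeries = 1 :=
  PowerSeries.mul_inv_cancel _ (by simp [constantCoeff_treeSeries])

theorem treeSeries_mul_pathSeries : treeSeries * pathSeries = pathSeries - 1 := by
  linear_combination -one_sub_treeSeries_mul_pathSeries

theorem theta_treeSeries_eq : theta ℝ treeSeries = pathSeries - 1 := by
  linear_combination pathSeries * theta_treeSeries -
    theta ℝ treeSeries * one_sub_treeSeries_mul_pathSeries + treeSeries_mul_pathSeries

theorem theta_pathSeries : theta ℝ pathSeries = pathSeries ^ 3 - pathSeries ^ 2 := by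
  have h := congrArg (theta ℝ) one_sub_treeSeries_mul_pathSeries
  rw [Derivation.leibniz, map_sub, theta_treeSeries_eq,
    show theta ℝ (1 : ℝ⟦X⟧) = 0 from Derivation.map_one_eq_zero _] at h
  simp only [smul_eq_mul] at h
  linear_combination pathSeries * h - theta ℝ pathSeries * one_sub_treeSeries_mul_pathSeries

theorem theta_pathSeries_pow (k : ℕ) :
    theta ℝ (pathSeries ^ k) = k * (pathSeries ^ (k + 2) - pathSeries ^ (k + 1)) := by
  cases k with
  | zero => simp [show theta ℝ (1 : ℝ⟦X⟧) = 0 from Derivation.map_one_eq_zero _]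
  | succ k =>
    rw [Derivation.leibniz_pow, theta_pathSeries]
    simp only [smul_eq_mul, nsmul_eq_mul, Nat.add_one_sub_one]
    ring

theorem one_sub_treeSeries_mul_theta_pathSeries_pow (k : ℕ) :
    (1 - treeSeries) * theta ℝ (pathSeries ^ k) = k * (pathSeries ^ (k + 1) - pathSeries ^ k) := by
  rw [theta_pathSeries_pow]
  linear_combination k * (pathSeries ^ (k + 1) - pathSeries ^ k) *
    one_sub_treeSeries_mul_pathSeries

theorem coeff_mul_nonneg {f g : ℝ⟦X⟧} (hf : ∀ n, 0 ≤ coeff n f) (hg : ∀ n, 0 ≤ coeff n g) (n : ℕ) :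
    0 ≤ coeff n (f * g) := by
  rw [coeff_mul]
  exact Finset.sum_nonneg fun p _ => mul_nonneg (hf _) (hg _)

theorem coeff_pathSeries_nonneg (n : ℕ) : 0 ≤ coeff n pathSeries := by
  induction n using Nat.strong_induction_on with
  | _ n ih =>
    rw [show pathSeries = 1 + treeSeries * pathSeries by rw [treeSeries_mul_pathSeries]; ring,
      map_add, coeff_mul]
    refine add_nonneg ?_ (Finset.sum_nonneg ?_)
    · rw [coeff_one]; split_ifs <;> norm_num
    · rintro ⟨a, b⟩ hab
      rw [Finset.HasAntidiagonal.mem_antidiagonal] at hab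
      simp only at hab ⊢
      rcases Nat.eq_zero_or_pos a with rfl | ha
      · rw [coeff_zero_treeSeries, zero_mul]
      · exact mul_nonneg (coeff_treeSeries_nonneg a) (ih b (by omega))

theorem coeff_pathSeries_pow_nonneg (k n : ℕ) : 0 ≤ coeff n (pathSeries ^ k) := by
  induction k generalizing n with
  | zero => rw [pow_zero, coeff_one]; split_ifs <;> norm_num
  | succ k ih => rw [pow_succ]; exact coeff_mul_nonneg ih coeff_pathSeries_nonneg n

theorem coeff_pathSeries_pow_le_succ (k n : ℕ) :
    coeff n (pathSeries ^ k) ≤ coeff n (pathSeries ^ (k + 1)) := by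
  rw [← sub_nonneg, ← map_sub, show pathSeries ^ (k + 1) - pathSeries ^ k =
    treeSeries * pathSeries ^ (k + 1) by
      linear_combination -pathSeries ^ k * treeSeries_mul_pathSeries]
  exact coeff_mul_nonneg coeff_treeSeries_nonneg (coeff_pathSeries_pow_nonneg _) n

theorem coeff_pathSeries_pow_mono {k l : ℕ} (h : k ≤ l) (n : ℕ) :
    coeff n (pathSeries ^ k) ≤ coeff n (pathSeries ^ l) :=
  monotone_nat_of_le_succ (f := fun k => coeff n (pathSeries ^ k))
    (fun k => coeff_pathSeries_pow_le_succ k n) h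

/-- The coefficients of `f` are dominated by those of `pathSeries ^ k`. -/
def PathDom (k : ℕ) (f : ℝ⟦X⟧) : Prop :=
  ∃ B : ℝ, 0 ≤ B ∧ ∀ n, |coeff n f| ≤ B * coeff n (pathSeries ^ k)

namespace PathDom

theorem mono {k l : ℕ} {f : ℝ⟦X⟧} (hf : PathDom k f) (h : k ≤ l) : PathDom l f := by
  obtain ⟨B, hB, hf⟩ := hf
  exact ⟨B, hB, fun n => (hf n).trans
    (mul_le_mul_of_nonneg_left (coeff_pathSeries_pow_mono h n) hB)⟩

theorem add {k : ℕ} {f g : ℝ⟦X⟧} (hf : PathDom k f) (hg : PathDom k g) : PathDom k (f + g) := by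
  obtain ⟨B, hB, hf⟩ := hf
  obtain ⟨D, hD, hg⟩ := hg
  refine ⟨B + D, add_nonneg hB hD, fun n => ?_⟩
  rw [map_add, add_mul]
  exact (abs_add_le _ _).trans (add_le_add (hf n) (hg n))

theorem mul {k l : ℕ} {f g : ℝ⟦X⟧} (hf : PathDom k f) (hg : PathDom l g) :
    PathDom (k + l) (f * g) := by
  obtain ⟨B, hB, hf⟩ := hf
  obtain ⟨D, hD, hg⟩ := hg
  refine ⟨B * D, mul_nonneg hB hD, fun n => ?_⟩
  rw [pow_add, coeff_mul, coeff_mul, Finset.mul_sum]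
  refine (Finset.abs_sum_le_sum_abs _ _).trans (Finset.sum_le_sum fun p _ => ?_)
  rw [abs_mul]
  calc _ ≤ (B * coeff p.1 (pathSeries ^ k)) * (D * coeff p.2 (pathSeries ^ l)) :=
        mul_le_mul (hf _) (hg _) (abs_nonneg _)
          (mul_nonneg hB (coeff_pathSeries_pow_nonneg _ _))
    _ = _ := by ring

theorem const (c : ℝ) : PathDom 0 (C c) := by
  refine ⟨|c|, abs_nonneg c, fun n => ?_⟩
  rw [pow_zero, coeff_C, coeff_one]
  split_ifs <;> simp

theorem one : PathDom 0 1 := by simpa using const 1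

theorem pow (k : ℕ) : PathDom k (pathSeries ^ k) :=
  ⟨1, zero_le_one, fun n => by rw [abs_of_nonneg (coeff_pathSeries_pow_nonneg _ _), one_mul]⟩

theorem const_mul (c : ℝ) {k : ℕ} {f : ℝ⟦X⟧} (hf : PathDom k f) : PathDom k (C c * f) := by
  simpa using (const c).mul hf

theorem neg {k : ℕ} {f : ℝ⟦X⟧} (hf : PathDom k f) : PathDom k (-f) := by
  simpa using hf.const_mul (-1)

theorem sub {k : ℕ} {f g : ℝ⟦X⟧} (hf : PathDom k f) (hg : PathDom k g) : PathDom k (f - g) := by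
  simpa [sub_eq_add_neg] using hf.add hg.neg

theorem sum {ι : Type*} (s : Finset ι) {k : ℕ} {f : ι → ℝ⟦X⟧} (hf : ∀ i ∈ s, PathDom k (f i)) :
    PathDom k (∑ i ∈ s, f i) := by
  classical
  induction s using Finset.induction_on with
  | empty => simpa using ((const 0).mono k.zero_le)
  | insert a s ha ih =>
    rw [Finset.sum_insert ha]
    exact (hf a (Finset.mem_insert_self a s)).add
      (ih fun i hi => hf i (Finset.mem_insert_of_mem hi))

theorem theta {k : ℕ} {f : ℝ⟦X⟧} (hf : PathDom k f) : PathDom (k + 2) (theta ℝ f) := by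
  obtain ⟨B, hB, hf⟩ := hf
  refine ⟨B * k, by positivity, fun n => ?_⟩
  have h := congrArg (coeff n) (theta_pathSeries_pow k)
  rw [coeff_theta, show (k : ℝ⟦X⟧) = C (k : ℝ) by simp, coeff_C_mul, map_sub] at h
  rw [coeff_theta, abs_mul, Nat.abs_cast]
  calc (n : ℝ) * |coeff n f| ≤ n * (B * coeff n (pathSeries ^ k)) :=
        mul_le_mul_of_nonneg_left (hf n) (Nat.cast_nonneg n)
    _ = B * k * (coeff n (pathSeries ^ (k + 2)) - coeff n (pathSeries ^ (k + 1))) := by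
        linear_combination B * h
    _ ≤ _ := by
        refine mul_le_mul_of_nonneg_left ?_ (by positivity)
        linarith [coeff_pathSeries_pow_nonneg (k + 1) n]

theorem of_one_sub_mul_theta_add {m k : ℕ} (hm : 1 ≤ m) (hk : m ≤ k) {f : ℝ⟦X⟧}
    (hf : PathDom (k + 1) ((1 - treeSeries) * _root_.theta ℝ f + (m : ℝ⟦X⟧) * f)) :
    PathDom k f := by
  obtain ⟨B, hB, hf⟩ := hf
  have hm0 : (0 : ℝ) < m := by exact_mod_cast hm
  have hmC : (m : ℝ⟦X⟧) = C (m : ℝ) := by simp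
  have key : ∀ (g : ℝ⟦X⟧) (n : ℕ), coeff n ((1 - treeSeries) * _root_.theta ℝ g + (m : ℝ⟦X⟧) * g) =
      (n + m) * coeff n g - coeff n (treeSeries * _root_.theta ℝ g) := by
    intro g n
    rw [sub_mul, one_mul, hmC, map_add, map_sub, coeff_C_mul, coeff_theta]
    ring
  refine ⟨B / m, by positivity, fun n => ?_⟩
  induction n using Nat.strong_induction_on with
  | _ n ih =>
    have h1 : |coeff n (treeSeries * _root_.theta ℝ f)| ≤
        B / m * coeff n (treeSeries * _root_.theta ℝ (pathSeries ^ k)) := by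
      rw [coeff_mul, coeff_mul, Finset.mul_sum]
      refine (Finset.abs_sum_le_sum_abs _ _).trans (Finset.sum_le_sum ?_)
      rintro ⟨a, b⟩ hab
      rw [Finset.HasAntidiagonal.mem_antidiagonal] at hab
      simp only [coeff_theta] at hab ⊢
      rcases Nat.eq_zero_or_pos a with rfl | ha
      · simp [coeff_zero_treeSeries]
      · rw [abs_mul, abs_mul, abs_of_nonneg (coeff_treeSeries_nonneg a), Nat.abs_cast]
        calc _ ≤ coeff a treeSeries * (b * (B / m * coeff b (pathSeries ^ k))) := by
              gcongr
              · exact coeff_treeSeries_nonneg a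
              · exact ih b (by omega)
          _ = _ := by ring
    have h2 := hf n
    rw [key] at h2
    have h3 := key (pathSeries ^ k) n
    rw [one_sub_treeSeries_mul_theta_pathSeries_pow, show (k : ℝ⟦X⟧) = C (k : ℝ) by simp, hmC,
      map_add, coeff_C_mul, coeff_C_mul, map_sub] at h3
    have h4 : (m : ℝ) * coeff n (pathSeries ^ (k + 1)) ≤ (n + m) * coeff n (pathSeries ^ k) -
        coeff n (treeSeries * _root_.theta ℝ (pathSeries ^ k)) := by
      rw [← h3]
      have h5 : ((k : ℝ) - m) * (coeff n (pathSeries ^ (k + 1)) - coeff n (pathSeries ^ k)) ≥ 0 :=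
        mul_nonneg (sub_nonneg.2 (by exact_mod_cast hk))
          (sub_nonneg.2 (coeff_pathSeries_pow_le_succ k n))
      linarith
    have h6 : B * coeff n (pathSeries ^ (k + 1)) ≤ B / m * ((n + m) * coeff n (pathSeries ^ k) -
        coeff n (treeSeries * _root_.theta ℝ (pathSeries ^ k))) := by
      calc _ = B / m * (m * coeff n (pathSeries ^ (k + 1))) := by field_simp
        _ ≤ _ := mul_le_mul_of_nonneg_left h4 (by positivity)
    have h7 : ((n : ℝ) + m) * |coeff n f| ≤ (n + m) * (B / m * coeff n (pathSeries ^ k)) := by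
      rw [← abs_of_nonneg (by positivity : (0 : ℝ) ≤ n + m), ← abs_mul,
        abs_of_nonneg (by positivity : (0 : ℝ) ≤ n + m)]
      calc |((n : ℝ) + m) * coeff n f| = |(((n : ℝ) + m) * coeff n f -
            coeff n (treeSeries * _root_.theta ℝ f)) +
            coeff n (treeSeries * _root_.theta ℝ f)| := by
            congr 1; ring
        _ ≤ _ := abs_add_le _ _
        _ ≤ _ := add_le_add (h2.trans h6) h1
        _ = _ := by ring
    exact le_of_mul_le_mul_left h7 (by positivity)

end PathDom

/-- `f` is `c * pathSeries ^ (k + 1)` up to terms dominated by `pathSeries ^ k`. -/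
def HasLead (k : ℕ) (c : ℝ) (f : ℝ⟦X⟧) : Prop := PathDom k (f - C c * pathSeries ^ (k + 1))

namespace HasLead

theorem pathDom {k : ℕ} {c : ℝ} {f : ℝ⟦X⟧} (hf : HasLead k c f) : PathDom (k + 1) f := by
  have h := (hf.mono k.le_succ).add ((PathDom.pow (k + 1)).const_mul c)
  rwa [sub_add_cancel] at h

theorem add_pathDom {k : ℕ} {c : ℝ} {f g : ℝ⟦X⟧} (hf : HasLead k c f) (hg : PathDom k g) :
    HasLead k c (f + g) := by
  have h := PathDom.add hf hg
  rwa [sub_add_eq_add_sub] at h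

theorem add {k : ℕ} {c d : ℝ} {f g : ℝ⟦X⟧} (hf : HasLead k c f) (hg : HasLead k d g) :
    HasLead k (c + d) (f + g) := by
  have h := PathDom.add hf hg
  rwa [show f - C c * pathSeries ^ (k + 1) + (g - C d * pathSeries ^ (k + 1)) =
    f + g - C (c + d) * pathSeries ^ (k + 1) by rw [map_add]; ring] at h

theorem const_mul (b : ℝ) {k : ℕ} {c : ℝ} {f : ℝ⟦X⟧} (hf : HasLead k c f) :
    HasLead k (b * c) (C b * f) := by
  have h := PathDom.const_mul b hf
  rwa [show C b * (f - C c * pathSeries ^ (k + 1)) = C b * f - C (b * c) * pathSeries ^ (k + 1) by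
    rw [map_mul]; ring] at h

theorem mul {k l : ℕ} {c d : ℝ} {f g : ℝ⟦X⟧} (hf : HasLead k c f) (hg : HasLead l d g) :
    HasLead (k + l + 1) (c * d) (f * g) := by
  have h1 := PathDom.mul hf hg.pathDom
  have h2 := ((PathDom.pow (k + 1)).const_mul c).mul hg
  have h := (h1.mono (by omega : k + (l + 1) ≤ k + l + 1)).add
    (h2.mono (by omega : k + 1 + l ≤ k + l + 1))
  refine (congrArg (PathDom _) ?_).mp h
  rw [map_mul]
  ring

theorem sum {ι : Type*} (s : Finset ι) {k : ℕ} {c : ι → ℝ} {f : ι → ℝ⟦X⟧}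
    (hf : ∀ i ∈ s, HasLead k (c i) (f i)) : HasLead k (∑ i ∈ s, c i) (∑ i ∈ s, f i) := by
  have h := PathDom.sum s hf
  rwa [Finset.sum_sub_distrib, ← Finset.sum_mul, ← map_sum] at h

theorem theta {k : ℕ} {c : ℝ} {f : ℝ⟦X⟧} (hf : HasLead k c f) :
    HasLead (k + 2) ((k + 1) * c) (theta ℝ f) := by
  have h := (PathDom.theta hf).sub ((PathDom.pow (k + 2)).const_mul ((k + 1) * c))
  rw [map_sub, theta_C_mul, theta_pathSeries_pow] at h
  refine (congrArg (PathDom _) ?_).mp h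
  simp only [map_mul, map_add, map_natCast, map_one, Nat.cast_add, Nat.cast_one]
  ring

theorem of_one_sub_mul_theta_add {m k : ℕ} (hm : 1 ≤ m) (hk : m ≤ k) {f : ℝ⟦X⟧} {c : ℝ}
    (hf : HasLead (k + 1) c ((1 - treeSeries) * _root_.theta ℝ f + (m : ℝ⟦X⟧) * f)) :
    HasLead k (c / (k + 1)) f := by
  refine PathDom.of_one_sub_mul_theta_add hm hk ?_
  have h := PathDom.sub hf ((PathDom.pow (k + 1)).const_mul ((m - (k + 1)) * (c / (k + 1))))
  refine (congrArg (PathDom _) ?_).mp h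
  have hc : (C c : ℝ⟦X⟧) = (k + 1) * C (c / (k + 1)) := by
    rw [show ((k : ℝ⟦X⟧) + 1) = C ((k : ℝ) + 1) by simp, ← map_mul]
    congr 1
    field_simp
  have h1 := one_sub_treeSeries_mul_theta_pathSeries_pow (k + 1)
  rw [map_sub (_root_.theta ℝ), theta_C_mul, map_mul, map_sub, map_natCast, map_add, map_natCast,
    map_one]
  push_cast at h1
  linear_combination (-pathSeries ^ (k + 2)) * hc + C (c / (k + 1)) * h1

end HasLead

end TreeFunction

section LeadingTerms

open PowerSeries

/-- The leading coefficients of the excess series, normalised. -/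
noncomputable def leadCoeff : ℕ → ℝ
  | 0 => 1 / 2
  | k + 1 => 1 / 2 * ((3 * k + 2) * leadCoeff k +
      ∑ j : Fin (k + 1), leadCoeff j * leadCoeff (k - j))
decreasing_by all_goals omega

theorem leadCoeff_succ (k : ℕ) : leadCoeff (k + 1) = 1 / 2 * ((3 * k + 2) * leadCoeff k +
    ∑ p ∈ Finset.HasAntidiagonal.antidiagonal k, leadCoeff p.1 * leadCoeff p.2) := by
  rw [leadCoeff, Finset.Nat.sum_antidiagonal_eq_sum_range_succ_mk, Finset.sum_range]

theorem leadCoeff_pos (k : ℕ) : 0 < leadCoeff k := by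
  induction k using Nat.strong_induction_on with
  | _ k ih =>
    cases k with
    | zero => rw [leadCoeff]; norm_num
    | succ k =>
      rw [leadCoeff_succ]
      have h1 := ih k (by omega)
      have h2 : 0 ≤ ∑ p ∈ Finset.HasAntidiagonal.antidiagonal k,
          leadCoeff p.1 * leadCoeff p.2 := by
        refine Finset.sum_nonneg fun p hp => ?_
        rw [Finset.HasAntidiagonal.mem_antidiagonal] at hp
        exact mul_nonneg (ih p.1 (by omega)).le (ih p.2 (by omega)).le
      positivity

theorem allSeries_zero_eq_treeSeries :
    allSeries 0 = treeSeries - C (1 / 2) * treeSeries ^ 2 := by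
  have h := allSeries_zero_eq
  change treeSeries - allSeries 0 = C (1 / 2) * treeSeries ^ 2 at h
  linear_combination -h

theorem eq_of_theta_sub_eq {F G : ℝ⟦X⟧} (hF : theta ℝ F - F = C (1 / 2) * theta ℝ F ^ 2)
    (hG : theta ℝ G - G = C (1 / 2) * theta ℝ G ^ 2) (hF0 : coeff 0 F = coeff 0 G)
    (hF1 : coeff 1 F = coeff 1 G) : F = G := by
  ext n
  induction n using Nat.strong_induction_on with
  | _ n ih =>
    rcases n with _ | _ | n
    · exact hF0
    · exact hF1
    · have h1 := congrArg (coeff (n + 2)) hF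
      have h2 := congrArg (coeff (n + 2)) hG
      rw [map_sub, coeff_theta, coeff_C_mul, pow_two, coeff_mul] at h1 h2
      have h3 : ∑ p ∈ Finset.HasAntidiagonal.antidiagonal (n + 2),
          coeff p.1 (theta ℝ F) * coeff p.2 (theta ℝ F) =
          ∑ p ∈ Finset.HasAntidiagonal.antidiagonal (n + 2),
          coeff p.1 (theta ℝ G) * coeff p.2 (theta ℝ G) := by
        refine Finset.sum_congr rfl ?_
        rintro ⟨a, b⟩ hab
        rw [Finset.HasAntidiagonal.mem_antidiagonal] at hab
        simp only [coeff_theta] at hab ⊢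
        rcases Nat.eq_zero_or_pos a with rfl | ha
        · simp
        rcases Nat.eq_zero_or_pos b with rfl | hb
        · simp
        rw [ih a (by omega), ih b (by omega)]
      rw [h3, ← h2] at h1
      have h4 : ((n : ℝ) + 1) * (coeff (n + 2) F - coeff (n + 2) G) = 0 := by
        push_cast at h1
        linear_combination h1
      rcases mul_eq_zero.1 h4 with h5 | h5
      · exact absurd h5 (by positivity)
      · exact sub_eq_zero.1 h5

theorem evenSeries_zero : evenSeries 0 = allSeries 0 := by
  refine eq_of_theta_sub_eq evenSeries_zero_eq allSeries_zero_eq ?_ ?_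
  · rw [evenSeries, coeff_C_mul, coeff_forget, coeff_zero_bicolSeries, coeff_zero_allSeries]
    simp
  · rw [evenSeries, coeff_C_mul, coeff_forget, coeff_one_bicolSeries_zero,
      coeff_one_allSeries_zero]
    norm_num

theorem sum_antidiagonal_succ_split (f : ℕ → ℝ⟦X⟧) (k : ℕ) :
    ∑ p ∈ Finset.HasAntidiagonal.antidiagonal (k + 2), f p.1 * f p.2 =
      2 * (f 0 * f (k + 2)) +
        ∑ p ∈ Finset.HasAntidiagonal.antidiagonal k, f (p.1 + 1) * f (p.2 + 1) := by
  rw [Finset.Nat.sum_antidiagonal_succ, Finset.Nat.sum_antidiagonal_succ']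
  ring

theorem pathDom_treeSeries : PathDom 1 treeSeries := by
  refine ⟨1, zero_le_one, fun n => ?_⟩
  rw [abs_of_nonneg (coeff_treeSeries_nonneg n), one_mul, pow_one, ← sub_nonneg, ← map_sub,
    show pathSeries - treeSeries = 1 + treeSeries * (treeSeries * pathSeries) by
      linear_combination (-1 - treeSeries) * treeSeries_mul_pathSeries, map_add]
  refine add_nonneg ?_ (coeff_mul_nonneg coeff_treeSeries_nonneg
    (coeff_mul_nonneg coeff_treeSeries_nonneg coeff_pathSeries_nonneg) n)
  rw [coeff_one]
  split_ifs <;> norm_num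

theorem hasLead_of_recurrence {a b : ℝ} {U E : ℕ → ℝ⟦X⟧} (hU : U 0 = allSeries 0)
    (hE0 : PathDom 1 (pathSeries * E 0)) (hE : ∀ k, PathDom (3 * k + 3) (E (k + 1)))
    (hrec : ∀ k, theta ℝ (U (k + 1)) + (k : ℝ⟦X⟧) * U (k + 1) + theta ℝ (U k) +
      ((k : ℝ⟦X⟧) - 1) * U k = C a * theta ℝ (theta ℝ (U k)) + C b * theta ℝ (U k) + E k +
        C (1 / 2) * ∑ p ∈ Finset.HasAntidiagonal.antidiagonal (k + 1),
          theta ℝ (U p.1) * theta ℝ (U p.2)) (k : ℕ) :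
    HasLead (3 * k + 1) ((2 * a) ^ (k + 1) * leadCoeff k) (theta ℝ (U (k + 1))) ∧
      (1 ≤ k → HasLead (3 * k - 1) ((2 * a) ^ (k + 1) * leadCoeff k / (3 * k)) (U (k + 1))) := by
  have hT : theta ℝ (U 0) = treeSeries := by rw [hU, treeSeries]
  induction k using Nat.strong_induction_on with
  | _ k ih =>
  rcases k with _ | k
  · refine ⟨?_, by omega⟩
    have h := hrec 0
    rw [Finset.Nat.sum_antidiagonal_succ, Finset.HasAntidiagonal.antidiagonal_zero,
      Finset.sum_singleton] at h
    simp only [zero_add, hT, theta_treeSeries_eq, Nat.cast_zero, zero_mul, zero_sub, add_zero] at h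
    have h2 : theta ℝ (U 1) = C a * pathSeries ^ 2 + (-(C a * pathSeries) +
        C b * (pathSeries - 1) - C (1 / 2) * (pathSeries - 1 - treeSeries) + pathSeries * E 0) := by
      rw [hU, allSeries_zero_eq_treeSeries] at h
      linear_combination pathSeries * h - theta ℝ (U 1) * one_sub_treeSeries_mul_pathSeries +
        pathSeries * treeSeries * theta ℝ (U 1) * two_mul_C_half +
        (C b - C (1 / 2) * (1 + treeSeries)) * treeSeries_mul_pathSeries
    have hp := PathDom.pow 1
    rw [pow_one] at hp
    have h1 := PathDom.one.mono zero_le_one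
    rw [HasLead, h2]
    refine (congrArg (PathDom _) ?_).mp ((((hp.const_mul a).neg.add
      ((hp.sub h1).const_mul b)).sub (((hp.sub h1).sub pathDom_treeSeries).const_mul (1 / 2))).add
        hE0)
    rw [leadCoeff]
    ring_nf
  · have hk := (ih k (by omega)).1
    have hUk : PathDom (3 * k + 3) (C (k : ℝ) * U (k + 1)) := by
      rcases Nat.eq_zero_or_pos k with rfl | hk0
      · simpa using (PathDom.const 0).mono (Nat.zero_le _)
      · exact (((ih k (by omega)).2 hk0).pathDom.mono (by omega)).const_mul k
    have h := hrec (k + 1)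
    rw [sum_antidiagonal_succ_split (fun i => theta ℝ (U i)) k] at h
    have hR : HasLead (3 * k + 2 + 1) ((2 * a) ^ (k + 2) * leadCoeff (k + 1))
        ((1 - treeSeries) * theta ℝ (U (k + 2)) + ((k + 1 : ℕ) : ℝ⟦X⟧) * U (k + 2)) := by
      have h3 := (hk.theta.const_mul a).add ((HasLead.sum
        (Finset.HasAntidiagonal.antidiagonal k) (k := 3 * k + 3)
        (c := fun p => (2 * a) ^ (k + 2) * (leadCoeff p.1 * leadCoeff p.2))
        (f := fun p => theta ℝ (U (p.1 + 1)) * theta ℝ (U (p.2 + 1))) ?_).const_mul (1 / 2))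
      · have h4 := h3.add_pathDom (((hk.pathDom.mono (by omega)).const_mul b).add ((hE k).sub
          ((hk.pathDom.mono (by omega)).add hUk)))
        convert h4 using 1
        · rw [leadCoeff_succ, ← Finset.mul_sum]
          push_cast
          ring
        · rw [hT] at h
          rw [map_natCast]
          push_cast at h ⊢
          linear_combination h + treeSeries * theta ℝ (U (k + 2)) * two_mul_C_half
      · rintro ⟨i, j⟩ hij
        rw [Finset.HasAntidiagonal.mem_antidiagonal] at hij
        simp only at hij ⊢
        have h5 := (ih i (by omega)).1.mul (ih j (by omega)).1
        convert h5 using 1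
        · omega
        · rw [← hij]; ring
    have h6 := HasLead.of_one_sub_mul_theta_add (by omega : 1 ≤ k + 1) (by omega) hR
    refine ⟨?_, fun _ => ?_⟩
    · have h7 := h6.theta
      rwa [mul_div_cancel₀ _ (by positivity)] at h7
    · have h8 : (3 * ((k + 1 : ℕ) : ℝ)) = ((3 * k + 2 : ℕ) : ℝ) + 1 := by
        push_cast
        ring
      rw [h8]
      exact h6

end LeadingTerms

section Evaluation

open PowerSeries

/-- Absolute convergence of a power series at a point. -/
def ConvAt (x : ℝ) (f : ℝ⟦X⟧) : Prop := Summable fun n => ‖coeff n f * x ^ n‖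

/-- The value of a power series at a point. -/
noncomputable def valueAt (x : ℝ) (f : ℝ⟦X⟧) : ℝ := ∑' n, coeff n f * x ^ n

theorem coeff_mul_mul_pow (f g : ℝ⟦X⟧) (x : ℝ) (n : ℕ) : coeff n (f * g) * x ^ n =
    ∑ p ∈ Finset.HasAntidiagonal.antidiagonal n,
      (coeff p.1 f * x ^ p.1) * (coeff p.2 g * x ^ p.2) := by
  rw [coeff_mul, Finset.sum_mul]
  refine Finset.sum_congr rfl fun p hp => ?_
  rw [← Finset.HasAntidiagonal.mem_antidiagonal.1 hp, pow_add]
  ring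

namespace ConvAt

variable {x : ℝ} {f g : ℝ⟦X⟧}

theorem mul (hf : ConvAt x f) (hg : ConvAt x g) : ConvAt x (f * g) := by
  unfold ConvAt
  simp only [coeff_mul_mul_pow]
  exact summable_norm_sum_mul_antidiagonal_of_summable_norm
    (f := fun n => coeff n f * x ^ n) (g := fun n => coeff n g * x ^ n) hf hg

theorem const (c : ℝ) : ConvAt x (C c) := by
  refine summable_of_ne_finset_zero (s := {0}) fun n hn => ?_
  rw [Finset.mem_singleton] at hn
  simp [coeff_C, hn]

theorem pow (hf : ConvAt x f) (k : ℕ) : ConvAt x (f ^ k) := by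
  induction k with
  | zero => simpa using const (x := x) 1
  | succ k ih => rw [pow_succ]; exact ih.mul hf

end ConvAt

theorem valueAt_add {x : ℝ} {f g : ℝ⟦X⟧} (hf : ConvAt x f) (hg : ConvAt x g) :
    valueAt x (f + g) = valueAt x f + valueAt x g := by
  unfold valueAt
  rw [← Summable.tsum_add hf.of_norm hg.of_norm]
  simp only [map_add, add_mul]

theorem valueAt_mul {x : ℝ} {f g : ℝ⟦X⟧} (hf : ConvAt x f) (hg : ConvAt x g) :
    valueAt x (f * g) = valueAt x f * valueAt x g := by
  unfold valueAt
  rw [tsum_mul_tsum_eq_tsum_sum_antidiagonal_of_summable_norm hf hg]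
  simp only [coeff_mul_mul_pow]

theorem valueAt_C (x c : ℝ) : valueAt x (C c) = c := by
  unfold valueAt
  rw [tsum_eq_single 0]
  · simp
  · intro n hn
    simp [coeff_C, hn]

theorem valueAt_pow {x : ℝ} {f : ℝ⟦X⟧} (hf : ConvAt x f) (k : ℕ) :
    valueAt x (f ^ k) = valueAt x f ^ k := by
  induction k with
  | zero => simpa using valueAt_C x 1
  | succ k ih => rw [pow_succ, valueAt_mul (hf.pow k) hf, ih, pow_succ]

theorem sum_range_antidiagonal_le {f : ℕ × ℕ → ℝ} (hf : ∀ p, 0 ≤ f p) (N : ℕ) :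
    ∑ n ∈ Finset.range N, ∑ p ∈ Finset.HasAntidiagonal.antidiagonal n, f p ≤
      ∑ p ∈ Finset.range N ×ˢ Finset.range N, f p := by
  refine le_trans (le_of_eq (Finset.sum_congr rfl fun n hn => ?_))
    (Finset.sum_fiberwise_le_sum_of_sum_fiber_nonneg (s := Finset.range N ×ˢ Finset.range N)
      (t := Finset.range N) (g := fun p : ℕ × ℕ => p.1 + p.2) (f := f)
      fun y _ => Finset.sum_nonneg fun p _ => hf p)
  refine Finset.sum_congr ?_ fun _ _ => rfl
  ext ⟨a, b⟩
  simp only [Finset.HasAntidiagonal.mem_antidiagonal, Finset.mem_filter, Finset.mem_product,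
    Finset.mem_range] at hn ⊢
  omega

theorem sum_mul_exp_neg_le_one {c : ℕ → ℝ} (h0 : c 0 = 1) (hc : ∀ n, 0 ≤ c n)
    (hrec : ∀ n : ℕ, (n + 1) * c (n + 1) =
      ∑ p ∈ Finset.HasAntidiagonal.antidiagonal n, c p.1 * ((p.2 + 1) * c p.2))
    (N : ℕ) {x : ℝ} (hx : 0 ≤ x) :
    (∑ n ∈ Finset.range (N + 1), c n * x ^ n) *
      Real.exp (-(x * ∑ n ∈ Finset.range (N + 1), c n * x ^ n)) ≤ 1 := by
  set q : ℝ → ℝ := fun y => ∑ n ∈ Finset.range (N + 1), c n * y ^ n with hq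
  set q' : ℝ → ℝ := fun y => ∑ n ∈ Finset.range (N + 1), c n * (n * y ^ (n - 1)) with hq'
  have hder : ∀ y, HasDerivAt q (q' y) y := fun y =>
    HasDerivAt.fun_sum fun n _ => (hasDerivAt_pow n y).const_mul (c n)
  have hF : ∀ y, HasDerivAt (fun y => q y * Real.exp (-(y * q y)))
      (q' y * Real.exp (-(y * q y)) +
        q y * (Real.exp (-(y * q y)) * -(1 * q y + y * q' y))) y := fun y =>
    (hder y).mul ((((hasDerivAt_id' y).mul (hder y)).neg).exp)
  have hle : ∀ y, 0 ≤ y → q' y ≤ q y * (q y + y * q' y) := by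
    intro y hy
    have e1 : q' y = ∑ n ∈ Finset.range N, ∑ p ∈ Finset.HasAntidiagonal.antidiagonal n,
        (c p.1 * y ^ p.1) * (((p.2 + 1) * c p.2) * y ^ p.2) := by
      simp only [hq']
      rw [Finset.sum_range_succ']
      simp only [Nat.cast_zero, zero_mul, mul_zero, add_zero, Nat.add_one_sub_one]
      refine Finset.sum_congr rfl fun n _ => ?_
      push_cast
      rw [show c (n + 1) * ((n + 1) * y ^ n) = ((n + 1) * c (n + 1)) * y ^ n by ring, hrec,
        Finset.sum_mul]
      refine Finset.sum_congr rfl fun p hp => ?_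
      rw [← Finset.HasAntidiagonal.mem_antidiagonal.1 hp, pow_add]
      ring
    have e2 : q y + y * q' y = ∑ n ∈ Finset.range (N + 1), ((n + 1) * c n) * y ^ n := by
      simp only [hq, hq', Finset.mul_sum]
      rw [← Finset.sum_add_distrib]
      refine Finset.sum_congr rfl fun n _ => ?_
      rcases n with _ | n
      · simp
      · simp only [Nat.add_one_sub_one]; ring
    have hnn : ∀ p : ℕ × ℕ, 0 ≤ (c p.1 * y ^ p.1) * (((p.2 + 1) * c p.2) * y ^ p.2) := by
      intro p
      have := hc p.1
      have := hc p.2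
      positivity
    rw [e2, e1]
    refine (sum_range_antidiagonal_le hnn N).trans ?_
    simp only [hq]
    rw [Finset.sum_mul_sum, ← Finset.sum_product']
    refine Finset.sum_le_sum_of_subset_of_nonneg ?_ fun p _ _ => hnn p
    exact Finset.product_subset_product (Finset.range_mono (by omega))
      (Finset.range_mono (by omega))
  have hanti : AntitoneOn (fun y => q y * Real.exp (-(y * q y))) (Set.Ici 0) := by
    refine antitoneOn_of_deriv_nonpos (convex_Ici 0)
      (fun y _ => (hF y).continuousAt.continuousWithinAt)
      (fun y _ => (hF y).differentiableAt.differentiableWithinAt) fun y hy => ?_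
    rw [interior_Ici] at hy
    rw [(hF y).deriv]
    have h1 := mul_nonneg (Real.exp_pos (-(y * q y))).le (sub_nonneg.2 (hle y (le_of_lt hy)))
    linarith
  have h1 := hanti (Set.mem_Ici.2 le_rfl) (Set.mem_Ici.2 hx) hx
  have h2 : q 0 = 1 := by
    simp only [hq]
    rw [Finset.sum_range_succ']
    simp [h0]
  simpa [h2] using h1

theorem mul_sum_lt_one {c : ℕ → ℝ} (h0 : c 0 = 1) (hc : ∀ n, 0 ≤ c n)
    (hrec : ∀ n : ℕ, (n + 1) * c (n + 1) =
      ∑ p ∈ Finset.HasAntidiagonal.antidiagonal n, c p.1 * ((p.2 + 1) * c p.2))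
    (N : ℕ) {x : ℝ} (hx : 0 ≤ x) (hx' : x < (Real.exp 1)⁻¹) :
    x * ∑ n ∈ Finset.range (N + 1), c n * x ^ n < 1 := by
  by_contra! h
  have hcont : ContinuousOn (fun y : ℝ => y * ∑ n ∈ Finset.range (N + 1), c n * y ^ n)
      (Set.Icc 0 x) := by fun_prop
  obtain ⟨y, hy, hy1⟩ := intermediate_value_Icc hx hcont ⟨by simp, h⟩
  have h1 := sum_mul_exp_neg_le_one h0 hc hrec N hy.1
  simp only at hy1
  rw [hy1] at h1
  have h2 := mul_le_mul_of_nonneg_left h1 hy.1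
  rw [← mul_assoc, hy1, one_mul, Real.exp_neg, mul_one] at h2
  linarith [hy.2]

theorem treeSeries_recurrence (n : ℕ) :
    ((n : ℝ) + 1) * coeff (n + 2) treeSeries = ∑ p ∈ Finset.HasAntidiagonal.antidiagonal n,
      coeff (p.1 + 1) treeSeries * ((p.2 + 1) * coeff (p.2 + 1) treeSeries) := by
  have h := congrArg (coeff (n + 2)) theta_treeSeries
  rw [map_add, coeff_theta, coeff_mul, Finset.Nat.sum_antidiagonal_succ,
    Finset.Nat.sum_antidiagonal_succ'] at h
  simp only [coeff_zero_treeSeries, coeff_theta, zero_mul, zero_add, Nat.cast_zero,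
    mul_zero] at h
  push_cast at h
  linear_combination h

theorem mul_sum_treeSeries (N : ℕ) (x : ℝ) :
    x * ∑ n ∈ Finset.range (N + 1), coeff (n + 1) treeSeries * x ^ n =
      ∑ n ∈ Finset.range (N + 2), coeff n treeSeries * x ^ n := by
  rw [Finset.sum_range_succ' _ (N + 1), coeff_zero_treeSeries, zero_mul, add_zero, Finset.mul_sum]
  exact Finset.sum_congr rfl fun n _ => by ring

theorem sum_treeSeries_le_one (N : ℕ) {x : ℝ} (hx : 0 ≤ x) (hx' : x < (Real.exp 1)⁻¹) :
    ∑ n ∈ Finset.range N, coeff n treeSeries * x ^ n ≤ 1 := by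
  have h := mul_sum_lt_one (c := fun n => coeff (n + 1) treeSeries) coeff_one_treeSeries
    (fun n => coeff_treeSeries_nonneg _) treeSeries_recurrence N hx hx'
  rw [mul_sum_treeSeries] at h
  refine le_trans (Finset.sum_le_sum_of_subset_of_nonneg (Finset.range_mono (by omega))
    fun n _ _ => ?_) h.le
  exact mul_nonneg (coeff_treeSeries_nonneg n) (pow_nonneg hx n)

variable {x : ℝ}

theorem convAt_iff_summable {f : ℝ⟦X⟧} (hf : ∀ n, 0 ≤ coeff n f) (hx : 0 ≤ x) :
    ConvAt x f ↔ Summable fun n => coeff n f * x ^ n := by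
  unfold ConvAt
  simp only [Real.norm_of_nonneg (mul_nonneg (hf _) (pow_nonneg hx _))]

theorem convAt_treeSeries (hx : 0 ≤ x) (hx' : x < (Real.exp 1)⁻¹) : ConvAt x treeSeries := by
  rw [convAt_iff_summable coeff_treeSeries_nonneg hx]
  exact summable_of_sum_range_le
    (fun n => mul_nonneg (coeff_treeSeries_nonneg n) (pow_nonneg hx n))
    fun N => sum_treeSeries_le_one N hx hx'

theorem treeSeries_mul_exp_le (hx : 0 ≤ x) (hx' : x < (Real.exp 1)⁻¹) :
    valueAt x treeSeries * Real.exp (-valueAt x treeSeries) ≤ x := by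
  have h1 : Tendsto (fun N => ∑ n ∈ Finset.range (N + 2), coeff n treeSeries * x ^ n) atTop
      (nhds (valueAt x treeSeries)) :=
    ((convAt_treeSeries hx hx').of_norm.hasSum.tendsto_sum_nat).comp (tendsto_add_atTop_nat 2)
  refine le_of_tendsto (h1.mul ((Real.continuous_exp.tendsto _).comp h1.neg))
    (Eventually.of_forall fun N => ?_)
  have h2 := sum_mul_exp_neg_le_one (c := fun n => coeff (n + 1) treeSeries) coeff_one_treeSeries
    (fun n => coeff_treeSeries_nonneg _) treeSeries_recurrence N hx
  have h3 := mul_le_mul_of_nonneg_left h2 hx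
  rw [← mul_assoc, mul_sum_treeSeries, mul_one] at h3
  exact h3

theorem valueAt_nonneg {f : ℝ⟦X⟧} (hf : ∀ n, 0 ≤ coeff n f) (hx : 0 ≤ x) : 0 ≤ valueAt x f :=
  tsum_nonneg fun n => mul_nonneg (hf n) (pow_nonneg hx n)

theorem valueAt_treeSeries_lt_one (hx : 0 ≤ x) (hx' : x < (Real.exp 1)⁻¹) :
    valueAt x treeSeries < 1 := by
  refine lt_of_le_of_ne ?_ fun h => ?_
  · exact Real.tsum_le_of_sum_range_le
      (fun n => mul_nonneg (coeff_treeSeries_nonneg n) (pow_nonneg hx n))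
      fun N => sum_treeSeries_le_one N hx hx'
  · have h1 := treeSeries_mul_exp_le hx hx'
    rw [h, one_mul, Real.exp_neg] at h1
    linarith

theorem convAt_pathSeries (hx : 0 ≤ x) (hx' : x < (Real.exp 1)⁻¹) : ConvAt x pathSeries := by
  rw [convAt_iff_summable coeff_pathSeries_nonneg hx]
  have hT := valueAt_treeSeries_lt_one hx hx'
  refine summable_of_sum_range_le (c := (1 - valueAt x treeSeries)⁻¹)
    (fun n => mul_nonneg (coeff_pathSeries_nonneg n) (pow_nonneg hx n)) fun N => ?_
  have hvn : ∀ n, 0 ≤ coeff n pathSeries * x ^ n := fun n =>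
    mul_nonneg (coeff_pathSeries_nonneg n) (pow_nonneg hx n)
  have htn : ∀ n, 0 ≤ coeff n treeSeries * x ^ n := fun n =>
    mul_nonneg (coeff_treeSeries_nonneg n) (pow_nonneg hx n)
  have h1 : ∑ n ∈ Finset.range N, coeff n pathSeries * x ^ n ≤
      1 + valueAt x treeSeries * ∑ n ∈ Finset.range N, coeff n pathSeries * x ^ n := by
    calc _ = ∑ n ∈ Finset.range N, coeff n (1 : ℝ⟦X⟧) * x ^ n +
          ∑ n ∈ Finset.range N, ∑ p ∈ Finset.HasAntidiagonal.antidiagonal n,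
            (coeff p.1 treeSeries * x ^ p.1) * (coeff p.2 pathSeries * x ^ p.2) := by
          rw [← Finset.sum_add_distrib]
          refine Finset.sum_congr rfl fun n _ => ?_
          rw [← coeff_mul_mul_pow, treeSeries_mul_pathSeries, map_sub]
          ring
      _ ≤ 1 + _ := by
          refine add_le_add ?_ (sum_range_antidiagonal_le
            (f := fun p => (coeff p.1 treeSeries * x ^ p.1) * (coeff p.2 pathSeries * x ^ p.2))
            (fun p => mul_nonneg (htn _) (hvn _)) N)
          cases N with
          | zero => simp
          | succ N => rw [Finset.sum_range_succ']; simp [coeff_one]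
      _ ≤ _ := by
          rw [Finset.sum_product]
          simp only
          rw [← Finset.sum_mul_sum]
          gcongr
          · exact Finset.sum_nonneg fun n _ => hvn n
          · exact (convAt_treeSeries hx hx').of_norm.sum_le_tsum _ fun n _ => htn n
  rw [inv_eq_one_div, le_div_iff₀ (by linarith)]
  linarith

theorem one_sub_mul_valueAt_pathSeries (hx : 0 ≤ x) (hx' : x < (Real.exp 1)⁻¹) :
    (1 - valueAt x treeSeries) * valueAt x pathSeries = 1 := by
  have hT := convAt_treeSeries hx hx'
  have hv := convAt_pathSeries hx hx'
  have h : pathSeries = treeSeries * pathSeries + C 1 := by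
    rw [treeSeries_mul_pathSeries, map_one]; ring
  have h1 := congrArg (valueAt x) h
  rw [valueAt_add (hT.mul hv) (ConvAt.const 1), valueAt_mul hT hv, valueAt_C] at h1
  linear_combination h1

end Evaluation

section Singularity

open PowerSeries

variable {x : ℝ}

theorem hasDerivAt_valueAt_treeSeries (hx : 0 < x) (hx' : x < (Real.exp 1)⁻¹) :
    HasDerivAt (fun y => valueAt y treeSeries) ((valueAt x pathSeries - 1) / x) x := by
  obtain ⟨r, hxr, hr⟩ := exists_between hx'
  have hr0 : 0 < r := hx.trans hxr
  have hθ : ∀ n, coeff n pathSeries - coeff n (1 : ℝ⟦X⟧) = n * coeff n treeSeries := fun n => by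
    rw [← coeff_theta, theta_treeSeries_eq, map_sub]
  have hsum : ∀ y, 0 < y → y < (Real.exp 1)⁻¹ →
      HasSum (fun n => coeff n treeSeries * (n * y ^ (n - 1)))
        ((valueAt y pathSeries - 1) / y) := by
    intro y hy hy'
    have h1 := ((convAt_pathSeries hy.le hy').of_norm.hasSum.sub
      ((ConvAt.const (x := y) 1).of_norm.hasSum)).div_const y
    have h2 : ∑' n, coeff n (C (1 : ℝ)) * y ^ n = 1 := valueAt_C y 1
    rw [h2] at h1
    refine (congrArg (fun f => HasSum f _) (funext fun n => ?_)).mp h1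
    rw [← sub_mul, map_one, hθ]
    rcases n with _ | n
    · simp
    · simp only [Nat.add_one_sub_one]
      field_simp
      ring
  have h := hasDerivAt_tsum_of_isPreconnected (t := Set.Ioo 0 r) (y₀ := x) (y := x)
    (u := fun n : ℕ => coeff n treeSeries * (n * r ^ (n - 1)))
    (g := fun n y => coeff n treeSeries * y ^ n)
    (g' := fun n y => coeff n treeSeries * (n * y ^ (n - 1)))
    (hsum r hr0 hr).summable isOpen_Ioo isPreconnected_Ioo
    (fun n y _ => (hasDerivAt_pow n y).const_mul _) (fun n y hy => ?_) ⟨hx, hxr⟩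
    (convAt_treeSeries hx.le hx').of_norm ⟨hx, hxr⟩
  · rwa [(hsum x hx hx').tsum_eq] at h
  · have := coeff_treeSeries_nonneg n
    have h0 := hy.1.le
    have h1 := hy.2.le
    rw [Real.norm_of_nonneg (by positivity)]
    gcongr

theorem valueAt_treeSeries_le (hx : 0 ≤ x) (hx' : x < (Real.exp 1)⁻¹) :
    valueAt x treeSeries ≤ Real.exp 1 * x := by
  have h1 := treeSeries_mul_exp_le hx hx'
  have h2 := valueAt_treeSeries_lt_one hx hx'
  have h3 := valueAt_nonneg coeff_treeSeries_nonneg hx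
  calc valueAt x treeSeries = Real.exp (valueAt x treeSeries) *
        (valueAt x treeSeries * Real.exp (-valueAt x treeSeries)) := by
        rw [Real.exp_neg]; field_simp
    _ ≤ Real.exp 1 * x := by gcongr

theorem le_valueAt_treeSeries (hx : 0 ≤ x) (hx' : x < (Real.exp 1)⁻¹) :
    x ≤ valueAt x treeSeries := by
  have h := (convAt_treeSeries hx hx').of_norm.sum_le_tsum {1}
    fun n _ => mul_nonneg (coeff_treeSeries_nonneg n) (pow_nonneg hx n)
  rwa [Finset.sum_singleton, coeff_one_treeSeries, one_mul, pow_one] at h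

theorem le_treeSeries_mul_exp (hx : 0 < x) (hx' : x < (Real.exp 1)⁻¹) :
    x ≤ valueAt x treeSeries * Real.exp (-valueAt x treeSeries) := by
  set G : ℝ → ℝ := fun y => valueAt y treeSeries * Real.exp (-valueAt y treeSeries) / y with hG
  have hder : ∀ y ∈ Set.Ioo 0 (Real.exp 1)⁻¹, HasDerivAt G 0 y := by
    intro y hy
    have h1 := hasDerivAt_valueAt_treeSeries hy.1 hy.2
    have h2 := ((h1.mul h1.neg.exp).div (hasDerivAt_id' y) hy.1.ne')
    refine h2.congr_deriv ?_
    have h3 := one_sub_mul_valueAt_pathSeries hy.1.le hy.2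
    have hy0 := hy.1.ne'
    simp only [Pi.mul_apply, Pi.neg_apply]
    field_simp
    linear_combination Real.exp (-valueAt y treeSeries) * h3
  have hconst : ∀ y ∈ Set.Ioo 0 (Real.exp 1)⁻¹, G x = G y := fun y hy =>
    isOpen_Ioo.is_const_of_deriv_eq_zero isPreconnected_Ioo
      (fun z hz => (hder z hz).differentiableAt.differentiableWithinAt)
      (fun z hz => (hder z hz).deriv) ⟨hx, hx'⟩ hy
  have hlow : ∀ y ∈ Set.Ioo 0 (Real.exp 1)⁻¹, Real.exp (-(Real.exp 1 * y)) ≤ G x := by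
    intro y hy
    rw [hconst y hy, hG]
    simp only
    rw [le_div_iff₀ hy.1, mul_comm]
    have := valueAt_treeSeries_le hy.1.le hy.2
    exact mul_le_mul (le_valueAt_treeSeries hy.1.le hy.2)
      (Real.exp_le_exp.2 (neg_le_neg this)) (Real.exp_pos _).le
      (valueAt_nonneg coeff_treeSeries_nonneg hy.1.le)
  have hlim : Tendsto (fun y : ℝ => Real.exp (-(Real.exp 1 * y))) (nhdsWithin 0 (Set.Ioi 0))
      (nhds 1) := by
    have : Continuous fun y : ℝ => Real.exp (-(Real.exp 1 * y)) := by fun_prop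
    have h := this.tendsto 0
    simp only [mul_zero, neg_zero, Real.exp_zero] at h
    exact h.mono_left nhdsWithin_le_nhds
  have h1 : 1 ≤ G x := le_of_tendsto hlim (by
    filter_upwards [Ioo_mem_nhdsGT (inv_pos.2 (Real.exp_pos 1))] with y hy using hlow y hy)
  rw [hG] at h1
  simp only at h1
  rwa [le_div_iff₀ hx, one_mul] at h1

theorem eventually_mem_Ioo_inv_exp :
    ∀ᶠ y in nhdsWithin (Real.exp 1)⁻¹ (Set.Iio (Real.exp 1)⁻¹),
      y ∈ Set.Ioo 0 (Real.exp 1)⁻¹ :=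
  Ioo_mem_nhdsLT (inv_pos.2 (Real.exp_pos 1))

theorem mul_exp_neg_mono {s t : ℝ} (hst : s ≤ t) (ht : t < 1) :
    s * Real.exp (-s) ≤ t * Real.exp (-t) := by
  have hmono : MonotoneOn (fun y : ℝ => y * Real.exp (-y)) (Set.Iic 1) := by
    have hd : ∀ y : ℝ, HasDerivAt (fun y : ℝ => y * Real.exp (-y))
        (1 * Real.exp (-y) + y * (Real.exp (-y) * -1)) y := fun y =>
      (hasDerivAt_id' y).mul ((hasDerivAt_id' y).neg.exp)
    refine monotoneOn_of_deriv_nonneg (convex_Iic 1)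
      (fun y _ => (hd y).continuousAt.continuousWithinAt)
      (fun y _ => (hd y).differentiableAt.differentiableWithinAt) fun y hy => ?_
    rw [interior_Iic] at hy
    rw [(hd y).deriv]
    have h1 := mul_nonneg (sub_nonneg.2 (le_of_lt hy)) (Real.exp_pos (-y)).le
    linarith
  exact hmono (hst.trans ht.le) ht.le hst

theorem tendsto_valueAt_treeSeries :
    Tendsto (fun y => valueAt y treeSeries) (nhdsWithin (Real.exp 1)⁻¹ (Set.Iio (Real.exp 1)⁻¹))
      (nhds 1) := by
  refine tendsto_order.2 ⟨fun a ha => ?_, fun a ha => ?_⟩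
  · have h1 : max a 0 * Real.exp (-max a 0) < (Real.exp 1)⁻¹ := by
      have hm : max a 0 < 1 := max_lt ha one_pos
      have h2 := Real.add_one_lt_exp (x := max a 0 - 1) (by linarith)
      rw [sub_add_cancel] at h2
      calc _ < Real.exp (max a 0 - 1) * Real.exp (-max a 0) := by gcongr
        _ = _ := by rw [← Real.exp_add, ← Real.exp_neg]; congr 1; ring
    filter_upwards [eventually_mem_Ioo_inv_exp, Ioo_mem_nhdsLT h1] with y hy hy'
    by_contra! h
    have h2 := mul_exp_neg_mono (h.trans (le_max_left a 0)) (max_lt ha one_pos)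
    linarith [le_treeSeries_mul_exp hy.1 hy.2, hy'.1]
  · filter_upwards [eventually_mem_Ioo_inv_exp] with y hy
    exact (valueAt_treeSeries_lt_one hy.1.le hy.2).trans ha

theorem valueAt_pathSeries (hx : 0 ≤ x) (hx' : x < (Real.exp 1)⁻¹) :
    valueAt x pathSeries = (1 - valueAt x treeSeries)⁻¹ :=
  eq_inv_of_mul_eq_one_right (one_sub_mul_valueAt_pathSeries hx hx')

theorem valueAt_pathSeries_pos (hx : 0 ≤ x) (hx' : x < (Real.exp 1)⁻¹) :
    0 < valueAt x pathSeries := by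
  rw [valueAt_pathSeries hx hx']
  exact inv_pos.2 (sub_pos.2 (valueAt_treeSeries_lt_one hx hx'))

theorem tendsto_inv_valueAt_pathSeries :
    Tendsto (fun y => (valueAt y pathSeries)⁻¹)
      (nhdsWithin (Real.exp 1)⁻¹ (Set.Iio (Real.exp 1)⁻¹)) (nhds 0) := by
  have h := (tendsto_const_nhds (x := (1 : ℝ))).sub tendsto_valueAt_treeSeries
  rw [sub_self] at h
  refine h.congr' ?_
  filter_upwards [eventually_mem_Ioo_inv_exp] with y hy
  rw [valueAt_pathSeries hy.1.le hy.2, inv_inv]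

theorem PathDom.convAt {k : ℕ} {f : ℝ⟦X⟧} (hf : PathDom k f) (hx : 0 ≤ x)
    (hx' : x < (Real.exp 1)⁻¹) : ConvAt x f := by
  obtain ⟨B, hB, hf⟩ := hf
  refine (((convAt_pathSeries hx hx').pow k).mul_left B).of_nonneg_of_le
    (fun _ => norm_nonneg _) fun n => ?_
  rw [norm_mul, norm_mul, ← mul_assoc]
  refine mul_le_mul_of_nonneg_right ?_ (norm_nonneg _)
  rw [Real.norm_of_nonneg (coeff_pathSeries_pow_nonneg k n)]
  exact hf n

theorem PathDom.abs_valueAt_le {k : ℕ} {f : ℝ⟦X⟧} (hf : PathDom k f) :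
    ∃ B : ℝ, ∀ x, 0 ≤ x → x < (Real.exp 1)⁻¹ → |valueAt x f| ≤ B * valueAt x pathSeries ^ k := by
  obtain ⟨B, hB, hf⟩ := hf
  refine ⟨B, fun x hx hx' => ?_⟩
  have hv := ((convAt_pathSeries hx hx').pow k).of_norm.hasSum.mul_left B
  rw [← valueAt_pow (convAt_pathSeries hx hx')]
  refine tsum_of_norm_bounded (f := fun n => coeff n f * x ^ n) hv fun n => ?_
  rw [norm_mul, Real.norm_of_nonneg (pow_nonneg hx n), ← mul_assoc]
  exact mul_le_mul_of_nonneg_right (hf n) (pow_nonneg hx n)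

theorem HasLead.tendsto {k : ℕ} {c : ℝ} {f : ℝ⟦X⟧} (hf : HasLead k c f) :
    Tendsto (fun y => valueAt y f / valueAt y pathSeries ^ (k + 1))
      (nhdsWithin (Real.exp 1)⁻¹ (Set.Iio (Real.exp 1)⁻¹)) (nhds c) := by
  obtain ⟨B, hB⟩ := PathDom.abs_valueAt_le hf
  rw [tendsto_iff_norm_sub_tendsto_zero]
  refine squeeze_zero' (Eventually.of_forall fun _ => norm_nonneg _) ?_
    (by simpa using tendsto_inv_valueAt_pathSeries.const_mul B)
  filter_upwards [eventually_mem_Ioo_inv_exp] with y hy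
  have hv := valueAt_pathSeries_pos hy.1.le hy.2
  have h1 := hB y hy.1.le hy.2
  have hconv := PathDom.convAt hf hy.1.le hy.2
  have hcp := (convAt_pathSeries hy.1.le hy.2).pow (k + 1)
  have h2 : valueAt y f = valueAt y (f - C c * pathSeries ^ (k + 1)) +
      c * valueAt y pathSeries ^ (k + 1) := by
    conv_lhs => rw [← sub_add_cancel f (C c * pathSeries ^ (k + 1))]
    rw [valueAt_add hconv ((ConvAt.const c).mul hcp), valueAt_mul (ConvAt.const c) hcp, valueAt_C,
      valueAt_pow (convAt_pathSeries hy.1.le hy.2)]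
  rw [h2, add_div, mul_div_cancel_right₀ _ (by positivity), add_sub_cancel_right, norm_div,
    Real.norm_of_nonneg (by positivity : 0 ≤ valueAt y pathSeries ^ (k + 1)),
    div_le_iff₀ (by positivity), Real.norm_eq_abs]
  refine h1.trans (le_of_eq ?_)
  rw [pow_succ]
  field_simp

end Singularity

section Composition

open PowerSeries

theorem coeff_pow_eq_zero_of_lt {K : Type*} [CommRing K] {w : K⟦X⟧} (hw : constantCoeff w = 0)
    {n j : ℕ} (h : n < j) : coeff n (w ^ j) = 0 :=
  X_pow_dvd_iff.1 (pow_dvd_pow_of_dvd (X_dvd_iff.2 hw) j) n h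

variable {K : Type*} [CommRing K] [Algebra ℝ K]

/-- Substitution of a power series without constant term into real power series. -/
noncomputable def compHom (w : K⟦X⟧) (hw : constantCoeff w = 0) : ℝ⟦X⟧ →+* K⟦X⟧ :=
  (substAlgHom (R := ℝ) (HasSubst.of_constantCoeff_zero' hw)).toRingHom

theorem coeff_compHom (w : K⟦X⟧) (hw : constantCoeff w = 0) (h : ℝ⟦X⟧) (n : ℕ) :
    coeff n (compHom w hw h) =
      ∑ j ∈ Finset.range (n + 1), algebraMap ℝ K (coeff j h) * coeff n (w ^ j) := by
  have h1 : compHom w hw h = subst w h :=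
    congrFun (coe_substAlgHom (HasSubst.of_constantCoeff_zero' hw)) h
  rw [h1, coeff_subst' (HasSubst.of_constantCoeff_zero' hw), finsum_eq_sum_of_support_subset]
  · exact Finset.sum_congr rfl fun j _ => Algebra.smul_def _ _
  · intro j hj
    by_contra hlt
    refine hj ?_
    rw [Finset.mem_coe, Finset.mem_range, not_lt] at hlt
    simp only [coeff_pow_eq_zero_of_lt hw (Nat.lt_of_succ_le hlt), smul_zero]

theorem compHom_X (w : K⟦X⟧) (hw : constantCoeff w = 0) : compHom w hw X = w :=
  substAlgHom_X (HasSubst.of_constantCoeff_zero' hw)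

theorem compHom_C (w : K⟦X⟧) (hw : constantCoeff w = 0) (c : ℝ) :
    compHom w hw (C c) = C (algebraMap ℝ K c) := by
  ext n
  rw [coeff_compHom, Finset.sum_range_succ', Finset.sum_eq_zero]
  · rw [pow_zero, coeff_zero_C, coeff_C, coeff_one]
    split_ifs <;> simp
  · intro j _
    rw [coeff_C, if_neg (Nat.succ_ne_zero j), map_zero, zero_mul]

theorem map_compHom {L : Type*} [CommRing L] [Algebra ℝ L] (φ : K →ₐ[ℝ] L) (w : K⟦X⟧)
    (hw : constantCoeff w = 0) (w' : L⟦X⟧) (hw' : constantCoeff w' = 0)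
    (h : PowerSeries.map (φ : K →+* L) w = w') (f : ℝ⟦X⟧) :
    PowerSeries.map (φ : K →+* L) (compHom w hw f) = compHom w' hw' f := by
  ext n
  rw [coeff_map, coeff_compHom, coeff_compHom, map_sum]
  refine Finset.sum_congr rfl fun j _ => ?_
  rw [map_mul, ← h, ← map_pow, coeff_map]
  congr 1
  exact φ.commutes _

/-- The chain rule for a derivation scaling the substituted series. -/
theorem derivation_compHom (D : K⟦X⟧ →+ K⟦X⟧) (hmul : ∀ f g, D (f * g) = f * D g + g * D f)
    (hC : ∀ r : ℝ, D (C (algebraMap ℝ K r)) = 0) (w : K⟦X⟧) (hw : constantCoeff w = 0)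
    (c : ℝ) (hD : D w = C (algebraMap ℝ K c) * w) (h : ℝ⟦X⟧) :
    D (compHom w hw h) = compHom w hw (C c * theta ℝ h) := by
  have hX : theta ℝ X = X := by
    ext n
    rw [coeff_theta, coeff_X]
    split_ifs with hn <;> simp [hn]
  have key : ∀ N (h : ℝ⟦X⟧), w ^ N ∣ D (compHom w hw h) - compHom w hw (C c * theta ℝ h) := by
    intro N
    induction N with
    | zero => exact fun h => by rw [pow_zero]; exact one_dvd _
    | succ N ih =>
      intro h
      obtain ⟨r, hr⟩ := ih (PowerSeries.mk fun p => coeff (p + 1) h)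
      refine ⟨r, ?_⟩
      set g : ℝ⟦X⟧ := PowerSeries.mk fun p => coeff (p + 1) h
      have hh : h = X * g + C (constantCoeff h) := eq_X_mul_shift_add_const h
      have h2 : theta ℝ h = X * theta ℝ g + g * X := by
        rw [hh, map_add, theta_C, Derivation.leibniz, hX, smul_eq_mul, smul_eq_mul, add_zero]
      have h3 : D (compHom w hw h) = w * D (compHom w hw g) +
          compHom w hw g * (C (algebraMap ℝ K c) * w) := by
        rw [hh, map_add, compHom_C, map_add, hC, map_mul, compHom_X, hmul, hD, add_zero]
      rw [h2, h3, map_mul, map_add, map_mul, map_mul, compHom_C, compHom_X]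
      rw [map_mul, compHom_C] at hr
      linear_combination w * hr
  refine sub_eq_zero.1 (ext fun n => ?_)
  obtain ⟨r, hr⟩ := key (n + 1) h
  have h4 : (X : K⟦X⟧) ^ (n + 1) ∣ w ^ (n + 1) * r :=
    (pow_dvd_pow_of_dvd (X_dvd_iff.2 hw) _).mul_right _
  rw [hr, X_pow_dvd_iff.1 h4 n (Nat.lt_succ_self n), map_zero]

end Composition

section PolynomialGrowth

open PowerSeries

/-- The coefficients grow at most like the `k`-th power of the index. -/
def PolyGrowth (k : ℕ) (h : ℝ⟦X⟧) : Prop :=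
  ∃ B : ℝ, 0 ≤ B ∧ ∀ n, |coeff n h| ≤ B * ((n : ℝ) + 1) ^ k

namespace PolyGrowth

theorem mono {k l : ℕ} (hkl : k ≤ l) {h : ℝ⟦X⟧} (hh : PolyGrowth k h) : PolyGrowth l h := by
  obtain ⟨B, hB, hh⟩ := hh
  refine ⟨B, hB, fun n => (hh n).trans (mul_le_mul_of_nonneg_left ?_ hB)⟩
  exact pow_le_pow_right₀ (by linarith [n.cast_nonneg (α := ℝ)]) hkl

theorem neg {k : ℕ} {h : ℝ⟦X⟧} (hh : PolyGrowth k h) : PolyGrowth k (-h) := by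
  obtain ⟨B, hB, hh⟩ := hh
  exact ⟨B, hB, fun n => by rw [map_neg, abs_neg]; exact hh n⟩

theorem add {k : ℕ} {f g : ℝ⟦X⟧} (hf : PolyGrowth k f) (hg : PolyGrowth k g) :
    PolyGrowth k (f + g) := by
  obtain ⟨B, hB, hf⟩ := hf
  obtain ⟨D, hD, hg⟩ := hg
  refine ⟨B + D, add_nonneg hB hD, fun n => ?_⟩
  rw [map_add, add_mul]
  exact (abs_add_le _ _).trans (add_le_add (hf n) (hg n))

theorem C_mul {k : ℕ} (c : ℝ) {h : ℝ⟦X⟧} (hh : PolyGrowth k h) : PolyGrowth k (C c * h) := by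
  obtain ⟨B, hB, hh⟩ := hh
  refine ⟨|c| * B, mul_nonneg (abs_nonneg _) hB, fun n => ?_⟩
  rw [coeff_C_mul, abs_mul, mul_assoc]
  exact mul_le_mul_of_nonneg_left (hh n) (abs_nonneg _)

theorem mul {k l : ℕ} {f g : ℝ⟦X⟧} (hf : PolyGrowth k f) (hg : PolyGrowth l g) :
    PolyGrowth (k + l + 1) (f * g) := by
  obtain ⟨B, hB, hf⟩ := hf
  obtain ⟨D, hD, hg⟩ := hg
  refine ⟨B * D, mul_nonneg hB hD, fun n => ?_⟩
  rw [coeff_mul]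
  refine (Finset.abs_sum_le_sum_abs _ _).trans ?_
  refine (Finset.sum_le_card_nsmul _ _ (B * D * ((n : ℝ) + 1) ^ (k + l)) fun p hp => ?_).trans ?_
  · have h := Finset.HasAntidiagonal.mem_antidiagonal.1 hp
    have h1 : (p.1 : ℝ) ≤ n := by exact_mod_cast (by omega : p.1 ≤ n)
    have h2 : (p.2 : ℝ) ≤ n := by exact_mod_cast (by omega : p.2 ≤ n)
    rw [abs_mul]
    calc |coeff p.1 f| * |coeff p.2 g|
        ≤ (B * ((n : ℝ) + 1) ^ k) * (D * ((n : ℝ) + 1) ^ l) := by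
          refine mul_le_mul ((hf _).trans ?_) ((hg _).trans ?_) (abs_nonneg _) (by positivity)
          · gcongr
          · gcongr
      _ = B * D * ((n : ℝ) + 1) ^ (k + l) := by ring
  · rw [Finset.Nat.card_antidiagonal, nsmul_eq_mul]
    push_cast
    exact le_of_eq (by ring)

theorem theta {k : ℕ} {h : ℝ⟦X⟧} (hh : PolyGrowth k h) : PolyGrowth (k + 1) (theta ℝ h) := by
  obtain ⟨B, hB, hh⟩ := hh
  refine ⟨B, hB, fun n => ?_⟩
  rw [coeff_theta, abs_mul, Nat.abs_cast]
  calc (n : ℝ) * |coeff n h| ≤ ((n : ℝ) + 1) * (B * ((n : ℝ) + 1) ^ k) := by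
        refine mul_le_mul (by linarith) (hh n) (abs_nonneg _) (by positivity)
    _ = B * ((n : ℝ) + 1) ^ (k + 1) := by ring

theorem divide {k : ℕ} {h : ℝ⟦X⟧} (hh : PolyGrowth (k + 1) h) {m : ℕ} (hm : 1 ≤ m) :
    ∃ f, PolyGrowth k f ∧ C (m : ℝ) * f + C 2 * _root_.theta ℝ f = h := by
  obtain ⟨B, hB, hh⟩ := hh
  have hm' : (1 : ℝ) ≤ m := by exact_mod_cast hm
  have hpos : ∀ n : ℕ, (n : ℝ) + 1 ≤ (m : ℝ) + 2 * n := fun n => by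
    linarith [n.cast_nonneg (α := ℝ)]
  have hpos' : ∀ n : ℕ, (0 : ℝ) < (m : ℝ) + 2 * n := fun n => by
    linarith [n.cast_nonneg (α := ℝ)]
  refine ⟨PowerSeries.mk fun n => coeff n h / ((m : ℝ) + 2 * n), ⟨B, hB, fun n => ?_⟩, ?_⟩
  · rw [coeff_mk, abs_div, abs_of_pos (hpos' n), div_le_iff₀ (hpos' n)]
    calc |coeff n h| ≤ B * ((n : ℝ) + 1) ^ k * ((n : ℝ) + 1) := by
          rw [mul_assoc, ← pow_succ]
          exact hh n
      _ ≤ _ := mul_le_mul_of_nonneg_left (hpos n) (by positivity)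
  · ext n
    rw [map_add, coeff_C_mul, coeff_C_mul, coeff_theta, coeff_mk]
    have := (hpos' n).ne'
    field_simp

theorem C (c : ℝ) : PolyGrowth 0 (C c) := by
  refine ⟨|c|, abs_nonneg _, fun n => ?_⟩
  rw [coeff_C, pow_zero, mul_one]
  split_ifs
  · exact le_rfl
  · rw [abs_zero]
    exact abs_nonneg _

end PolyGrowth

end PolynomialGrowth

section GradedClass

open PowerSeries

variable {K : Type*} [CommRing K] [Algebra ℝ K]

/-- An additive map on power series which is a derivation killing the real constants. -/
structure IsRealDerivation (D : K⟦X⟧ →+ K⟦X⟧) : Prop where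
  leibniz : ∀ f g, D (f * g) = f * D g + g * D f
  const : ∀ r : ℝ, D (C (algebraMap ℝ K r)) = 0

theorem IsRealDerivation.pow {D : K⟦X⟧ →+ K⟦X⟧} (hD : IsRealDerivation D) {s : K⟦X⟧} {α : ℝ}
    (hs : D s = C (algebraMap ℝ K α) * s) (a : ℕ) :
    D (s ^ a) = C (algebraMap ℝ K (a * α)) * s ^ a := by
  induction a with
  | zero => simpa using hD.const 1
  | succ a ih =>
    rw [pow_succ, hD.leibniz, ih, hs]
    push_cast
    simp only [add_mul, one_mul, map_add]
    ring

/-- The additive group generated by the products `s ^ a * t ^ b * h (s * t)`, where the real power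
series `h` has coefficients growing at most like the `k`-th power of the index. -/
noncomputable def growthClass (s t : K⟦X⟧) (hw : constantCoeff (s * t) = 0) (k : ℕ) :
    AddSubgroup K⟦X⟧ :=
  AddSubgroup.closure {f | ∃ (a b : ℕ) (h : ℝ⟦X⟧), PolyGrowth k h ∧
    f = s ^ a * t ^ b * compHom (s * t) hw h}

namespace growthClass

variable {s t : K⟦X⟧} {hw : constantCoeff (s * t) = 0} {k l : ℕ} {f g : K⟦X⟧}

theorem of_monomial (a b : ℕ) {h : ℝ⟦X⟧} (hh : PolyGrowth k h) :
    s ^ a * t ^ b * compHom (s * t) hw h ∈ growthClass s t hw k :=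
  AddSubgroup.subset_closure ⟨a, b, h, hh, rfl⟩

theorem induction {P : K⟦X⟧ → Prop} (hf : f ∈ growthClass s t hw k)
    (hmon : ∀ (a b : ℕ) (h : ℝ⟦X⟧), PolyGrowth k h → P (s ^ a * t ^ b * compHom (s * t) hw h))
    (hadd : ∀ x y, P x → P y → P (x + y)) : P f := by
  refine AddSubgroup.closure_induction (p := fun x _ => P x ∧ P (-x)) ?_ ?_ ?_ ?_ hf |>.1
  · rintro x ⟨a, b, h, hh, rfl⟩
    refine ⟨hmon a b h hh, ?_⟩
    rw [← mul_neg, ← map_neg]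
    exact hmon a b _ hh.neg
  · have h0 := hmon 0 0 _ ((PolyGrowth.C 0).mono (Nat.zero_le k))
    rw [map_zero, map_zero, mul_zero] at h0
    rw [neg_zero]
    exact ⟨h0, h0⟩
  · intro x y _ _ hx hy
    rw [neg_add]
    exact ⟨hadd _ _ hx.1 hy.1, hadd _ _ hx.2 hy.2⟩
  · intro x _ hx
    rw [neg_neg]
    exact hx.symm

theorem mono (hkl : k ≤ l) (hf : f ∈ growthClass s t hw k) : f ∈ growthClass s t hw l :=
  induction (P := (· ∈ growthClass s t hw l)) hf
    (fun a b _ hh => of_monomial a b (hh.mono hkl)) fun _ _ => add_mem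

theorem monomial_mul (i j : ℕ) (hf : f ∈ growthClass s t hw k) :
    s ^ i * t ^ j * f ∈ growthClass s t hw k := by
  refine induction (P := (s ^ i * t ^ j * · ∈ growthClass s t hw k)) hf (fun a b h hh => ?_)
    fun x y hx hy => ?_
  · have := of_monomial (s := s) (t := t) (hw := hw) (i + a) (j + b) hh
    rw [pow_add, pow_add] at this
    convert this using 1
    ring
  · rw [mul_add]
    exact add_mem hx hy

theorem left_mul (hf : f ∈ growthClass s t hw k) : s * f ∈ growthClass s t hw k := by
  simpa using monomial_mul 1 0 hf

theorem right_mul (hf : f ∈ growthClass s t hw k) : t * f ∈ growthClass s t hw k := by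
  simpa using monomial_mul 0 1 hf

theorem compHom_mul {h : ℝ⟦X⟧} (hh : PolyGrowth l h) (hf : f ∈ growthClass s t hw k) :
    compHom (s * t) hw h * f ∈ growthClass s t hw (k + l + 1) := by
  refine induction (P := (compHom (s * t) hw h * · ∈ growthClass s t hw (k + l + 1))) hf
    (fun a b g hg => ?_) fun x y hx hy => ?_
  · have := of_monomial (s := s) (t := t) (hw := hw) a b (hg.mul hh)
    rw [map_mul] at this
    convert this using 1
    ring
  · rw [mul_add]
    exact add_mem hx hy

theorem mul (hf : f ∈ growthClass s t hw k) (hg : g ∈ growthClass s t hw l) :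
    f * g ∈ growthClass s t hw (k + l + 1) := by
  refine induction (P := (f * · ∈ growthClass s t hw (k + l + 1))) hg
    (fun a b h hh => ?_) fun x y hx hy => ?_
  · have := monomial_mul a b (compHom_mul hh hf)
    convert this using 1
    ring
  · rw [mul_add]
    exact add_mem hx hy

theorem C_mul (c : ℝ) (hf : f ∈ growthClass s t hw k) :
    C (algebraMap ℝ K c) * f ∈ growthClass s t hw k := by
  refine induction (P := (C (algebraMap ℝ K c) * · ∈ growthClass s t hw k)) hf
    (fun a b h hh => ?_) fun x y hx hy => ?_
  · have := of_monomial (s := s) (t := t) (hw := hw) a b (hh.C_mul c)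
    rw [map_mul, compHom_C] at this
    convert this using 1
    ring
  · rw [mul_add]
    exact add_mem hx hy

theorem natCast_mul (m : ℕ) (hf : f ∈ growthClass s t hw k) :
    (m : K⟦X⟧) * f ∈ growthClass s t hw k := by
  rw [← nsmul_eq_mul]
  exact nsmul_mem hf m

section

variable {D : K⟦X⟧ →+ K⟦X⟧} {α β : ℝ}

theorem derivation_monomial (hD : IsRealDerivation D) (hs : D s = C (algebraMap ℝ K α) * s)
    (ht : D t = C (algebraMap ℝ K β) * t) (a b : ℕ) (h : ℝ⟦X⟧) :
    D (s ^ a * t ^ b * compHom (s * t) hw h) = s ^ a * t ^ b *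
      compHom (s * t) hw (C (a * α + b * β) * h + C (α + β) * theta ℝ h) := by
  have hst : D (s * t) = C (algebraMap ℝ K (α + β)) * (s * t) := by
    rw [hD.leibniz, hs, ht, map_add, map_add]
    ring
  rw [hD.leibniz, hD.leibniz, hD.pow hs, hD.pow ht,
    derivation_compHom D hD.leibniz hD.const _ hw _ hst]
  simp only [map_add, map_mul, compHom_C]
  ring

theorem derivation (hD : IsRealDerivation D) (hs : D s = C (algebraMap ℝ K α) * s)
    (ht : D t = C (algebraMap ℝ K β) * t) (hf : f ∈ growthClass s t hw k) :
    D f ∈ growthClass s t hw (k + 1) := by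
  refine induction (P := (D · ∈ growthClass s t hw (k + 1))) hf (fun a b h hh => ?_)
    fun x y hx hy => ?_
  · rw [derivation_monomial hD hs ht]
    exact of_monomial a b (((hh.mono (Nat.le_succ k)).C_mul _).add (hh.theta.C_mul _))
  · rw [map_add]
    exact add_mem hx hy

theorem derivation_of_add_eq_zero (hD : IsRealDerivation D)
    (hs : D s = C (algebraMap ℝ K α) * s) (ht : D t = C (algebraMap ℝ K β) * t)
    (hαβ : α + β = 0) (hf : f ∈ growthClass s t hw k) : D f ∈ growthClass s t hw k := by
  refine induction (P := (D · ∈ growthClass s t hw k)) hf (fun a b h hh => ?_)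
    fun x y hx hy => ?_
  · rw [derivation_monomial hD hs ht, hαβ, map_zero, zero_mul, add_zero]
    exact of_monomial a b (hh.C_mul _)
  · rw [map_add]
    exact add_mem hx hy

theorem exists_derivation_add_eq (hD : IsRealDerivation D) (hs : D s = s) (ht : D t = t)
    {m : ℕ} (hm : 1 ≤ m) (hf : f ∈ growthClass s t hw (k + 1)) :
    ∃ g ∈ growthClass s t hw k, D g + (m : K⟦X⟧) * g = f := by
  refine induction (P := fun f => ∃ g ∈ growthClass s t hw k, D g + (m : K⟦X⟧) * g = f) hf
    (fun a b h hh => ?_) ?_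
  · obtain ⟨g, hg, hgh⟩ := hh.divide (m := m + (a + b)) (by omega)
    refine ⟨_, of_monomial a b hg, ?_⟩
    rw [derivation_monomial (α := 1) (β := 1) hD (by simpa using hs) (by simpa using ht), ← hgh]
    have h1 : (m : K⟦X⟧) = compHom (s * t) hw (C (m : ℝ)) := by
      rw [compHom_C, map_natCast, map_natCast]
    rw [h1, mul_left_comm, ← mul_add, ← map_mul, ← map_add]
    congr 2
    push_cast
    simp only [map_add, mul_one, one_add_one_eq_two]
    ring
  · rintro x y ⟨g, hg, rfl⟩ ⟨g', hg', rfl⟩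
    refine ⟨g + g', add_mem hg hg', ?_⟩
    rw [map_add]
    ring

end

end growthClass

end GradedClass

section BicolouredTrees

open PowerSeries

/-- The trees rooted at a vertex of the first colour. -/
noncomputable def xiTree : (Polynomial ℝ)⟦X⟧ := xiD (bicolSeries 0)

/-- The trees rooted at a vertex of the second colour. -/
noncomputable def etaTree : (Polynomial ℝ)⟦X⟧ := etaD (bicolSeries 0)

theorem coeff_xiD (f : (Polynomial ℝ)⟦X⟧) (n : ℕ) :
    coeff n (xiD f) = n * coeff n f - eulerDeriv (coeff n f) := by
  rw [xiD_apply, map_sub, coeff_theta, coeff_etaD]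

theorem coeff_zero_xiTree : coeff 0 xiTree = 0 := by
  rw [xiTree, coeff_xiD, coeff_zero_bicolSeries]
  simp

theorem coeff_zero_etaTree : coeff 0 etaTree = 0 := by
  rw [etaTree, coeff_etaD, coeff_zero_bicolSeries, map_zero]

theorem coeff_one_xiTree : coeff 1 xiTree = 1 := by
  rw [xiTree, coeff_xiD, coeff_one_bicolSeries_zero]
  simp [eulerDeriv]

theorem bicolSeries_zero_eq_trees : bicolSeries 0 = xiTree + etaTree - xiTree * etaTree := by
  have h := bicolSeries_zero_eq
  rw [← xiD_add_etaD, sub_eq_iff_eq_add] at h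
  rw [xiTree, etaTree, h]
  ring

theorem xiD_etaTree : xiD etaTree = etaD xiTree := xiD_etaD_comm _

theorem xiTree_eq : xiTree = (1 - etaTree) * xiD xiTree + (1 - xiTree) * etaD xiTree := by
  have h := congrArg xiD bicolSeries_zero_eq_trees
  rw [map_sub, map_add, Derivation.leibniz, xiD_etaTree, smul_eq_mul, smul_eq_mul] at h
  rw [xiTree] at h ⊢
  linear_combination h

theorem etaTree_eq : etaTree = (1 - etaTree) * etaD xiTree + (1 - xiTree) * etaD etaTree := by
  have h := congrArg etaD bicolSeries_zero_eq_trees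
  rw [map_sub, map_add, Derivation.leibniz, smul_eq_mul, smul_eq_mul] at h
  rw [etaTree] at h ⊢
  linear_combination h

/-- The derivation fixing both tree series. -/
noncomputable def sumD : (Polynomial ℝ)⟦X⟧ →+ (Polynomial ℝ)⟦X⟧ :=
  AddMonoidHom.mk' (fun f => (1 - etaTree) * xiD f + (1 - xiTree) * etaD f) fun f g => by
    rw [map_add, map_add]
    ring

/-- The derivation fixing the first tree series and negating the second. -/
noncomputable def diffD : (Polynomial ℝ)⟦X⟧ →+ (Polynomial ℝ)⟦X⟧ :=
  AddMonoidHom.mk' (fun f => (1 + etaTree) * xiD f - (1 + xiTree) * etaD f) fun f g => by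
    rw [map_add, map_add]
    ring

theorem sumD_apply (f : (Polynomial ℝ)⟦X⟧) :
    sumD f = (1 - etaTree) * xiD f + (1 - xiTree) * etaD f := rfl

theorem diffD_apply (f : (Polynomial ℝ)⟦X⟧) :
    diffD f = (1 + etaTree) * xiD f - (1 + xiTree) * etaD f := rfl

theorem etaD_C_algebraMap (r : ℝ) : etaD (C (algebraMap ℝ (Polynomial ℝ) r)) = 0 := by
  ext1 n
  rw [coeff_etaD, coeff_C]
  split_ifs
  · rw [Derivation.map_algebraMap, map_zero]
  · rw [map_zero, map_zero]

theorem xiD_C_algebraMap (r : ℝ) : xiD (C (algebraMap ℝ (Polynomial ℝ) r)) = 0 := by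
  rw [xiD_apply, etaD_C_algebraMap, sub_zero]
  ext1 n
  rw [coeff_theta, coeff_C]
  split_ifs with h
  · rw [h, Nat.cast_zero, zero_mul, map_zero]
  · rw [mul_zero, map_zero]

theorem isRealDerivation_sumD : IsRealDerivation sumD where
  leibniz f g := by
    simp only [sumD_apply, Derivation.leibniz, smul_eq_mul]
    ring
  const r := by
    rw [sumD_apply, etaD_C_algebraMap, xiD_C_algebraMap, mul_zero, mul_zero, add_zero]

theorem isRealDerivation_diffD : IsRealDerivation diffD where
  leibniz f g := by
    simp only [diffD_apply, Derivation.leibniz, smul_eq_mul]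
    ring
  const r := by
    rw [diffD_apply, etaD_C_algebraMap, xiD_C_algebraMap, mul_zero, mul_zero, sub_zero]

theorem sumD_xiTree : sumD xiTree = xiTree := xiTree_eq.symm

theorem sumD_etaTree : sumD etaTree = etaTree := by
  rw [sumD_apply, xiD_etaTree]
  exact etaTree_eq.symm

theorem coeff_mul_zero {K : Type*} [CommRing K] (f g : K⟦X⟧) :
    coeff 0 (f * g) = coeff 0 f * coeff 0 g := by
  simp

theorem coeff_mul_of_forall_lt {K : Type*} [CommRing K] (a : K⟦X⟧) {f : K⟦X⟧} {n : ℕ}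
    (hf : ∀ j < n, coeff j f = 0) : coeff n (a * f) = coeff 0 a * coeff n f := by
  rw [coeff_mul, Finset.sum_eq_single (0, n)]
  · intro p hp hne
    have h := Finset.HasAntidiagonal.mem_antidiagonal.1 hp
    rw [hf p.2 ?_, mul_zero]
    refine lt_of_le_of_ne (by omega) fun h' => hne ?_
    ext <;> simp <;> omega
  · intro h
    exact absurd (Finset.HasAntidiagonal.mem_antidiagonal.2 (zero_add n)) h

theorem coeff_sumD_of_forall_lt {f : (Polynomial ℝ)⟦X⟧} {n : ℕ} (hf : ∀ j < n, coeff j f = 0) :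
    coeff n (sumD f) = n * coeff n f := by
  rw [sumD_apply, map_add, coeff_mul_of_forall_lt, coeff_mul_of_forall_lt, coeff_xiD, coeff_etaD,
    map_sub, map_sub, coeff_zero_xiTree, coeff_zero_etaTree, coeff_zero_one]
  · ring
  · exact fun j hj => by rw [coeff_etaD, hf j hj, map_zero]
  · exact fun j hj => by rw [coeff_xiD, hf j hj, map_zero, mul_zero, sub_zero]

/-- A first-order equation for `sumD` has at most one solution with prescribed resonant
coefficient. -/
theorem eq_zero_of_mul_sumD_eq_mul {a b z : (Polynomial ℝ)⟦X⟧} (h : a * sumD z = b * z) (κ : ℤ)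
    (ha : coeff 0 a = 1) (hb : coeff 0 b = (κ : Polynomial ℝ))
    (hz : ∀ n : ℕ, (n : ℤ) ≤ κ → coeff n z = 0) : z = 0 := by
  ext1 n
  rw [map_zero]
  induction n using Nat.strong_induction_on with
  | _ n ih =>
    by_cases hn : (n : ℤ) ≤ κ
    · exact hz n hn
    have h1 := congrArg (coeff n) h
    rw [coeff_mul_of_forall_lt b ih, coeff_mul_of_forall_lt a, coeff_sumD_of_forall_lt ih, ha, hb,
      one_mul, ← sub_eq_zero, ← sub_mul] at h1
    · refine (mul_eq_zero.1 h1).resolve_left fun h2 => hn ?_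
      have h3 : ((n : ℤ) : Polynomial ℝ) = (κ : Polynomial ℝ) := by
        push_cast
        exact sub_eq_zero.1 h2
      exact (Int.cast_injective h3).le
    · intro j hj
      rw [coeff_sumD_of_forall_lt fun i hi => ih i (hi.trans hj), ih j hj, mul_zero]

theorem sumD_xiD_xiTree : sumD (xiD xiTree) = xiD xiTree + 2 * xiD xiTree * etaD xiTree := by
  have h := congrArg xiD xiTree_eq
  rw [map_add, Derivation.leibniz, Derivation.leibniz, map_sub, map_sub,
    Derivation.map_one_eq_zero, xiD_etaTree, xiD_etaD_comm] at h
  simp only [smul_eq_mul] at h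
  rw [sumD_apply]
  linear_combination -h

theorem sumD_etaD_xiTree :
    sumD (etaD xiTree) = etaD xiTree + etaD xiTree ^ 2 + xiD xiTree * etaD etaTree := by
  have h := congrArg etaD xiTree_eq
  rw [map_add, Derivation.leibniz, Derivation.leibniz, map_sub, map_sub,
    Derivation.map_one_eq_zero, ← xiD_etaD_comm] at h
  simp only [smul_eq_mul] at h
  rw [sumD_apply]
  linear_combination -h

theorem etaD_xiTree_eq : etaD xiTree = etaTree * xiD xiTree := by
  set z := etaD xiTree - etaTree * xiD xiTree with hz
  have hp0 : coeff 0 (xiD xiTree) = 0 := by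
    rw [coeff_xiD, coeff_zero_xiTree]
    simp
  have hK : (1 - xiTree) * sumD z = ((1 - xiTree) * (1 + z) -
      xiD xiTree * (1 - 2 * etaTree + xiTree * etaTree)) * z := by
    rw [hz, map_sub, isRealDerivation_sumD.leibniz, sumD_etaTree, sumD_xiD_xiTree,
      sumD_etaD_xiTree]
    linear_combination (-xiD xiTree) * etaTree_eq + xiD xiTree * etaTree * xiTree_eq
  have hz0 : coeff 0 z = 0 := by
    rw [hz, map_sub, coeff_etaD, coeff_zero_xiTree, map_zero, coeff_mul_zero, coeff_zero_etaTree,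
      zero_mul, sub_zero]
  have hz1 : coeff 1 z = 0 := by
    rw [hz, map_sub, coeff_etaD, coeff_one_xiTree, Derivation.map_one_eq_zero, coeff_mul,
      Finset.Nat.sum_antidiagonal_succ, Finset.HasAntidiagonal.antidiagonal_zero]
    simp [coeff_zero_etaTree, hp0]
  refine sub_eq_zero.1 (eq_zero_of_mul_sumD_eq_mul hK 1 ?_ ?_ fun n hn => ?_)
  · rw [map_sub, coeff_zero_xiTree, coeff_zero_one, sub_zero]
  · rw [map_sub, coeff_mul_zero, coeff_mul_zero, map_sub, map_add, hp0, hz0, coeff_zero_xiTree,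
      coeff_zero_one]
    simp
  · have : n ≤ 1 := by exact_mod_cast hn
    interval_cases n
    · exact hz0
    · exact hz1

theorem one_sub_mul_xiD_xiTree : (1 - xiTree * etaTree) * xiD xiTree = xiTree := by
  have h := xiTree_eq
  rw [etaD_xiTree_eq] at h
  linear_combination -h

theorem one_sub_mul_etaD_xiTree :
    (1 - xiTree * etaTree) * etaD xiTree = xiTree * etaTree := by
  rw [etaD_xiTree_eq]
  linear_combination etaTree * one_sub_mul_xiD_xiTree

theorem one_sub_xiTree_ne_zero : 1 - xiTree ≠ 0 := fun h => by
  have := congrArg (coeff 0) h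
  rw [map_sub, coeff_zero_xiTree, coeff_zero_one, sub_zero, map_zero] at this
  exact one_ne_zero this

theorem one_sub_mul_etaD_etaTree : (1 - xiTree * etaTree) * etaD etaTree = etaTree := by
  refine mul_left_cancel₀ one_sub_xiTree_ne_zero ?_
  linear_combination -(1 - xiTree * etaTree) * etaTree_eq -
    (1 - etaTree) * one_sub_mul_etaD_xiTree

theorem one_sub_mul_ne_zero : 1 - xiTree * etaTree ≠ 0 := fun h => by
  have := congrArg (coeff 0) h
  rw [map_sub, coeff_mul_zero, coeff_zero_xiTree, coeff_zero_one, zero_mul, sub_zero,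
    map_zero] at this
  exact one_ne_zero this

theorem diffD_xiTree : diffD xiTree = xiTree := by
  refine mul_left_cancel₀ one_sub_mul_ne_zero ?_
  rw [diffD_apply]
  linear_combination (1 + etaTree) * one_sub_mul_xiD_xiTree -
    (1 + xiTree) * one_sub_mul_etaD_xiTree

theorem diffD_etaTree : diffD etaTree = -etaTree := by
  refine mul_left_cancel₀ one_sub_mul_ne_zero ?_
  rw [diffD_apply, xiD_etaTree]
  linear_combination (1 + etaTree) * one_sub_mul_etaD_xiTree -
    (1 + xiTree) * one_sub_mul_etaD_etaTree

theorem two_mul_one_sub_mul_xiD (f : (Polynomial ℝ)⟦X⟧) :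
    2 * (1 - xiTree * etaTree) * xiD f = (1 + xiTree) * sumD f + (1 - xiTree) * diffD f := by
  rw [sumD_apply, diffD_apply]
  ring

theorem two_mul_one_sub_mul_etaD (f : (Polynomial ℝ)⟦X⟧) :
    2 * (1 - xiTree * etaTree) * etaD f = (1 + etaTree) * sumD f - (1 - etaTree) * diffD f := by
  rw [sumD_apply, diffD_apply]
  ring

end BicolouredTrees

section ImbalanceBound

open PowerSeries

theorem constantCoeff_xiTree_mul_etaTree : constantCoeff (xiTree * etaTree) = 0 := by
  rw [← coeff_zero_eq_constantCoeff_apply, coeff_mul_zero, coeff_zero_xiTree, zero_mul]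

/-- The growth class attached to the two tree series. -/
noncomputable abbrev treeClass (k : ℕ) : AddSubgroup (Polynomial ℝ)⟦X⟧ :=
  growthClass xiTree etaTree constantCoeff_xiTree_mul_etaTree k

/-- The inverse of `1 - xiTree * etaTree`. -/
noncomputable def cycleSeries : (Polynomial ℝ)⟦X⟧ :=
  compHom (xiTree * etaTree) constantCoeff_xiTree_mul_etaTree (PowerSeries.mk 1)

theorem one_sub_mul_cycleSeries : (1 - xiTree * etaTree) * cycleSeries = 1 := by
  have h := congrArg (compHom (xiTree * etaTree) constantCoeff_xiTree_mul_etaTree)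
    (mk_one_mul_one_sub_eq_one ℝ)
  rw [map_mul, map_sub, map_one, compHom_X, mul_comm] at h
  exact h

theorem polyGrowth_mk_one : PolyGrowth 0 (PowerSeries.mk 1) :=
  ⟨1, zero_le_one, fun n => by simp⟩

theorem cycleSeries_mul_mem {k : ℕ} {f : (Polynomial ℝ)⟦X⟧} (hf : f ∈ treeClass k) :
    cycleSeries * f ∈ treeClass (k + 1) := by
  rw [cycleSeries, ← add_zero k]
  exact growthClass.compHom_mul (l := 0) polyGrowth_mk_one hf

theorem sumD_mem {k : ℕ} {f : (Polynomial ℝ)⟦X⟧} (hf : f ∈ treeClass k) :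
    sumD f ∈ treeClass (k + 1) :=
  growthClass.derivation (α := 1) (β := 1) isRealDerivation_sumD (by simpa using sumD_xiTree)
    (by simpa using sumD_etaTree) hf

theorem diffD_mem {k : ℕ} {f : (Polynomial ℝ)⟦X⟧} (hf : f ∈ treeClass k) :
    diffD f ∈ treeClass k :=
  growthClass.derivation_of_add_eq_zero (α := 1) (β := -1) isRealDerivation_diffD
    (by simpa using diffD_xiTree) (by simpa using diffD_etaTree) (by norm_num) hf

theorem half_mul_two_mul (f : (Polynomial ℝ)⟦X⟧) :
    C (algebraMap ℝ (Polynomial ℝ) (1 / 2)) * (2 * f) = f := by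
  rw [← mul_assoc, (map_ofNat C 2).symm, ← map_ofNat (algebraMap ℝ (Polynomial ℝ)) 2, ← map_mul,
    ← map_mul]
  norm_num

theorem xiD_mem {k : ℕ} {f : (Polynomial ℝ)⟦X⟧} (hf : f ∈ treeClass k)
    (hf' : sumD f ∈ treeClass k) : xiD f ∈ treeClass (k + 1) := by
  have h : xiD f = C (algebraMap ℝ (Polynomial ℝ) (1 / 2)) * (cycleSeries *
      ((sumD f + xiTree * sumD f) + (diffD f - xiTree * diffD f))) := by
    rw [← half_mul_two_mul (xiD f)]
    congr 1
    linear_combination (-2 * xiD f) * one_sub_mul_cycleSeries +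
      cycleSeries * two_mul_one_sub_mul_xiD f
  rw [h]
  exact growthClass.C_mul _ (cycleSeries_mul_mem (add_mem
    (add_mem hf' (growthClass.left_mul hf'))
    (sub_mem (diffD_mem hf) (growthClass.left_mul (diffD_mem hf)))))

theorem etaD_mem {k : ℕ} {f : (Polynomial ℝ)⟦X⟧} (hf : f ∈ treeClass k)
    (hf' : sumD f ∈ treeClass k) : etaD f ∈ treeClass (k + 1) := by
  have h : etaD f = C (algebraMap ℝ (Polynomial ℝ) (1 / 2)) * (cycleSeries *
      ((sumD f + etaTree * sumD f) - (diffD f - etaTree * diffD f))) := by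
    rw [← half_mul_two_mul (etaD f)]
    congr 1
    linear_combination (-2 * etaD f) * one_sub_mul_cycleSeries +
      cycleSeries * two_mul_one_sub_mul_etaD f
  rw [h]
  exact growthClass.C_mul _ (cycleSeries_mul_mem (sub_mem
    (add_mem hf' (growthClass.right_mul hf'))
    (sub_mem (diffD_mem hf) (growthClass.right_mul (diffD_mem hf)))))

theorem eq_of_sumD_add_eq {f g : (Polynomial ℝ)⟦X⟧} (m : ℕ)
    (h : sumD f + (m : (Polynomial ℝ)⟦X⟧) * f = sumD g + (m : (Polynomial ℝ)⟦X⟧) * g)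
    (h0 : m = 0 → coeff 0 f = coeff 0 g) : f = g := by
  refine sub_eq_zero.1 (eq_zero_of_mul_sumD_eq_mul (a := 1) (b := -(m : (Polynomial ℝ)⟦X⟧))
    ?_ (-m) coeff_zero_one ?_ fun n hn => ?_)
  · rw [map_sub]
    linear_combination h
  · simp
  · obtain rfl : m = 0 := by omega
    obtain rfl : n = 0 := by omega
    rw [map_sub, h0 rfl, sub_self]

theorem sumD_bicolSeries_one :
    sumD (bicolSeries 1) = xiTree ^ 2 * etaTree ^ 2 * cycleSeries := by
  have h := bicolSeries_succ_eq 0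
  rw [Finset.Nat.sum_antidiagonal_succ, Finset.HasAntidiagonal.antidiagonal_zero,
    Finset.sum_singleton, ← xiD_add_etaD] at h
  have h1 : etaD xiTree = xiTree * etaTree * cycleSeries := by
    linear_combination cycleSeries * one_sub_mul_etaD_xiTree -
      etaD xiTree * one_sub_mul_cycleSeries
  have h2 := bicolSeries_zero_eq
  have h3 : xiD (etaD (bicolSeries 0)) = etaD xiTree := xiD_etaTree
  rw [h3, h1] at h
  simp only [zero_add, Nat.cast_zero] at h
  change _ = xiTree * etaTree at h2
  change _ = _ + (xiTree * _ + _ * etaTree) at h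
  rw [sumD_apply]
  linear_combination h - h2 + xiTree * etaTree * one_sub_mul_cycleSeries

theorem sumD_bicolSeries_add_two (k : ℕ) :
    sumD (bicolSeries (k + 2)) + ((k + 1 : ℕ) : (Polynomial ℝ)⟦X⟧) * bicolSeries (k + 2) =
      xiD (etaD (bicolSeries (k + 1))) - (xiD (bicolSeries (k + 1)) + etaD (bicolSeries (k + 1))) -
      (k : (Polynomial ℝ)⟦X⟧) * bicolSeries (k + 1) +
      ∑ p ∈ Finset.HasAntidiagonal.antidiagonal k,
        xiD (bicolSeries (p.1 + 1)) * etaD (bicolSeries (p.2 + 1)) := by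
  have h := bicolSeries_succ_eq (k + 1)
  rw [Finset.Nat.sum_antidiagonal_succ, Finset.Nat.sum_antidiagonal_succ', ← xiD_add_etaD,
    ← xiD_add_etaD] at h
  change _ = _ + (xiTree * _ + (_ * etaTree + _)) at h
  rw [sumD_apply]
  push_cast at h ⊢
  linear_combination h

theorem bicolSeries_succ_mem (k : ℕ) :
    bicolSeries (k + 1) ∈ treeClass (3 * k) ∧ sumD (bicolSeries (k + 1)) ∈ treeClass (3 * k) := by
  induction k using Nat.strong_induction_on with
  | _ k ih =>
    rcases k with _ | k
    · rw [zero_add, sumD_bicolSeries_one]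
      refine ⟨?_, growthClass.of_monomial 2 2 polyGrowth_mk_one⟩
      obtain ⟨g, hg, hgh⟩ := (polyGrowth_mk_one.mono (Nat.zero_le 1)).divide (m := 4) (by norm_num)
      have hmem := growthClass.of_monomial (s := xiTree) (t := etaTree)
        (hw := constantCoeff_xiTree_mul_etaTree) 2 2 hg
      convert hmem using 1
      refine eq_of_sumD_add_eq 0 ?_ fun _ => ?_
      · rw [Nat.cast_zero, zero_mul, zero_mul, add_zero, add_zero, sumD_bicolSeries_one,
          growthClass.derivation_monomial (α := 1) (β := 1) isRealDerivation_sumD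
            (by simpa using sumD_xiTree) (by simpa using sumD_etaTree), cycleSeries, ← hgh]
        norm_num
      · rw [coeff_zero_bicolSeries, pow_two, mul_assoc, mul_assoc, coeff_mul_zero,
          coeff_zero_xiTree, zero_mul]
    · have hxi : ∀ j ≤ k, xiD (bicolSeries (j + 1)) ∈ treeClass (3 * j + 1) := fun j hj =>
        xiD_mem (ih j (by omega)).1 (ih j (by omega)).2
      have heta : ∀ j ≤ k, etaD (bicolSeries (j + 1)) ∈ treeClass (3 * j + 1) := fun j hj =>
        etaD_mem (ih j (by omega)).1 (ih j (by omega)).2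
      have hR : sumD (bicolSeries (k + 2)) +
          ((k + 1 : ℕ) : (Polynomial ℝ)⟦X⟧) * bicolSeries (k + 2) ∈ treeClass (3 * k + 2 + 1) := by
        rw [sumD_bicolSeries_add_two]
        refine add_mem (sub_mem (sub_mem ?_ ?_) ?_) (sum_mem fun p hp => ?_)
        · exact xiD_mem (growthClass.mono (by omega) (heta k le_rfl)) (sumD_mem (heta k le_rfl))
        · exact growthClass.mono (by omega) (add_mem (hxi k le_rfl) (heta k le_rfl))
        · exact growthClass.natCast_mul _ (growthClass.mono (by omega) (ih k (by omega)).1)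
        · have hp' := Finset.HasAntidiagonal.mem_antidiagonal.1 hp
          exact growthClass.mono (by omega)
            (growthClass.mul (hxi p.1 (by omega)) (heta p.2 (by omega)))
      obtain ⟨g, hg, hgR⟩ := growthClass.exists_derivation_add_eq isRealDerivation_sumD sumD_xiTree
        sumD_etaTree (Nat.succ_le_succ (Nat.zero_le k)) hR
      have hgV := eq_of_sumD_add_eq (k + 1) hgR (by omega)
      rw [hgV] at hg
      refine ⟨growthClass.mono (by omega) hg, ?_⟩
      have h1 := sub_mem hR (growthClass.natCast_mul (k + 1) (growthClass.mono (l := 3 * k + 2 + 1)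
        (by omega) hg))
      rw [add_sub_cancel_right] at h1
      exact growthClass.mono (by omega) h1

end ImbalanceBound

section ForgettingColours

open PowerSeries

theorem PathDom.treeSeries_mul {k : ℕ} {f : ℝ⟦X⟧} (hf : PathDom (k + 1) f) :
    PathDom (k + 1) (treeSeries * f) := by
  obtain ⟨B, hB, hf⟩ := hf
  refine ⟨B, hB, fun n => ?_⟩
  have h1 : treeSeries * pathSeries ^ (k + 1) = pathSeries ^ (k + 1) - pathSeries ^ k := by
    linear_combination pathSeries ^ k * treeSeries_mul_pathSeries
  calc |coeff n (treeSeries * f)|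
      ≤ B * coeff n (treeSeries * pathSeries ^ (k + 1)) := by
        rw [coeff_mul, coeff_mul, Finset.mul_sum]
        refine (Finset.abs_sum_le_sum_abs _ _).trans (Finset.sum_le_sum fun p _ => ?_)
        rw [abs_mul, abs_of_nonneg (coeff_treeSeries_nonneg _), mul_left_comm]
        exact mul_le_mul_of_nonneg_left (hf _) (coeff_treeSeries_nonneg _)
    _ ≤ B * coeff n (pathSeries ^ (k + 1)) := by
        rw [h1, map_sub]
        exact mul_le_mul_of_nonneg_left (sub_le_self _ (coeff_pathSeries_pow_nonneg _ _)) hB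

theorem constantCoeff_treeSeries_mul_self : constantCoeff (treeSeries * treeSeries) = 0 := by
  rw [map_mul, constantCoeff_treeSeries, zero_mul]

/-- The inverse of `1 - treeSeries ^ 2`. -/
noncomputable def evenPathSeries : ℝ⟦X⟧ :=
  compHom (treeSeries * treeSeries) constantCoeff_treeSeries_mul_self (PowerSeries.mk 1)

theorem one_sub_mul_evenPathSeries : (1 - treeSeries * treeSeries) * evenPathSeries = 1 := by
  have h := congrArg (compHom (treeSeries * treeSeries) constantCoeff_treeSeries_mul_self)
    (mk_one_mul_one_sub_eq_one ℝ)
  rw [map_mul, map_sub, map_one, compHom_X, mul_comm] at h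
  exact h

theorem coeff_treeSeries_mul_self_pow_nonneg (j n : ℕ) :
    0 ≤ coeff n ((treeSeries * treeSeries) ^ j) := by
  induction j generalizing n with
  | zero => rw [pow_zero, coeff_one]; split_ifs <;> norm_num
  | succ j ih =>
    rw [pow_succ]
    exact coeff_mul_nonneg ih (coeff_mul_nonneg coeff_treeSeries_nonneg coeff_treeSeries_nonneg) n

theorem coeff_evenPathSeries_nonneg (n : ℕ) : 0 ≤ coeff n evenPathSeries := by
  rw [evenPathSeries, coeff_compHom]
  refine Finset.sum_nonneg fun j _ => mul_nonneg ?_ (coeff_treeSeries_mul_self_pow_nonneg j n)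
  simp

theorem pathDom_evenPathSeries : PathDom 1 evenPathSeries := by
  refine ⟨1, zero_le_one, fun n => ?_⟩
  have h : pathSeries ^ 1 = evenPathSeries + treeSeries * evenPathSeries := by
    linear_combination (1 + treeSeries) * evenPathSeries * one_sub_treeSeries_mul_pathSeries -
      pathSeries * one_sub_mul_evenPathSeries
  rw [abs_of_nonneg (coeff_evenPathSeries_nonneg n), one_mul, h, map_add]
  exact le_add_of_nonneg_right
    (coeff_mul_nonneg coeff_treeSeries_nonneg coeff_evenPathSeries_nonneg n)

theorem pathDom_evenPathSeries_pow (k : ℕ) : PathDom k (evenPathSeries ^ k) := by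
  induction k with
  | zero => simpa using PathDom.pow 0
  | succ k ih =>
    rw [pow_succ]
    exact ih.mul pathDom_evenPathSeries

theorem add_one_pow_le_factorial_mul_coeff (k n : ℕ) :
    ((n : ℝ) + 1) ^ k ≤ k.factorial * coeff n ((PowerSeries.mk 1 : ℝ⟦X⟧) ^ (k + 1)) := by
  rw [mk_one_pow_eq_mk_choose_add, coeff_mk]
  have h := Nat.pow_succ_le_ascFactorial (n + 1) k
  rw [Nat.ascFactorial_eq_factorial_mul_choose, add_comm n k] at h
  exact_mod_cast h

theorem PolyGrowth.pathDom_compHom {k : ℕ} {h : ℝ⟦X⟧} (hh : PolyGrowth k h) :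
    PathDom (k + 1)
      (compHom (treeSeries * treeSeries) constantCoeff_treeSeries_mul_self h) := by
  obtain ⟨B, hB, hh⟩ := hh
  obtain ⟨D, hD, hu⟩ := pathDom_evenPathSeries_pow (k + 1)
  refine ⟨B * k.factorial * D, by positivity, fun n => ?_⟩
  calc |coeff n (compHom (treeSeries * treeSeries) constantCoeff_treeSeries_mul_self h)|
      ≤ B * k.factorial * coeff n (evenPathSeries ^ (k + 1)) := by
        rw [evenPathSeries, ← map_pow, coeff_compHom, coeff_compHom, Finset.mul_sum]
        refine (Finset.abs_sum_le_sum_abs _ _).trans (Finset.sum_le_sum fun j _ => ?_)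
        rw [abs_mul, abs_of_nonneg (coeff_treeSeries_mul_self_pow_nonneg j n), ← mul_assoc]
        refine mul_le_mul_of_nonneg_right ?_ (coeff_treeSeries_mul_self_pow_nonneg j n)
        refine (hh j).trans ?_
        rw [mul_assoc]
        exact mul_le_mul_of_nonneg_left (add_one_pow_le_factorial_mul_coeff k j) hB
    _ ≤ B * k.factorial * (D * coeff n (pathSeries ^ (k + 1))) :=
        mul_le_mul_of_nonneg_left ((le_abs_self _).trans (hu n)) (by positivity)
    _ = _ := by ring

theorem forget_xiTree : forget xiTree = treeSeries := by
  rw [xiTree, forget_xiD_bicolSeries, evenSeries_zero, treeSeries]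

theorem forget_etaTree : forget etaTree = treeSeries := by
  rw [etaTree, forget_etaD_bicolSeries, evenSeries_zero, treeSeries]

theorem forget_compHom (h : ℝ⟦X⟧) :
    forget (compHom (xiTree * etaTree) constantCoeff_xiTree_mul_etaTree h) =
      compHom (treeSeries * treeSeries) constantCoeff_treeSeries_mul_self h := by
  refine map_compHom (Polynomial.aeval (1 : ℝ)) _ _ _ _ ?_ h
  rw [map_mul]
  exact congrArg₂ (· * ·) forget_xiTree forget_etaTree

theorem pathDom_forget {k : ℕ} {f : (Polynomial ℝ)⟦X⟧} (hf : f ∈ treeClass k) :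
    PathDom (k + 1) (forget f) := by
  refine growthClass.induction (P := fun f => PathDom (k + 1) (forget f)) hf
    (fun a b h hh => ?_) fun x y hx hy => by rw [map_add]; exact hx.add hy
  rw [map_mul, map_mul, map_pow, map_pow, forget_xiTree, forget_etaTree, forget_compHom, ← pow_add]
  generalize a + b = c
  induction c with
  | zero => simpa using hh.pathDom_compHom
  | succ c ih =>
    rw [pow_succ', mul_assoc]
    exact ih.treeSeries_mul

theorem one_add_treeSeries_mul_forget (f : (Polynomial ℝ)⟦X⟧) :
    (1 + treeSeries) * forget (xiD f - etaD f) = forget (diffD f) := by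
  have h : 2 * (1 - xiTree * etaTree) * (xiD f - etaD f) =
      (xiTree - etaTree) * sumD f + (2 - xiTree - etaTree) * diffD f := by
    linear_combination two_mul_one_sub_mul_xiD f - two_mul_one_sub_mul_etaD f
  have h1 := congrArg forget h
  simp only [map_mul, map_add, map_sub, map_one, map_ofNat, forget_xiTree, forget_etaTree] at h1 ⊢
  have h2 : 2 * ((1 + treeSeries) * (forget (xiD f) - forget (etaD f))) =
      2 * forget (diffD f) := by
    linear_combination pathSeries * h1 - (2 * (1 + treeSeries) * (forget (xiD f) -
      forget (etaD f)) - 2 * forget (diffD f)) * one_sub_treeSeries_mul_pathSeries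
  linear_combination C (1 / 2) * h2 - ((1 + treeSeries) * (forget (xiD f) - forget (etaD f)) -
    forget (diffD f)) * two_mul_C_half

theorem forget_sub_eq (f : (Polynomial ℝ)⟦X⟧) : forget (xiD f - etaD f) =
    evenPathSeries * (forget (diffD f) - treeSeries * forget (diffD f)) := by
  linear_combination (1 - treeSeries) * evenPathSeries * one_add_treeSeries_mul_forget f -
    forget (xiD f - etaD f) * one_sub_mul_evenPathSeries

theorem pathDom_imbalance_succ (k : ℕ) :
    PathDom (3 * k + 3) (forget (imbalance (bicolSeries (k + 1)))) := by
  obtain ⟨h1, h2⟩ := bicolSeries_succ_mem k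
  have h3 := pathDom_forget (diffD_mem (sub_mem (xiD_mem h1 h2) (etaD_mem h1 h2)))
  rw [imbalance, forget_sub_eq]
  exact (pathDom_evenPathSeries.mul (h3.sub h3.treeSeries_mul)).mono (by omega)

theorem pathDom_imbalance_zero :
    PathDom 1 (pathSeries * forget (imbalance (bicolSeries 0))) := by
  have h1 : forget (imbalance (bicolSeries 0)) =
      evenPathSeries * ((1 - treeSeries) * (2 * treeSeries)) := by
    rw [imbalance, forget_sub_eq]
    change evenPathSeries * (forget (diffD (xiTree - etaTree)) -
      treeSeries * forget (diffD (xiTree - etaTree))) = _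
    rw [map_sub, diffD_xiTree, diffD_etaTree, map_sub, map_neg, forget_xiTree, forget_etaTree]
    ring
  have h2 : pathSeries * forget (imbalance (bicolSeries 0)) =
      C 2 * (treeSeries * evenPathSeries) := by
    rw [h1, map_ofNat C 2]
    linear_combination 2 * treeSeries * evenPathSeries * one_sub_treeSeries_mul_pathSeries
  rw [h2]
  exact pathDom_evenPathSeries.treeSeries_mul.const_mul 2

end ForgettingColours

section Ratio

open PowerSeries

theorem hasLead_allSeries {k : ℕ} (hk : 1 ≤ k) :
    HasLead (3 * k - 1) (leadCoeff k / (3 * k)) (allSeries (k + 1)) := by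
  have h := (hasLead_of_recurrence (a := 1 / 2) (b := -(1 / 2)) (U := allSeries) (E := 0) rfl
    ?_ (fun k => ?_) (fun k => ?_) k).2 hk
  · simpa using h
  · simpa using (PathDom.const 0).mono zero_le_one
  · simpa using (PathDom.const 0).mono (Nat.zero_le (3 * k + 3))
  · rw [allSeries_succ_eq, map_neg, Pi.zero_apply]
    ring

theorem hasLead_evenSeries {k : ℕ} (hk : 1 ≤ k) :
    HasLead (3 * k - 1) ((1 / 2) ^ (k + 1) * leadCoeff k / (3 * k)) (evenSeries (k + 1)) := by
  have h := (hasLead_of_recurrence (a := 1 / 4) (b := 0) (U := evenSeries)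
    (E := fun k => -(C (1 / 8) * forget (imbalance (bicolSeries k)))) evenSeries_zero
    ?_ (fun k => ?_) (fun k => ?_) k).2 hk
  · rwa [show (2 : ℝ) * (1 / 4) = 1 / 2 by norm_num] at h
  · have := (pathDom_imbalance_zero.const_mul (1 / 8)).neg
    rwa [mul_left_comm, ← mul_neg] at this
  · exact ((pathDom_imbalance_succ k).const_mul (1 / 8)).neg
  · rw [evenSeries_succ_eq, map_zero]
    ring

theorem Sgen_eq (ℓ : ℕ) (x : ℝ) : Sgen ℓ x = valueAt x (allSeries (ℓ + 1)) :=
  tsum_congr fun n => by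
    rw [coeff_allSeries, div_mul_eq_mul_div, ← add_assoc, Nat.add_sub_cancel]

theorem SgenE_eq (ℓ : ℕ) (x : ℝ) : SgenE ℓ x = valueAt x (evenSeries (ℓ + 1)) :=
  tsum_congr fun n => by
    rw [coeff_evenSeries, div_mul_eq_mul_div, ← add_assoc, Nat.add_sub_cancel]

theorem valueAt_pos {f : ℝ⟦X⟧} (hf : ∀ n, 0 ≤ coeff n f) (h0 : f ≠ 0) {x : ℝ} (hx : 0 < x)
    (hc : ConvAt x f) : 0 < valueAt x f := by
  obtain ⟨n, hn⟩ : ∃ n, coeff n f ≠ 0 := by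
    by_contra! h
    exact h0 (ext fun n => by rw [h n, map_zero])
  exact (Summable.of_norm hc).tsum_pos (fun i => mul_nonneg (hf i) (pow_nonneg hx.le i)) n
    (mul_pos (lt_of_le_of_ne (hf n) hn.symm) (pow_pos hx n))

theorem allSeries_succ_ne_zero {k : ℕ} (hk : 1 ≤ k) : allSeries (k + 1) ≠ 0 := fun h => by
  have h1 := (hasLead_allSeries hk).tendsto
  have h2 : ∀ y, valueAt y (0 : ℝ⟦X⟧) = 0 := fun y => by simp [valueAt]
  simp only [h, h2, zero_div] at h1
  have h3 := tendsto_nhds_unique h1 tendsto_const_nhds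
  have h4 : (0 : ℝ) < k := by exact_mod_cast hk
  have := leadCoeff_pos k
  have : 0 < leadCoeff k / (3 * k) := by positivity
  exact this.ne' h3

end Ratio

/-- for fixed `ℓ ≥ 1`, both series converge for `0 < x < 1/e`, `S_ℓ(x) > 0`
there, and `S^e_ℓ(x)/S_ℓ(x) → 1/2^{ℓ+1}` as `x → 1/e` from the left. -/
theorem ratio_even_to_all_connected (ℓ : ℕ) (hℓ : 1 ≤ ℓ) :
    (∀ x : ℝ, 0 < x → x < (Real.exp 1)⁻¹ →
      Summable (fun n : ℕ => (Cconn n (n + ℓ) : ℝ) * x ^ n / n.factorial) ∧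
      Summable (fun n : ℕ => (CconnE n (n + ℓ) : ℝ) * x ^ n / n.factorial) ∧
      0 < Sgen ℓ x) ∧
    Tendsto (fun x : ℝ => SgenE ℓ x / Sgen ℓ x)
      (nhdsWithin (Real.exp 1)⁻¹ (Set.Iio (Real.exp 1)⁻¹))
      (nhds (1 / 2 ^ (ℓ + 1))) := by
  have hA := hasLead_allSeries hℓ
  have hE := hasLead_evenSeries hℓ
  refine ⟨fun x hx hx' => ⟨?_, ?_, ?_⟩, ?_⟩
  · refine (Summable.of_norm (hA.pathDom.convAt hx.le hx')).congr fun n => ?_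
    rw [coeff_allSeries, div_mul_eq_mul_div, ← add_assoc, Nat.add_sub_cancel]
  · refine (Summable.of_norm (hE.pathDom.convAt hx.le hx')).congr fun n => ?_
    rw [coeff_evenSeries, div_mul_eq_mul_div, ← add_assoc, Nat.add_sub_cancel]
  · rw [Sgen_eq]
    refine valueAt_pos (fun n => ?_) (allSeries_succ_ne_zero hℓ) hx (hA.pathDom.convAt hx.le hx')
    rw [coeff_allSeries]
    positivity
  · have h1 : (0 : ℝ) < ℓ := by exact_mod_cast hℓ
    have h2 : 0 < leadCoeff ℓ / (3 * ℓ) := div_pos (leadCoeff_pos ℓ) (by positivity)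
    have h3 := hE.tendsto.div hA.tendsto h2.ne'
    have h4 : (1 / 2) ^ (ℓ + 1) * leadCoeff ℓ / (3 * ℓ) / (leadCoeff ℓ / (3 * ℓ)) =
        1 / 2 ^ (ℓ + 1) := by
      rw [mul_div_assoc, mul_div_cancel_right₀ _ h2.ne', one_div_pow]
    rw [h4] at h3
    refine h3.congr' ?_
    filter_upwards [eventually_mem_Ioo_inv_exp] with y hy
    rw [Sgen_eq, SgenE_eq, Pi.div_apply]
    exact div_div_div_cancel_right₀ (pow_pos (valueAt_pathSeries_pos hy.1.le hy.2) _).ne' _ _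
end

section
/- For all real numbers a, b ≥ 0: (1/2)^{a+b+2}/(a+b+2) ≤ Γ(a+1)Γ(b+1)/Γ(a+b+2) ≤ a^a·b^b/(a+b)^{a+b} ≤ 1, where in the middle expression the convention 0^0 = 1 is used (so for a = b = 0 the right-hand bound equals 1). -/
/-- Euler's integral for the Beta function, as a real interval integral. -/
theorem Real.Gamma_mul_Gamma_div_Gamma_eq_integral {a b : ℝ} (ha : 0 ≤ a) (hb : 0 ≤ b) :
    Real.Gamma (a + 1) * Real.Gamma (b + 1) / Real.Gamma (a + b + 2) =
      ∫ x in (0 : ℝ)..1, x ^ a * (1 - x) ^ b := by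
  have h := ProbabilityTheory.beta_eq_betaIntegralReal (a + 1) (b + 1) (by linarith) (by linarith)
  rw [ProbabilityTheory.beta, show a + 1 + (b + 1) = a + b + 2 by ring] at h
  rw [h, Complex.betaIntegral, ← Complex.ofReal_re (∫ x in (0 : ℝ)..1, x ^ a * (1 - x) ^ b),
    ← intervalIntegral.integral_ofReal]
  congr 1
  refine intervalIntegral.integral_congr fun x hx ↦ ?_
  rw [Set.uIcc_of_le zero_le_one] at hx
  have hx1 : 0 ≤ 1 - x := sub_nonneg.2 hx.2
  push_cast
  rw [Complex.ofReal_cpow hx.1, Complex.ofReal_cpow hx1]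
  push_cast
  simp

theorem Real.rpow_mul_one_sub_rpow_intervalIntegrable {a b : ℝ} (ha : 0 ≤ a) (hb : 0 ≤ b)
    (u v : ℝ) :
    IntervalIntegrable (fun x : ℝ ↦ x ^ a * (1 - x) ^ b) MeasureTheory.volume u v :=
  ((continuous_id.rpow_const fun _ ↦ Or.inr ha).mul
    ((continuous_const.sub continuous_id).rpow_const fun _ ↦ Or.inr hb)).intervalIntegrable u v

/-- The maximum of `x ^ a * y ^ b` on the simplex `x + y = 1`. -/
theorem Real.rpow_mul_rpow_le_of_add_eq_one {a b x y : ℝ} (ha : 0 ≤ a) (hb : 0 ≤ b)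
    (hx : 0 ≤ x) (hy : 0 ≤ y) (hxy : x + y = 1) :
    x ^ a * y ^ b ≤ a ^ a * b ^ b / (a + b) ^ (a + b) := by
  rcases ha.eq_or_lt with rfl | ha
  · rcases hb.eq_or_lt with rfl | hb
    · simp
    · have h1 : y ^ b ≤ 1 := Real.rpow_le_one hy (by linarith) hb.le
      have h2 : b ^ b ≠ 0 := (Real.rpow_pos_of_pos hb b).ne'
      simpa [h2] using h1
  rcases hb.eq_or_lt with rfl | hb
  · have h1 : x ^ a ≤ 1 := Real.rpow_le_one hx (by linarith) ha.le
    have h2 : a ^ a ≠ 0 := (Real.rpow_pos_of_pos ha a).ne'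
    simpa [h2] using h1
  have hs : 0 < a + b := add_pos ha hb
  have key := Real.geom_mean_le_arith_mean2_weighted (div_pos ha hs).le (div_pos hb hs).le
    (mul_nonneg hs.le (div_nonneg hx ha.le)) (mul_nonneg hs.le (div_nonneg hy hb.le))
    (by field_simp)
  have hr : a / (a + b) * ((a + b) * (x / a)) + b / (a + b) * ((a + b) * (y / b)) = 1 := by
    rw [← hxy]; field_simp
  rw [hr] at key
  have h := Real.rpow_le_one (by positivity) key hs.le
  rw [Real.mul_rpow (by positivity) (by positivity), ← Real.rpow_mul (by positivity),
    ← Real.rpow_mul (by positivity), div_mul_cancel₀ _ hs.ne', div_mul_cancel₀ _ hs.ne',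
    Real.mul_rpow hs.le (by positivity), Real.mul_rpow hs.le (by positivity),
    Real.div_rpow hx ha.le, Real.div_rpow hy hb.le] at h
  have hA := Real.rpow_pos_of_pos ha a
  have hB := Real.rpow_pos_of_pos hb b
  rw [le_div_iff₀ (Real.rpow_pos_of_pos hs _), Real.rpow_add hs]
  calc x ^ a * y ^ b * ((a + b) ^ a * (a + b) ^ b)
      = (a + b) ^ a * (x ^ a / a ^ a) * ((a + b) ^ b * (y ^ b / b ^ b)) * (a ^ a * b ^ b) := by
        field_simp
    _ ≤ 1 * (a ^ a * b ^ b) := by gcongr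
    _ = a ^ a * b ^ b := one_mul _

theorem Real.rpow_self_mul_rpow_self_le {a b : ℝ} (ha : 0 ≤ a) (hb : 0 ≤ b) :
    a ^ a * b ^ b ≤ (a + b) ^ (a + b) := by
  rw [Real.rpow_add_of_nonneg (add_nonneg ha hb) ha hb]
  exact mul_le_mul (Real.rpow_le_rpow ha (by linarith) ha) (Real.rpow_le_rpow hb (by linarith) hb)
    (by positivity) (by positivity)

theorem Real.half_rpow_div_le_integral_rpow_mul_one_sub_rpow {a b : ℝ} (ha : 0 ≤ a) (hb : 0 ≤ b) :
    (1 / 2 : ℝ) ^ (a + b + 1) / (a + b + 1) ≤ ∫ x in (0 : ℝ)..1, x ^ a * (1 - x) ^ b := by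
  have hI := Real.rpow_mul_one_sub_rpow_intervalIntegrable ha hb
  have hs : 0 ≤ a + b := add_nonneg ha hb
  calc (1 / 2 : ℝ) ^ (a + b + 1) / (a + b + 1) = ∫ x in (0 : ℝ)..(1 / 2), x ^ (a + b) := by
        rw [integral_rpow (Or.inl (by linarith)), Real.zero_rpow (by linarith), sub_zero]
    _ ≤ ∫ x in (0 : ℝ)..(1 / 2), x ^ a * (1 - x) ^ b := by
        refine intervalIntegral.integral_mono_on (by norm_num)
          (intervalIntegral.intervalIntegrable_rpow' (by linarith)) (hI _ _) fun x hx ↦ ?_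
        rw [Real.rpow_add_of_nonneg hx.1 ha hb]
        exact mul_le_mul_of_nonneg_left
          (Real.rpow_le_rpow hx.1 (by linarith [hx.2]) hb) (Real.rpow_nonneg hx.1 _)
    _ ≤ (∫ x in (0 : ℝ)..(1 / 2), x ^ a * (1 - x) ^ b) +
          ∫ x in (1 / 2 : ℝ)..1, x ^ a * (1 - x) ^ b :=
        le_add_of_nonneg_right <| intervalIntegral.integral_nonneg (by norm_num) fun x hx ↦
          mul_nonneg (Real.rpow_nonneg (by linarith [hx.1]) _)
            (Real.rpow_nonneg (by linarith [hx.2]) _)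
    _ = ∫ x in (0 : ℝ)..1, x ^ a * (1 - x) ^ b :=
        intervalIntegral.integral_add_adjacent_intervals (hI _ _) (hI _ _)

/-- for real `a, b ≥ 0`,
`(1/2)^{a+b+2}/(a+b+2) ≤ Γ(a+1)Γ(b+1)/Γ(a+b+2) ≤ a^a b^b/(a+b)^{a+b} ≤ 1`, with the
`rpow` convention `0^0 = 1`. -/
theorem gamma_ratio_bounds (a b : ℝ) (ha : 0 ≤ a) (hb : 0 ≤ b) :
    (1 / 2 : ℝ) ^ (a + b + 2) / (a + b + 2) ≤
        Real.Gamma (a + 1) * Real.Gamma (b + 1) / Real.Gamma (a + b + 2) ∧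
      Real.Gamma (a + 1) * Real.Gamma (b + 1) / Real.Gamma (a + b + 2) ≤
        a ^ a * b ^ b / (a + b) ^ (a + b) ∧
      a ^ a * b ^ b / (a + b) ^ (a + b) ≤ 1 := by
  rw [Real.Gamma_mul_Gamma_div_Gamma_eq_integral ha hb]
  refine ⟨le_trans ?_ (Real.half_rpow_div_le_integral_rpow_mul_one_sub_rpow ha hb), ?_,
    div_le_one_of_le₀ (Real.rpow_self_mul_rpow_self_le ha hb) (by positivity)⟩
  · exact div_le_div₀ (by positivity)
      (Real.rpow_le_rpow_of_exponent_ge (by norm_num) (by norm_num) (by linarith))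
      (by positivity) (by linarith)
  · calc ∫ x in (0 : ℝ)..1, x ^ a * (1 - x) ^ b
        ≤ ∫ _ in (0 : ℝ)..1, a ^ a * b ^ b / (a + b) ^ (a + b) :=
          intervalIntegral.integral_mono_on zero_le_one
            (Real.rpow_mul_one_sub_rpow_intervalIntegrable ha hb 0 1)
            intervalIntegrable_const fun x hx ↦
              Real.rpow_mul_rpow_le_of_add_eq_one ha hb hx.1 (sub_nonneg.2 hx.2)
                (add_sub_cancel x 1)
      _ = a ^ a * b ^ b / (a + b) ^ (a + b) := by simp
end
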